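/- arXiv:1004.2614 — 4 statements merged into one kernel-verified Lean document; each statement's English description precedes it below -/
import Mathlib

section
/- Let d ≥ 3, n, m ≥ 1, and let s_1 be the largest multiple of (n+1) at most ⌊(n+1)·C(m+d,d)/(m+n+1)⌋ and s_2 the smallest multiple of (n+1) at least ⌈(n+1)·C(m+d,d)/(m+n+1)⌉. Then the d-uple Veronese embedding of P^m is not (n, s−1)-Grassmann defective for any s ≤ s_1 and any s ≥ s_2. -/
open MvPolynomial

noncomputable section

/-- The (radical, homogeneous for cones) vanishing ideal of a set `S` of vectors. -/
def vIdeal (K : Type) [Field K] {ι : Type} (S : Set (ι → K)) : Ideal (MvPolynomial ι K) :=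
  ⨅ x ∈ S, RingHom.ker (MvPolynomial.eval x)

/-- Krull dimension of the homogeneous coordinate ring of the (Zariski closure of the)
cone `S`; for a projective variety of dimension `D` this equals `D + 1`. -/
def coneKrullDim (K : Type) [Field K] {ι : Type} (S : Set (ι → K)) : WithBot ℕ∞ :=
  ringKrullDim (MvPolynomial ι K ⧸ vIdeal K S)

/-- The projective variety whose affine cone is the Zariski closure of `S` has
dimension `D` (dimension of a projective variety = Krull dimension of its homogeneous
coordinate ring minus one). -/
def HasProjDim (K : Type) [Field K] {ι : Type} (S : Set (ι → K)) (D : ℕ) : Prop :=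
  coneKrullDim K S = ((D : ℕ∞) : WithBot ℕ∞) + 1

/-- The affine cone over the `s`-th secant variety `σ_s(X)` of the projective variety
with affine cone `C`: (the closure of) the set of sums of `s` elements of `C`.
Since `C` is a cone, sums of `s` elements of `C` are exactly the vectors lying on the
cone over the linear span of `s` points of `X`.  (Taking the Zariski closure does not
change the vanishing ideal, hence does not change the dimension.) -/
def secantCone (K : Type) [Field K] {ι : Type} (C : Set (ι → K)) (s : ℕ) : Set (ι → K) :=
  { y | ∃ x : Fin s → (ι → K), (∀ i, x i ∈ C) ∧ y = ∑ i, x i }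

/-- The affine cone over the Segre–Veronese variety `X^{(n,m)}_{(1,d)}`, the image of
`P^n × P^m` embedded by `O(1,d)` in `P^N`, `N = (n+1)·C(m+d,d) − 1`.  Coordinates of the
ambient `P^N` are indexed by pairs (coordinate of `P^n`, monomial of degree `d` in the
`m+1` coordinates of `P^m`); there are `(n+1)·C(m+d,d)` of them. -/
def svCone (K : Type) [Field K] (n m d : ℕ) :
    Set ((Fin (n + 1) × { μ : Fin (m + 1) → ℕ // ∑ i, μ i = d }) → K) :=
  { v | ∃ (a : Fin (n + 1) → K) (b : Fin (m + 1) → K),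
      v = fun p => a p.1 * ∏ i, b i ^ (p.2.1 i) }

/-- The `d`-uple Veronese embedding `X ⊂ P^M` of `P^m` is `(n, s-1)`-Grassmann defective.
Following the equivalence of Dionisi–Fontanari (after Terracini) this holds if and only
if the `s`-th secant variety of the Segre–Veronese embedding `X^{(n,m)}_{(1,d)}` of
`P^n × P^m` by `O(1,d)` is `(s-1)`-defective, i.e. its dimension is strictly smaller
than the expected dimension `min {N, s(n+m+1) − 1}`, `N = (n+1)·C(m+d,d) − 1`;
we take this characterization as the definition. -/
def GrassmannDefective (K : Type) [Field K] (n m d s : ℕ) : Prop :=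
  coneKrullDim K (secantCone K (svCone K n m d) s)
    < (((min ((n + 1) * ((m + d).choose d) - 1) (s * (n + m + 1) - 1) : ℕ) : ℕ∞) :
        WithBot ℕ∞) + 1

/-- The property `S` holds on a nonempty Zariski open subset of `K ^ ι`. -/
def Generically {K ι : Type*} [Field K] (S : (ι → K) → Prop) : Prop :=
  ∃ P : MvPolynomial ι K, P ≠ 0 ∧ ∀ x, eval x P ≠ 0 → S x

namespace Generically

variable {K ι : Type*} [Field K]

lemma and {S S' : (ι → K) → Prop} (h : Generically S) (h' : Generically S') :
    Generically fun x => S x ∧ S' x := by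
  obtain ⟨P, hP, hS⟩ := h
  obtain ⟨P', hP', hS'⟩ := h'
  refine ⟨P * P', mul_ne_zero hP hP', fun x hx => ?_⟩
  rw [map_mul] at hx
  exact ⟨hS x (left_ne_zero_of_mul hx), hS' x (right_ne_zero_of_mul hx)⟩

lemma forall_finite {α : Type*} [Finite α] {S : α → (ι → K) → Prop}
    (h : ∀ a, Generically (S a)) : Generically fun x => ∀ a, S a x := by
  cases nonempty_fintype α
  choose P hP hS using h
  refine ⟨∏ a, P a, Finset.prod_ne_zero_iff.2 fun a _ => hP a, fun x hx a => hS a x ?_⟩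
  rw [map_prod] at hx
  exact Finset.prod_ne_zero_iff.1 hx a (Finset.mem_univ a)

lemma exists_point [Infinite K] {S : (ι → K) → Prop} (h : Generically S) : ∃ x, S x := by
  obtain ⟨P, hP, hS⟩ := h
  by_contra! hx
  refine hP (MvPolynomial.funext fun x => ?_)
  by_contra hne
  exact hx x (hS x (by simpa using hne))

lemma coord_ne_zero (i : ι) : Generically fun x : ι → K => x i ≠ 0 :=
  ⟨X i, X_ne_zero i, fun x hx => by simpa using hx⟩

end Generically

section Rank

variable {K V W : Type*} [Field K] [AddCommGroup V] [Module K V] [AddCommGroup W] [Module K W]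

/-- A linear map of rank at least `r` restricts and projects to the identity of `K ^ r`. -/
lemma exists_comp_eq_id_of_le_finrank_range (f : V →ₗ[K] W) {r : ℕ}
    (h : r ≤ Module.finrank K (LinearMap.range f)) :
    ∃ (A : W →ₗ[K] (Fin r → K)) (B : (Fin r → K) →ₗ[K] V), A ∘ₗ f ∘ₗ B = LinearMap.id := by
  obtain ⟨v, hv⟩ := exists_linearIndependent_of_le_finrank h
  choose w hw using fun i => (v i).2
  let B : (Fin r → K) →ₗ[K] V := Fintype.linearCombination K w
  have hinj : LinearMap.ker (f ∘ₗ B) = ⊥ := by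
    have h2 : LinearIndependent K fun i => f (w i) := by
      rw [show (fun i => f (w i)) = (LinearMap.range f).subtype ∘ v from funext hw]
      exact hv.map' _ (Submodule.ker_subtype _)
    rw [LinearMap.ker_eq_bot']
    intro c hc
    rw [Fintype.linearIndependent_iff] at h2
    funext i
    refine h2 c ?_ i
    simpa [B, Fintype.linearCombination_apply, map_sum] using hc
  obtain ⟨A, hA⟩ := LinearMap.exists_leftInverse_of_injective _ hinj
  exact ⟨A, B, hA⟩

lemma le_finrank_range_of_injective_comp [Module.Finite K W] (f : V →ₗ[K] W) {r : ℕ}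
    (A : W →ₗ[K] (Fin r → K)) (B : (Fin r → K) →ₗ[K] V)
    (h : Function.Injective (A ∘ₗ f ∘ₗ B)) : r ≤ Module.finrank K (LinearMap.range f) := by
  have hinj : Function.Injective (f ∘ₗ B) := by
    intro x y hxy
    exact h (by simpa using congrArg A hxy)
  have h1 := LinearMap.finrank_range_of_inj hinj
  rw [Module.finrank_fin_fun] at h1
  rw [← h1]
  exact Submodule.finrank_mono (LinearMap.range_comp_le_range _ _)

end Rank

/-- Lower semicontinuity of the rank of a family of linear maps with polynomial entries. -/
lemma generically_le_finrank_range {K ι V J : Type*} [Field K] [AddCommGroup V] [Module K V]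
    [Fintype J] (f : (ι → K) → V →ₗ[K] (J → K))
    (hf : ∀ v j, ∃ P : MvPolynomial ι K, ∀ x, eval x P = f x v j)
    (x₀ : ι → K) {r : ℕ} (h : r ≤ Module.finrank K (LinearMap.range (f x₀))) :
    Generically fun x => r ≤ Module.finrank K (LinearMap.range (f x)) := by
  classical
  obtain ⟨A, B, hAB⟩ := exists_comp_eq_id_of_le_finrank_range (f x₀) h
  choose P hP using hf
  let Q : Matrix (Fin r) (Fin r) (MvPolynomial ι K) := Matrix.of fun a b =>
    ∑ j, C (A (Pi.single j 1) a) * P (B (Pi.single b 1)) j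
  have hQ : ∀ x, Q.map (eval x) = LinearMap.toMatrix' (A ∘ₗ f x ∘ₗ B) := by
    intro x
    ext a b
    have h1 : f x (B (Pi.single b 1)) =
        ∑ j, (f x (B (Pi.single b 1)) j) • (Pi.single j 1 : J → K) :=
      pi_eq_sum_univ' _
    rw [LinearMap.toMatrix'_apply]
    simp only [Matrix.map_apply, Matrix.of_apply, Q, map_sum, map_mul, eval_C, hP, LinearMap.comp_apply]
    conv_rhs => rw [h1]
    simp [map_sum, map_smul, Finset.sum_apply, mul_comm]
  refine ⟨Q.det, fun h0 => ?_, fun x hx => ?_⟩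
  · have := congrArg (eval x₀) h0
    rw [RingHom.map_det, RingHom.mapMatrix_apply, hQ, hAB] at this
    simp at this
  · rw [RingHom.map_det, RingHom.mapMatrix_apply, hQ, LinearMap.det_toMatrix'] at hx
    exact le_finrank_range_of_injective_comp _ A B
      (LinearEquiv.ofIsUnitDet (v := Pi.basisFun K (Fin r)) (v' := Pi.basisFun K (Fin r))
        (f := A ∘ₗ f x ∘ₗ B) (by
          rw [← LinearMap.toMatrix_eq_toMatrix', LinearMap.det_toMatrix] at *; exact hx.isUnit)).injective

/-- Vectors of exponents of degree `d` correspond to multisets of size `d`. -/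
instance fintypeExponents (k d : ℕ) : Fintype {μ : Fin k → ℕ // ∑ i, μ i = d} :=
  Fintype.ofEquiv _ (Sym.equivNatSumOfFintype (Fin k) d)

lemma card_exponents (k d : ℕ) :
    Fintype.card {μ : Fin k → ℕ // ∑ i, μ i = d} = k.multichoose d := by
  rw [← Fintype.card_congr (Sym.equivNatSumOfFintype (Fin k) d), Sym.card_sym_eq_multichoose,
    Fintype.card_fin]

section Hom

variable (K : Type*) [Field K]

/-- A form of degree `d` is determined by its coefficients. -/
def homogeneousSubmoduleEquiv (k d : ℕ) :
    homogeneousSubmodule (Fin k) K d ≃ₗ[K] ({μ : Fin k → ℕ // ∑ i, μ i = d} → K) where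
  toFun f μ := coeff (Finsupp.equivFunOnFinite.symm μ.1) f.1
  map_add' _ _ := by ext; simp
  map_smul' _ _ := by ext; simp
  invFun c := ⟨∑ μ, monomial (Finsupp.equivFunOnFinite.symm μ.1) (c μ),
    Submodule.sum_mem _ fun μ _ => isHomogeneous_monomial _ (by
      rw [Finsupp.degree_eq_sum]; exact μ.2)⟩
  left_inv f := by
    ext ν
    simp only [coeff_sum, coeff_monomial]
    by_cases hν : ∑ i, ν i = d
    · rw [Finset.sum_eq_single ⟨ν, hν⟩]
      · have h : Finsupp.equivFunOnFinite.symm ⇑ν = ν := Finsupp.equivFunOnFinite.symm_apply_apply ν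
        simp only [h, if_true]
      · intro μ _ hne
        rw [if_neg]
        rintro rfl
        exact hne (Subtype.ext rfl)
      · simp
    · rw [Finset.sum_eq_zero]
      · refine (f.2.coeff_eq_zero ?_).symm
        rwa [Finsupp.degree_eq_sum]
      · intro μ _
        rw [if_neg]
        rintro rfl
        exact hν μ.2
  right_inv c := by
    ext ν
    simp only [coeff_sum, coeff_monomial]
    rw [Finset.sum_eq_single ν]
    · simp
    · intro μ _ hne
      rw [if_neg]
      intro h
      exact hne (Subtype.ext (Finsupp.equivFunOnFinite.symm.injective h))
    · simp

instance finiteHomogeneousSubmodule (k d : ℕ) :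
    Module.Finite K (homogeneousSubmodule (Fin k) K d) :=
  Module.Finite.equiv (homogeneousSubmoduleEquiv K k d).symm

lemma finrank_homogeneousSubmodule (k d : ℕ) :
    Module.finrank K (homogeneousSubmodule (Fin k) K d) = k.multichoose d := by
  rw [(homogeneousSubmoduleEquiv K k d).finrank_eq, Module.finrank_fintype_fun_eq_card,
    card_exponents]

variable {K}

/-- The gradients of a form at a family of points. -/
def gradMap {J : Type*} {k : ℕ} (d : ℕ) (x : J × Fin k → K) :
    homogeneousSubmodule (Fin k) K d →ₗ[K] (J × Fin k → K) where
  toFun f ji := eval (fun l => x (ji.1, l)) (pderiv ji.2 f.1)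
  map_add' _ _ := by ext; simp
  map_smul' _ _ := by ext; simp

lemma gradMap_apply {J : Type*} {k d : ℕ} (x : J × Fin k → K) (f) (j : J) (i : Fin k) :
    gradMap d x f (j, i) = eval (fun l => x (j, l)) (pderiv i f.1) := rfl

lemma exists_eval_eq_gradMap {J : Type*} {k d : ℕ} (f : homogeneousSubmodule (Fin k) K d)
    (ji : J × Fin k) : ∃ P, ∀ x : J × Fin k → K, eval x P = gradMap d x f ji :=
  ⟨rename (fun l => (ji.1, l)) (pderiv ji.2 f.1), fun x => by rw [eval_rename]; rfl⟩

variable (K)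

/-- Some `q` points impose at least `r` conditions as singular points of forms of degree `d`. -/
def GradRank (k d q r : ℕ) : Prop :=
  ∃ x : Fin q × Fin k → K, r ≤ Module.finrank K (LinearMap.range (gradMap d x))

/-- Forms of degree `d` in `k` variables have arbitrary gradients at some `q` points. -/
def GradSurj (k d q : ℕ) : Prop :=
  ∃ x : Fin q × Fin k → K, Function.Surjective (gradMap d x)

variable {K}

lemma le_finrank_range_iff_surjective {V J : Type*} [AddCommGroup V] [Module K V] [Fintype J]
    (f : V →ₗ[K] (J → K)) :
    Fintype.card J ≤ Module.finrank K (LinearMap.range f) ↔ Function.Surjective f := by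
  rw [← LinearMap.range_eq_top]
  constructor
  · intro h
    refine Submodule.eq_top_of_finrank_eq (le_antisymm (Submodule.finrank_le _) ?_)
    rwa [Module.finrank_fintype_fun_eq_card]
  · intro h
    rw [h, finrank_top, Module.finrank_fintype_fun_eq_card]

lemma generically_surjective {ι V J : Type*} [AddCommGroup V] [Module K V]
    [Fintype J] (f : (ι → K) → V →ₗ[K] (J → K))
    (hf : ∀ v j, ∃ P : MvPolynomial ι K, ∀ x, eval x P = f x v j)
    (x₀ : ι → K) (h : Function.Surjective (f x₀)) :
    Generically fun x => Function.Surjective (f x) := by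
  simp only [← le_finrank_range_iff_surjective] at h ⊢
  exact generically_le_finrank_range f hf x₀ h

lemma gradSurj_iff_gradRank {k d q : ℕ} : GradSurj K k d q ↔ GradRank K k d q (q * k) := by
  simp only [GradSurj, GradRank, ← le_finrank_range_iff_surjective, Fintype.card_prod,
    Fintype.card_fin]

lemma GradSurj.of_surjective {J : Type*} [Fintype J] {k d q : ℕ} (hq : q ≤ Fintype.card J)
    (x : J × Fin k → K) (hx : Function.Surjective (gradMap d x)) : GradSurj K k d q := by
  obtain ⟨φ⟩ := Function.Embedding.nonempty_of_card_le (α := Fin q) (β := J) (by simpa)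
  have hinj : Function.Injective fun p : Fin q × Fin k => (φ p.1, p.2) :=
    φ.injective.prodMap Function.injective_id
  refine ⟨fun p => x (φ p.1, p.2), fun s => ?_⟩
  obtain ⟨f, hf⟩ := hx (Function.extend (fun p : Fin q × Fin k => (φ p.1, p.2)) s 0)
  refine ⟨f, funext fun p => ?_⟩
  exact (congrFun hf (φ p.1, p.2)).trans (hinj.extend_apply s 0 p)

lemma GradSurj.mono {k d q q' : ℕ} (h : GradSurj K k d q) (hq : q' ≤ q) : GradSurj K k d q' := by
  obtain ⟨x, hx⟩ := h
  exact .of_surjective (by simpa) x hx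

lemma GradRank.mono {k d q r q' : ℕ} (h : GradRank K k d q r) (hq : q ≤ q') :
    GradRank K k d q' r := by
  obtain ⟨x, hx⟩ := h
  let y : Fin q' × Fin k → K := fun p => if h : p.1.1 < q then x (⟨p.1, h⟩, p.2) else 0
  refine ⟨y, hx.trans ?_⟩
  let A : (Fin q' × Fin k → K) →ₗ[K] (Fin q × Fin k → K) :=
    LinearMap.funLeft K K fun p => (Fin.castLE hq p.1, p.2)
  have hA : gradMap d x = A ∘ₗ gradMap d y := by
    ext f ⟨j, i⟩
    simp only [LinearMap.comp_apply, A, LinearMap.funLeft_apply, gradMap_apply]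
    simp [y]
  rw [hA, LinearMap.range_comp]
  exact Submodule.finrank_map_le _ _

lemma gradSurj_zero (k d : ℕ) : GradSurj K k d 0 :=
  ⟨0, fun _ => ⟨0, Subsingleton.elim _ _⟩⟩

/-- A space of functions of dimension at least `u` interpolates arbitrary values at some `u`
points. -/
lemma exists_surjective_eval {S X : Type*} [AddCommGroup S] [Module K S] [Module.Finite K S]
    (F : S →ₗ[K] (X → K)) : ∀ {u : ℕ}, u ≤ Module.finrank K (LinearMap.range F) →
    ∃ x : Fin u → X, Function.Surjective (LinearMap.funLeft K K x ∘ₗ F)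
  | 0, _ => ⟨Fin.elim0, fun _ => ⟨0, Subsingleton.elim _ _⟩⟩
  | u + 1, h => by
    obtain ⟨x, hx⟩ := exists_surjective_eval F (Nat.le_of_succ_le h)
    set G := LinearMap.funLeft K K x ∘ₗ F
    have h1 := LinearMap.finrank_range_add_finrank_ker F
    have h2 := LinearMap.finrank_range_add_finrank_ker G
    rw [LinearMap.range_eq_top.2 hx, finrank_top, Module.finrank_fin_fun] at h2
    have h3 : ¬ LinearMap.ker G ≤ LinearMap.ker F := fun hle => by
      have := Submodule.finrank_mono hle
      omega
    obtain ⟨s, hsG, hsF⟩ := Set.not_subset.1 h3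
    obtain ⟨y, hy⟩ : ∃ y, F s y ≠ 0 := by
      by_contra! hc
      exact hsF (funext hc)
    refine ⟨Fin.cons y x, fun c => ?_⟩
    obtain ⟨s', hs'⟩ := hx fun i => c i.succ
    refine ⟨s' + ((c 0 - F s' y) / F s y) • s, funext fun i => ?_⟩
    have hG : ∀ i, F s (x i) = 0 := fun i => congrFun hsG i
    have hG' : ∀ i, F s' (x i) = c i.succ := fun i => congrFun hs' i
    refine Fin.cases ?_ (fun i => ?_) i
    · simp [LinearMap.funLeft_apply, hy]
    · simp [LinearMap.funLeft_apply, hG, hG']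

end Hom

section Horace

variable {K : Type*} [Field K]

lemma sum_mul_eval_pderiv {k d : ℕ} {f : MvPolynomial (Fin k) K} (hf : f.IsHomogeneous d)
    (x : Fin k → K) : ∑ i, x i * eval x (pderiv i f) = d * eval x f := by
  have h := congrArg (eval x) hf.sum_X_mul_pderiv
  simpa [map_sum] using h

lemma pderiv_zero_rename_succ {k : ℕ} (f : MvPolynomial (Fin k) K) :
    pderiv 0 (rename Fin.succ f) = 0 := by
  refine pderiv_eq_zero_of_notMem_vars fun h => ?_
  classical
  obtain ⟨i, _, hi⟩ := Finset.mem_image.1 (vars_rename _ _ h)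
  exact Fin.succ_ne_zero i hi

lemma eval_pderiv_rename_succ {k : ℕ} (f : MvPolynomial (Fin k) K) (i : Fin k)
    (x : Fin (k + 1) → K) :
    eval x (pderiv i.succ (rename Fin.succ f)) = eval (fun l => x l.succ) (pderiv i f) := by
  rw [pderiv_rename (Fin.succ_injective k), eval_rename]
  rfl

/-- Multiplication of forms by the variable `X i`. -/
def mulX {k : ℕ} (d : ℕ) (i : Fin k) :
    homogeneousSubmodule (Fin k) K d →ₗ[K] homogeneousSubmodule (Fin k) K (d + 1) where
  toFun f := ⟨X i * f.1, by
    have := (isHomogeneous_X K i).mul f.2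
    rwa [add_comm] at this⟩
  map_add' _ _ := Subtype.ext (mul_add _ _ _)
  map_smul' c _ := Subtype.ext (mul_smul_comm c _ _)

lemma mulX_coe {k d : ℕ} (i : Fin k) (f : homogeneousSubmodule (Fin k) K d) :
    (mulX d i f : MvPolynomial (Fin k) K) = X i * f.1 := rfl

lemma exists_mulX_eq [Infinite K] {k d : ℕ} (g : homogeneousSubmodule (Fin (k + 1)) K (d + 1))
    (hg : ∀ h : Fin k → K, eval (Fin.cons 0 h : Fin (k + 1) → K) g.1 = 0) :
    ∃ f, mulX d 0 f = g := by
  have h0 : (finSuccEquiv K k g.1).coeff 0 = 0 := by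
    refine MvPolynomial.funext fun h => ?_
    have := hg h
    rw [eval_eq_eval_mv_eval', ← Polynomial.coeff_zero_eq_eval_zero, Polynomial.coeff_map] at this
    simpa using this
  obtain ⟨f', hf'⟩ := Polynomial.X_dvd_iff.2 h0
  have hf : g.1 = X 0 * (finSuccEquiv K k).symm f' := by
    apply (finSuccEquiv K k).injective
    rw [map_mul, finSuccEquiv_X_zero, AlgEquiv.apply_symm_apply, hf']
  refine ⟨⟨(finSuccEquiv K k).symm f', fun m hm => ?_⟩, Subtype.ext hf.symm⟩
  have h1 : coeff (Finsupp.single 0 1 + m) g.1 ≠ 0 := by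
    rwa [hf, coeff_X_mul]
  have h2 := g.2 h1
  rw [map_add] at h2
  simp only [Finsupp.weight_single, Pi.one_apply, smul_eq_mul, mul_one] at h2
  omega

variable [CharZero K]

/-- The values and gradients of the residual of a form that vanishes on a hyperplane. -/
lemma finrank_ker_restrict_le {J : Type*} {k d : ℕ} (x : J × Fin (k + 1) → K)
    (hx : ∀ j, x (j, 0) ≠ 0) (f : homogeneousSubmodule (Fin (k + 1)) K d)
    (hf : gradMap (d + 1) x (mulX d 0 f) = 0) : gradMap d x f = 0 := by
  have hval : ∀ j, eval (fun l => x (j, l)) f.1 = 0 := fun j => by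
    have h := sum_mul_eval_pderiv (mulX d 0 f).2 (fun l => x (j, l))
    rw [Finset.sum_eq_zero] at h
    · rw [mulX_coe, map_mul, eval_X] at h
      have h1 := mul_eq_zero.1 h.symm
      exact ((mul_eq_zero.1 (h1.resolve_left (by exact_mod_cast d.succ_ne_zero))).resolve_left (hx j))
    · intro i _
      rw [← gradMap_apply, hf]
      simp
  ext ⟨j, i⟩
  have h := congrFun hf (j, i)
  rw [gradMap_apply, mulX_coe, pderiv_mul, map_add, map_mul, map_mul, hval, mul_zero, zero_add,
    eval_X] at h
  exact (mul_eq_zero.1 h).resolve_left (hx j)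

/-- The restriction of forms to the hyperplane `X 0 = 0`, as functions. -/
def restrictHyperplane (k d : ℕ) :
    homogeneousSubmodule (Fin (k + 1)) K d →ₗ[K] ((Fin k → K) → K) where
  toFun g h := eval (Fin.cons 0 h : Fin (k + 1) → K) g.1
  map_add' _ _ := by ext; simp
  map_smul' _ _ := by ext; simp

lemma le_finrank_range_restrictHyperplane {k d q u r : ℕ} (x : Fin q × Fin (k + 1) → K)
    (hx : Function.Surjective (gradMap (d + 1) x))
    (hxr : r ≤ Module.finrank K (LinearMap.range (gradMap d x))) (hx0 : ∀ j, x (j, 0) ≠ 0)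
    (h : u + q * (k + 1) + (k + 1).multichoose d ≤ (k + 1).multichoose (d + 1) + r) :
    u ≤ Module.finrank K (LinearMap.range
      ((restrictHyperplane k (d + 1)).domRestrict (LinearMap.ker (gradMap (d + 1) x)))) := by
  set S := LinearMap.ker (gradMap (d + 1) x) with hS
  have h1 : (LinearMap.ker ((restrictHyperplane k (d + 1)).domRestrict S)).map S.subtype ≤
      (LinearMap.ker (gradMap d x)).map (mulX d 0) := by
    rintro _ ⟨g, hg, rfl⟩
    obtain ⟨f, hf⟩ := exists_mulX_eq g.1 (congrFun (LinearMap.mem_ker.1 hg))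
    refine ⟨f, finrank_ker_restrict_le x hx0 f ?_, hf⟩
    rw [hf]
    exact g.2
  have h2 := (Submodule.finrank_mono h1).trans (Submodule.finrank_map_le _ _)
  rw [Submodule.finrank_map_subtype_eq] at h2
  have h3 := LinearMap.finrank_range_add_finrank_ker (K := K) (V := S) (V₂ := (Fin k → K) → K)
    ((restrictHyperplane k (d + 1)).domRestrict S)
  have h4 := LinearMap.finrank_range_add_finrank_ker (gradMap d x)
  have h5 := LinearMap.finrank_range_add_finrank_ker (gradMap (d + 1) x)
  rw [LinearMap.range_eq_top.2 hx, finrank_top, Module.finrank_fintype_fun_eq_card,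
    finrank_homogeneousSubmodule, Fintype.card_prod, Fintype.card_fin, Fintype.card_fin] at h5
  rw [finrank_homogeneousSubmodule] at h4
  rw [← hS] at h5
  omega

omit [CharZero K] in
lemma exists_eval_eq_restrictHyperplane {k d : ℕ} (g : homogeneousSubmodule (Fin (k + 1)) K d) :
    ∃ P, ∀ y : Fin k → K, eval y P = restrictHyperplane k d g y := by
  refine ⟨bind₁ (Fin.cons 0 X) g.1, fun y => ?_⟩
  have h := aeval_bind₁ (R := K) y (Fin.cons 0 X) g.1
  refine h.trans ?_
  have h2 : (fun i => eval y ((Fin.cons 0 X : Fin (k + 1) → MvPolynomial _ K) i)) =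
      (Fin.cons 0 y : Fin (k + 1) → K) := by
    funext i
    refine Fin.cases ?_ (fun i => ?_) i <;> simp
  exact congrArg (fun z => eval z g.1) h2

omit [CharZero K] in
lemma GradSurj.generically {k d q : ℕ} (h : GradSurj K k d q) :
    Generically fun x : Fin q × Fin k → K => Function.Surjective (gradMap d x) := by
  obtain ⟨x, hx⟩ := h
  exact generically_surjective (gradMap d) exists_eval_eq_gradMap x hx

omit [CharZero K] in
lemma GradRank.generically {k d q r : ℕ} (h : GradRank K k d q r) :
    Generically fun x : Fin q × Fin k → K =>
      r ≤ Module.finrank K (LinearMap.range (gradMap d x)) := by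
  obtain ⟨x, hx⟩ := h
  exact generically_le_finrank_range (gradMap d) exists_eval_eq_gradMap x hx

omit [CharZero K] in
/-- A space of polynomial functions of dimension at least `u` interpolates arbitrary values at
`u` generic points. -/
lemma generically_surjective_eval {V : Type*} [AddCommGroup V] [Module K V] [Module.Finite K V]
    {k u : ℕ} (F : V →ₗ[K] ((Fin k → K) → K))
    (hF : ∀ v, ∃ P : MvPolynomial (Fin k) K, ∀ x, eval x P = F v x)
    (hu : u ≤ Module.finrank K (LinearMap.range F)) :
    Generically fun y : Fin u × Fin k → K =>
      ∀ c : Fin u → K, ∃ v, ∀ l, F v (fun i => y (l, i)) = c l := by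
  obtain ⟨y₀, hy₀⟩ := exists_surjective_eval F hu
  have h := generically_surjective
    (fun y : Fin u × Fin k → K => LinearMap.funLeft K K (fun l i => y (l, i)) ∘ₗ F)
    (fun v l => by
      obtain ⟨P, hP⟩ := hF v
      exact ⟨rename (fun i => (l, i)) P, fun y => by rw [eval_rename]; exact hP _⟩)
    (fun p => y₀ p.1 p.2) hy₀
  obtain ⟨P, hP, h⟩ := h
  refine ⟨P, hP, fun y hy c => ?_⟩
  obtain ⟨v, hv⟩ := h y hy c
  exact ⟨v, congrFun hv⟩

omit [CharZero K] in
lemma generically_surjective_eval_submodule {V : Type*} [AddCommGroup V] [Module K V]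
    [Module.Finite K V] {k u : ℕ} (F : V →ₗ[K] ((Fin k → K) → K))
    (hF : ∀ v, ∃ P : MvPolynomial (Fin k) K, ∀ x, eval x P = F v x) (S : Submodule K V)
    (hu : u ≤ Module.finrank K (LinearMap.range (F.domRestrict S))) :
    Generically fun y : Fin u × Fin k → K =>
      ∀ c : Fin u → K, ∃ v ∈ S, ∀ l, F v (fun i => y (l, i)) = c l := by
  obtain ⟨P, hP, h⟩ := generically_surjective_eval (F.domRestrict S) (fun v => hF v.1) hu
  refine ⟨P, hP, fun y hy c => ?_⟩
  obtain ⟨v, hv⟩ := h y hy c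
  exact ⟨v.1, v.2, hv⟩

lemma generically_restrictHyperplane {k d q u r : ℕ} (x : Fin q × Fin (k + 1) → K)
    (hx : Function.Surjective (gradMap (d + 1) x))
    (hxr : r ≤ Module.finrank K (LinearMap.range (gradMap d x))) (hx0 : ∀ j, x (j, 0) ≠ 0)
    (h : u + q * (k + 1) + (k + 1).multichoose d ≤ (k + 1).multichoose (d + 1) + r) :
    Generically fun y : Fin u × Fin k → K => ∀ c : Fin u → K, ∃ g, gradMap (d + 1) x g = 0 ∧
      ∀ l, eval (Fin.cons 0 fun i => y (l, i) : Fin (k + 1) → K) g.1 = c l := by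
  have h1 := le_finrank_range_restrictHyperplane x hx hxr hx0 h
  obtain ⟨P, hP, h2⟩ := generically_surjective_eval_submodule
    (restrictHyperplane k (d + 1)) exists_eval_eq_restrictHyperplane
    (LinearMap.ker (gradMap (d + 1) x)) h1
  refine ⟨P, hP, fun y hy c => ?_⟩
  obtain ⟨g, hgS, hg⟩ := h2 y hy c
  exact ⟨g, hgS, hg⟩

/-- The Horace method: specialise `u` of the points to a hyperplane. -/
lemma GradSurj.horace {k d q u r : ℕ} (hu : GradSurj K k (d + 2) u)
    (hq : GradSurj K (k + 1) (d + 1) q) (hr : GradRank K (k + 1) d q r)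
    (h : u + q * (k + 1) + (k + 1).multichoose d ≤ (k + 1).multichoose (d + 1) + r) :
    GradSurj K (k + 1) (d + 2) (q + u) := by
  obtain ⟨x, ⟨hx, hxr⟩, hx0⟩ := (hq.generically.and hr.generically).and (Generically.forall_finite
    fun j : Fin q => Generically.coord_ne_zero (j, (0 : Fin (k + 1)))) |>.exists_point
  obtain ⟨y, hy, hyE⟩ := (hu.generically.and
    (generically_restrictHyperplane x hx hxr hx0 h)).exists_point
  refine .of_surjective (J := Fin q ⊕ Fin u) (by simp)
    (fun p => Sum.elim (fun j => x (j, p.2)) (fun l => (Fin.cons 0 fun i => y (l, i) : _ → K) p.2) p.1)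
    fun s => ?_
  obtain ⟨f, hf⟩ := hy fun p => s (Sum.inr p.1, p.2.succ)
  have hf : ∀ l i, eval (fun i => y (l, i)) (pderiv i f.1) = s (Sum.inr l, i.succ) :=
    fun l i => congrFun hf (l, i)
  let F₀ : MvPolynomial (Fin (k + 1)) K := rename Fin.succ f.1
  let t : Fin q → Fin (k + 1) → K := fun j i =>
    s (Sum.inl j, i) - eval (fun l => x (j, l)) (pderiv i F₀)
  let c : Fin q → K := fun j => (∑ i, x (j, i) * t j i) / (x (j, 0) * (d + 2))
  obtain ⟨g₁, hg₁⟩ := hx fun p => (x (p.1, 0))⁻¹ * (t p.1 p.2 - if p.2 = 0 then c p.1 else 0)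
  have hg₁ : ∀ j i, eval (fun l => x (j, l)) (pderiv i g₁.1) =
      (x (j, 0))⁻¹ * (t j i - if i = 0 then c j else 0) := fun j i => congrFun hg₁ (j, i)
  have hd : (d : K) + 2 ≠ 0 := by exact_mod_cast (by omega : d + 2 ≠ 0)
  have hd' : (d : K) + 1 ≠ 0 := by exact_mod_cast (by omega : d + 1 ≠ 0)
  have hc : ∀ j, ∑ i, x (j, i) * t j i = c j * (x (j, 0) * (d + 2)) := fun j =>
    (div_mul_cancel₀ _ (mul_ne_zero (hx0 j) hd)).symm
  have hv₁ : ∀ j, eval (fun l => x (j, l)) g₁.1 = c j := fun j => by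
    have h1 := sum_mul_eval_pderiv g₁.2 (fun l => x (j, l))
    simp only [hg₁] at h1
    have h2 : ∑ i, x (j, i) * ((x (j, 0))⁻¹ * (t j i - if i = 0 then c j else 0)) =
        (x (j, 0))⁻¹ * (∑ i, x (j, i) * t j i - x (j, 0) * c j) := by
      simp only [mul_sub, Finset.sum_sub_distrib, mul_ite, mul_zero, Finset.sum_ite_eq',
        Finset.mem_univ, if_true, Finset.mul_sum]
      congr 1
      · exact Finset.sum_congr rfl fun i _ => by ring
      · ring
    rw [h2, hc] at h1
    have := hx0 j
    apply mul_left_cancel₀ hd'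
    push_cast at h1
    rw [← h1]
    field_simp
    ring
  obtain ⟨g₂, hgS, hg₂⟩ := hyE fun l =>
    s (Sum.inr l, 0) - eval (Fin.cons 0 fun i => y (l, i) : Fin (k + 1) → K) g₁.1
  have hd₂ : ∀ j i, eval (fun l => x (j, l)) (pderiv i g₂.1) = 0 := fun j i =>
    congrFun hgS (j, i)
  have hv₂ : ∀ j, eval (fun l => x (j, l)) g₂.1 = 0 := fun j => by
    have h1 := sum_mul_eval_pderiv g₂.2 (fun l => x (j, l))
    simp only [hd₂, mul_zero, Finset.sum_const_zero] at h1
    exact (mul_eq_zero.1 h1.symm).resolve_left (by exact_mod_cast d.succ_ne_zero)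
  refine ⟨⟨F₀, f.2.rename_isHomogeneous⟩ + mulX (d + 1) 0 (g₁ + g₂), funext ?_⟩
  rintro ⟨j | l, i⟩
  · rw [gradMap_apply]
    simp only [Submodule.coe_add, mulX_coe, map_add, pderiv_mul, map_mul, Sum.elim_inl, eval_X,
      hv₁, hv₂, hd₂, hg₁, pderiv_X]
    have := hx0 j
    by_cases hi : i = 0
    · subst hi
      simp [t, this]
    · simp [t, this, hi, Ne.symm hi]
  · rw [gradMap_apply]
    simp only [Submodule.coe_add, mulX_coe, map_add, pderiv_mul, map_mul, Sum.elim_inr, eval_X,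
      hg₂, pderiv_X, Fin.cons_zero]
    refine Fin.cases ?_ (fun i => ?_) i
    · simp [F₀, pderiv_zero_rename_succ]
    · simp [F₀, eval_pderiv_rename_succ, hf]

end Horace

section Arithmetic

/-- The number of points that is conjecturally enough to impose independent conditions on
forms of degree `d` in `k` variables, with the values and gradients of `k + 1` unknowns each:
`⌈binom (k - 1 + d) d / (k + 1)⌉`. -/
def pointBound (k d : ℕ) : ℕ := (k.multichoose d + k) / (k + 1)

lemma multichoose_le_pointBound (k d : ℕ) : k.multichoose d ≤ pointBound k d * (k + 1) := by
  have h := Nat.div_add_mod (k.multichoose d + k) (k + 1)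
  have h' : _ < k + 1 := Nat.mod_lt (k.multichoose d + k) k.succ_pos
  rw [pointBound, mul_comm]
  omega

lemma pointBound_le (k d : ℕ) : pointBound k d * (k + 1) ≤ k.multichoose d + k :=
  Nat.div_mul_le_self _ _

lemma le_of_mul_lt_mul_add {a b k : ℕ} (h : a * (k + 1) < (b + 1) * (k + 1)) : a ≤ b :=
  Nat.lt_succ_iff.1 (Nat.lt_of_mul_lt_mul_right h)

lemma multichoose_succ_mul (k d : ℕ) :
    k.multichoose (d + 1) * (d + 1) = (k + d) * k.multichoose d := by
  cases k with
  | zero => cases d <;> simp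
  | succ k =>
    rw [Nat.multichoose_eq, Nat.multichoose_eq, show k + 1 + (d + 1) - 1 = (k + d) + 1 by omega,
      show k + 1 + d - 1 = k + d by omega, ← Nat.add_one_mul_choose_eq]
    ring

lemma multichoose_three_mul (k : ℕ) : 6 * k.multichoose 3 = k * (k + 1) * (k + 2) := by
  have h1 := multichoose_succ_mul k 2
  have h2 := multichoose_succ_mul k 1
  simp only [Nat.multichoose_one_right] at h2
  nlinarith

lemma multichoose_four_mul (k : ℕ) : 24 * k.multichoose 4 = k * (k + 1) * (k + 2) * (k + 3) := by
  have h1 := multichoose_succ_mul k 3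
  have h2 := multichoose_three_mul k
  nlinarith

lemma multichoose_succ_le (k d : ℕ) :
    k.multichoose (d + 2) ≤ (k + 1) * k.multichoose (d + 1) := by
  have h := multichoose_succ_mul k (d + 1)
  refine Nat.le_of_mul_le_mul_right (c := d + 1 + 1) ?_ (by omega)
  rw [h, mul_right_comm]
  gcongr
  nlinarith

lemma pointBound_le_pointBound_succ (k d : ℕ) :
    pointBound k (d + 2) ≤ pointBound (k + 1) (d + 2) := by
  refine le_of_mul_lt_mul_add (k := k) ?_
  have h1 := pointBound_le k (d + 2)
  have h2 := multichoose_le_pointBound (k + 1) (d + 2)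
  have h3 := Nat.multichoose_succ_succ k (d + 1)
  have h4 := Nat.multichoose_succ_succ k d
  have h5 := multichoose_succ_le k d
  by_contra! h
  nlinarith [Nat.mul_le_mul_left (k + 1) h2, Nat.mul_le_mul_left (k + 2) h]

lemma pointBound_sub_le (k d : ℕ) :
    pointBound (k + 1) (d + 2) - pointBound k (d + 2) ≤ pointBound (k + 1) (d + 1) := by
  rw [Nat.sub_le_iff_le_add]
  refine le_of_mul_lt_mul_add (k := k + 1) ?_
  have h1 := multichoose_le_pointBound k (d + 2)
  have h2 := pointBound_le (k + 1) (d + 2)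
  have h3 := multichoose_le_pointBound (k + 1) (d + 1)
  have h4 := Nat.multichoose_succ_succ k (d + 1)
  nlinarith

/-- The numerical condition of the Horace step, when the singular points of the residual scheme
are too many to be independent. -/
lemma multichoose_add_cube_le_succ {k d : ℕ}
    (h : (k + 1).multichoose (d + 2) + (k + 2) ^ 3 ≤ (k + 2) * (k + 1).multichoose (d + 1)) :
    (k + 1).multichoose (d + 3) + (k + 2) ^ 3 ≤ (k + 2) * (k + 1).multichoose (d + 2) := by
  have h1 := Nat.multichoose_succ_succ k (d + 2)
  have h2 := Nat.multichoose_succ_succ k (d + 1)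
  have h3 := multichoose_succ_le k (d + 1)
  nlinarith

lemma multichoose_add_cube_le {k d d₀ : ℕ} (hd : d₀ ≤ d)
    (h : (k + 1).multichoose (d₀ + 2) + (k + 2) ^ 3 ≤ (k + 2) * (k + 1).multichoose (d₀ + 1)) :
    (k + 1).multichoose (d + 2) + (k + 2) ^ 3 ≤ (k + 2) * (k + 1).multichoose (d + 1) := by
  induction d, hd using Nat.le_induction with
  | base => exact h
  | succ d _ ih => exact multichoose_add_cube_le_succ ih

lemma horace_numeric_of_cube {k d : ℕ}
    (h : k.multichoose (d + 2) + (k + 1) ^ 3 ≤ (k + 1) * k.multichoose (d + 1)) :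
    pointBound k (d + 2) + (pointBound (k + 1) (d + 2) - pointBound k (d + 2)) * (k + 1) +
      (k + 1).multichoose d ≤ (k + 1).multichoose (d + 1) +
      min (pointBound (k + 1) (d + 2) - pointBound k (d + 2)) (pointBound (k + 1) d) *
        (k + 1) := by
  have h0 := pointBound_le_pointBound_succ k d
  obtain ⟨q, hq⟩ := Nat.exists_eq_add_of_le h0
  rw [hq, Nat.add_sub_cancel_left]
  have h1 := multichoose_le_pointBound k (d + 2)
  have h1' := pointBound_le k (d + 2)
  have h2 := pointBound_le (k + 1) (d + 2)
  have h3 := multichoose_le_pointBound (k + 1) d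
  have h4 := Nat.multichoose_succ_succ k (d + 1)
  have h5 := Nat.multichoose_succ_succ k d
  have h6 := multichoose_succ_le k d
  rw [hq] at h2
  simp only [Nat.add_assoc, Nat.reduceAdd] at *
  rcases le_total q (pointBound (k + 1) d) with hle | hle
  · rw [min_eq_left hle]
    have : pointBound k (d + 2) ≤ k.multichoose (d + 1) := by
      refine le_of_mul_lt_mul_add (k := k) ?_
      nlinarith
    linarith
  · rw [min_eq_right hle]
    obtain ⟨e, rfl⟩ := Nat.exists_eq_add_of_le hle
    suffices h : (pointBound k (d + 2) + e * (k + 1)) ≤ k.multichoose (d + 1) by nlinarith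
    refine Nat.le_of_mul_le_mul_right (c := (k + 1) * (k + 2)) ?_ (by positivity)
    nlinarith [Nat.mul_le_mul_left ((k + 1) ^ 2) h2, Nat.mul_le_mul_left ((k + 1) ^ 2) h3,
      Nat.mul_le_mul_left (k * (k + 2)) h1]

lemma horace_numeric {k d : ℕ} (hk : 2 ≤ k) (hd : 3 ≤ d) (hkd : ¬ (k = 2 ∧ d = 6)) :
    pointBound k (d + 2) + (pointBound (k + 1) (d + 2) - pointBound k (d + 2)) * (k + 1) +
      (k + 1).multichoose d ≤ (k + 1).multichoose (d + 1) +
      min (pointBound (k + 1) (d + 2) - pointBound k (d + 2)) (pointBound (k + 1) d) *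
        (k + 1) := by
  obtain hk8 | hk8 := le_or_gt 8 k
  · obtain ⟨k, rfl⟩ := Nat.exists_eq_add_of_le' (Nat.one_le_of_lt hk)
    refine horace_numeric_of_cube (multichoose_add_cube_le (d₀ := 2) (by omega) ?_)
    have h1 := multichoose_three_mul (k + 1)
    have h2 := multichoose_four_mul (k + 1)
    obtain ⟨t, rfl⟩ := Nat.exists_eq_add_of_le' (show 7 ≤ k by omega)
    simp only [Nat.reduceAdd] at *
    nlinarith [sq_nonneg t]
  · interval_cases k
    · by_cases h : 12 ≤ d
      · exact horace_numeric_of_cube (multichoose_add_cube_le (d₀ := 12) h (by simp [Nat.multichoose_eq]))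
      · interval_cases d <;> first | omega | simp [pointBound, Nat.multichoose_eq, Nat.choose]
    · by_cases h : 5 ≤ d
      · exact horace_numeric_of_cube (multichoose_add_cube_le (d₀ := 5) h (by simp [Nat.multichoose_eq, Nat.choose]))
      · interval_cases d <;> simp [pointBound, Nat.multichoose_eq, Nat.choose]
    · by_cases h : 4 ≤ d
      · exact horace_numeric_of_cube (multichoose_add_cube_le (d₀ := 4) h (by simp [Nat.multichoose_eq, Nat.choose]))
      · obtain rfl : d = 3 := by omega
        simp [pointBound, Nat.multichoose_eq, Nat.choose]
    all_goals exact horace_numeric_of_cube (multichoose_add_cube_le (d₀ := 3) hd (by simp [Nat.multichoose_eq, Nat.choose]))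

lemma horace_numeric_quartic {k : ℕ} (hk : 4 ≤ k) :
    pointBound k 4 + (pointBound (k + 1) 4 - pointBound k 4) * (k + 1) ≤ (k + 1).multichoose 3 ∧
      k + 1 ≤ pointBound (k + 1) 4 - pointBound k 4 := by
  have h0 := pointBound_le_pointBound_succ k 2
  obtain ⟨q, hq⟩ := Nat.exists_eq_add_of_le h0
  have e1 := multichoose_four_mul k
  have e2 := multichoose_three_mul (k + 1)
  have e3 := multichoose_four_mul (k + 1)
  constructor
  · have h1 := multichoose_le_pointBound k 4
    have h2 := pointBound_le (k + 1) 4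
    have h4 := Nat.multichoose_succ_succ k 3
    simp only [Nat.reduceAdd] at *
    rw [hq] at h2 ⊢
    rw [Nat.add_sub_cancel_left]
    refine Nat.le_of_mul_le_mul_right (c := (k + 1) * (k + 2)) ?_ (by positivity)
    have h : k.multichoose 4 + (k + 1) ^ 3 ≤ (k + 1) * (k + 1).multichoose 3 := by
      obtain ⟨t, rfl⟩ := Nat.exists_eq_add_of_le' hk
      nlinarith [sq_nonneg t]
    nlinarith [Nat.mul_le_mul_left ((k + 1) ^ 2) h2, Nat.mul_le_mul_left (k * (k + 2)) h1]
  · obtain hk6 | hk6 := le_or_gt 6 k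
    · have h1 := pointBound_le k 4
      have h2 := multichoose_le_pointBound (k + 1) 4
      simp only [Nat.reduceAdd] at *
      rw [hq] at h2 ⊢
      rw [Nat.add_sub_cancel_left]
      by_contra! hlt
      have hlt : q ≤ k := by omega
      obtain ⟨t, rfl⟩ := Nat.exists_eq_add_of_le' hk6
      nlinarith [Nat.mul_le_mul_left (t + 7) h2, Nat.mul_le_mul_left (t + 8) h1,
        Nat.mul_le_mul_left ((t + 7) * (t + 8)) hlt]
    · interval_cases k <;> simp [pointBound, Nat.multichoose_eq, Nat.choose]

end Arithmetic

section Interpolation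

variable {K : Type*} [Field K] [CharZero K]

lemma gradSurj_one_left (d : ℕ) : GradSurj K 1 (d + 1) 1 := by
  refine ⟨1, fun s => ⟨(s 0 / (d + 1)) • ⟨X 0 ^ (d + 1), isHomogeneous_X_pow 0 (d + 1)⟩, ?_⟩⟩
  have hd : (d : K) + 1 ≠ 0 := by exact_mod_cast d.succ_ne_zero
  ext ⟨j, i⟩
  obtain rfl := Subsingleton.elim j 0
  obtain rfl := Subsingleton.elim i 0
  rw [gradMap_apply]
  simp [hd]
  rfl

omit [CharZero K] in
lemma gradSurj_linear (k : ℕ) : GradSurj K k 1 1 := by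
  refine ⟨0, fun s => ⟨∑ i, s (0, i) • ⟨X i, isHomogeneous_X K i⟩, ?_⟩⟩
  ext ⟨j, i⟩
  obtain rfl := Subsingleton.elim j 0
  rw [gradMap_apply]
  simp [pderiv_X, Pi.single_apply, map_sum]

/-- Binary forms. -/
lemma gradSurj_two_left : ∀ {d q : ℕ}, 1 ≤ d → 2 * q ≤ d + 1 → GradSurj K 2 d q
  | _, 0, _, _ => gradSurj_zero _ _
  | 1, q + 1, _, h => by
    obtain rfl : q = 0 := by omega
    exact gradSurj_linear 2
  | d + 2, q + 1, _, h => by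
    have h1 : GradRank K 2 d q (q * 2) := by
      rw [← gradSurj_iff_gradRank]
      rcases d with _ | d
      · obtain rfl : q = 0 := by omega
        exact gradSurj_zero _ _
      · exact gradSurj_two_left (by omega) (by omega)
    refine GradSurj.horace (gradSurj_one_left (d + 1)) (gradSurj_two_left (by omega) (by omega)) h1 ?_
    simp only [Nat.reduceAdd, Nat.multichoose_two]
    omega

/-- A quadric that is singular at the coordinate points vanishes. -/
lemma gradRank_two (k : ℕ) : GradRank K k 2 k (k.multichoose 2) := by
  refine ⟨fun p => if p.1 = p.2 then 1 else 0, ?_⟩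
  have hinj : LinearMap.ker (gradMap (K := K) 2 fun p : Fin k × Fin k => if p.1 = p.2 then 1 else 0) =
      ⊥ := by
    rw [LinearMap.ker_eq_bot']
    intro f hf
    have hlin : ∀ g : MvPolynomial (Fin k) K, g.IsHomogeneous 1 →
        (∀ j, eval (fun l => if j = l then (1 : K) else 0) g = 0) → g = 0 := by
      intro g hg h0
      have hg' : g ∈ homogeneousSubmodule (Fin k) K 1 := hg
      rw [homogeneousSubmodule_one_eq_span_X] at hg'
      obtain ⟨c, rfl⟩ := (Submodule.mem_span_range_iff_exists_fun K).1 hg'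
      refine Finset.sum_eq_zero fun i _ => ?_
      have := h0 i
      simp [map_sum, smul_eval] at this
      rw [this, zero_smul]
    have h1 : ∀ i, pderiv i f.1 = 0 := fun i =>
      hlin _ f.2.pderiv fun j => congrFun hf (j, i)
    have h2 := f.2.sum_X_mul_pderiv
    simp only [h1, mul_zero, Finset.sum_const_zero] at h2
    refine Subtype.ext ((smul_eq_zero.1 h2.symm).resolve_left (by norm_num))
  have h := LinearMap.finrank_range_add_finrank_ker
    (gradMap (K := K) 2 fun p : Fin k × Fin k => if p.1 = p.2 then 1 else 0)
  rw [hinj, finrank_bot, finrank_homogeneousSubmodule] at h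
  exact h.ge

/-- If the expected number of double points imposes independent conditions on cubics, then it
does so in all degrees. -/
lemma gradSurj_pointBound_of_cubic
    (hcubic : ∀ k, 3 ≤ k → GradSurj K k 3 (pointBound k 3)) :
    ∀ k, 2 ≤ k → ∀ d, 3 ≤ d → GradSurj K k d (pointBound k d) := by
  intro k hk
  induction k, hk using Nat.le_induction with
  | base =>
    intro d hd
    refine gradSurj_two_left (by omega) ?_
    rw [pointBound, Nat.multichoose_two]
    omega
  | succ k hk ihk =>
    intro d hd
    induction d using Nat.strong_induction_on with
    | _ d ihd =>
      obtain rfl | hd4 := hd.eq_or_lt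
      · exact hcubic _ (by omega)
      obtain ⟨d, rfl⟩ := Nat.exists_eq_add_of_le' (show 2 ≤ d by omega)
      have hu := ihk (d + 2) hd
      have hq := ihd (d + 1) (by omega) (by omega)
      have hle := pointBound_le_pointBound_succ k d
      obtain rfl | hd2 := (show 2 ≤ d by omega).eq_or_lt
      · obtain hk4 | hk4 := le_or_gt 4 k
        · obtain ⟨h1, h2⟩ := horace_numeric_quartic hk4
          rw [← Nat.sub_add_cancel hle]
          refine GradSurj.horace hu (hq.mono (pointBound_sub_le k 2))
            ((gradRank_two (k + 1)).mono h2) ?_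
          simp only [Nat.reduceAdd]
          omega
        · interval_cases k
          · rw [show pointBound (2 + 1) (2 + 2) = 3 + 1 by
              simp [pointBound, Nat.multichoose_eq, Nat.choose]]
            exact GradSurj.horace (q := 3) (u := 1)
              (hu.mono (by simp [pointBound, Nat.multichoose_eq]))
              (hq.mono (by simp [pointBound, Nat.multichoose_eq, Nat.choose])) (gradRank_two 3)
              (by simp [Nat.multichoose_eq, Nat.choose])
          · rw [show pointBound (3 + 1) (2 + 2) = 4 + 3 by
              simp [pointBound, Nat.multichoose_eq, Nat.choose]]
            exact GradSurj.horace (q := 4) (u := 3)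
              (hu.mono (by simp [pointBound, Nat.multichoose_eq, Nat.choose]))
              (hq.mono (by simp [pointBound, Nat.multichoose_eq, Nat.choose])) (gradRank_two 4)
              (by simp [Nat.multichoose_eq, Nat.choose])
      · have hr := ihd d (by omega) (by omega)
        by_cases hkd : k = 2 ∧ d = 6
        · obtain ⟨rfl, rfl⟩ := hkd
          rw [show pointBound (2 + 1) (6 + 2) = 8 + 4 by
              simp [pointBound, Nat.multichoose_eq, Nat.choose]]
          exact GradSurj.horace (q := 8) (u := 4) (r := 21)
            (gradSurj_two_left (by omega) (by omega))
            (hq.mono (by simp [pointBound, Nat.multichoose_eq, Nat.choose]))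
            (((gradSurj_iff_gradRank.1 (hr.mono (q' := 7)
              (by simp [pointBound, Nat.multichoose_eq, Nat.choose])))).mono (by omega))
            (by simp [Nat.multichoose_eq, Nat.choose])
        · rw [← Nat.sub_add_cancel hle]
          exact GradSurj.horace hu (hq.mono (pointBound_sub_le k d))
            ((gradSurj_iff_gradRank.1 (hr.mono (min_le_right _ _))).mono (min_le_left _ _))
            (horace_numeric hk hd2 hkd)

end Interpolation

section Cubics

variable {K : Type*} [Field K]

/-- The derivative in the direction `c`, at the point `p`, of the monomial `X x * X y * X z`. -/
def polarCubic {V : Type*} (c p : V → K) (x y z : V) : K :=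
  c x * p y * p z + p x * c y * p z + p x * p y * c z

lemma gradSurj_three_of_polarCubic {V J : Type*} [Fintype V] [Fintype J] (p : J → V → K)
    (H : ∀ c : J → V → K, (∀ x y z, ∑ j, polarCubic (c j) (p j) x y z = 0) → c = 0) {k q : ℕ}
    (hk : Fintype.card V = k) (hq : q ≤ Fintype.card J) : GradSurj K k 3 q := by
  classical
  let e : V ≃ Fin k := Fintype.equivFinOfCardEq hk
  refine .of_surjective hq (fun ji => p ji.1 (e.symm ji.2)) ?_
  rw [← LinearMap.range_eq_top]
  by_contra htop
  obtain ⟨f, hf0, hf⟩ := Submodule.exists_le_ker_of_lt_top _ (lt_top_iff_ne_top.2 htop)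
  have hf' : ∀ s : J × Fin k → K, f s = ∑ ji, s ji * f (Pi.single ji 1) := fun s => by
    conv_lhs => rw [pi_eq_sum_univ' s]
    simp [map_sum]
  have hc := H (fun j v => f (Pi.single (j, e v) 1)) fun x y z => by
    have hxyz : (X (e x) * X (e y) * X (e z) : MvPolynomial (Fin k) K).IsHomogeneous 3 :=
      ((isHomogeneous_X K _).mul (isHomogeneous_X K _)).mul (isHomogeneous_X K _)
    have h := hf ⟨⟨_, hxyz⟩, rfl⟩
    rw [LinearMap.mem_ker, hf', Fintype.sum_prod_type] at h
    rw [← h]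
    refine Finset.sum_congr rfl fun j _ => ?_
    simp only [gradMap_apply, pderiv_mul, pderiv_X, map_add, map_mul, eval_X,
      Equiv.symm_apply_apply, Pi.single_apply, apply_ite (eval _), map_zero, add_mul,
      Finset.sum_add_distrib, ite_mul, mul_ite, zero_mul, mul_zero, one_mul, mul_one,
      Finset.sum_ite_eq, Finset.mem_univ, if_true, polarCubic]
    ring
  refine hf0 (LinearMap.ext fun s => ?_)
  rw [hf', LinearMap.zero_apply]
  refine Finset.sum_eq_zero fun ji _ => ?_
  have := congrFun (congrFun hc ji.1) (e.symm ji.2)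
  simp only [Equiv.apply_symm_apply, Pi.zero_apply, Prod.mk.eta] at this
  rw [this, mul_zero]

/-- For three blocks of variables with points on the unions of any two of them, the directional
derivatives of products of three variables from different blocks vanish only trivially. -/
def TripleIndep {na nb nc : ℕ} (u₁ : Fin nb → Fin na → K) (v₁ : Fin nb → Fin nb → K)
    (u₂ : Fin nc → Fin na → K) (w₂ : Fin nc → Fin nc → K)
    (v₃ : Fin nc → Fin nb → K) (w₃ : Fin nc → Fin nc → K) : Prop :=
  ∀ (γ : Fin nb → Fin nc → K) (β : Fin nc → Fin nb → K) (α : Fin nc → Fin na → K),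
    (∀ x y z, ∑ i, u₁ i x * v₁ i y * γ i z + ∑ l, u₂ l x * β l y * w₂ l z +
      ∑ l, α l x * v₃ l y * w₃ l z = 0) → γ = 0 ∧ β = 0 ∧ α = 0

/-- The cubic monomials that are relevant for points on the union of two blocks. -/
def IsMixed {na nb : ℕ} (da db : ℕ) (x y z : Fin na ⊕ Fin nb) : Prop :=
  ¬ (x.isLeft ∧ y.isLeft ∧ z.isLeft) ∧ ¬ (x.isRight ∧ y.isRight ∧ z.isRight) ∧
    ∀ v, (v = x ∧ v = y ∨ v = x ∧ v = z ∨ v = y ∧ v = z) →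
      Sum.elim (fun i : Fin na => da ≤ i) (fun i : Fin nb => db ≤ i) v

/-- For points on the union of two blocks, the directional derivatives of mixed products of three
variables, not containing squares of the first `da`, `db` variables, vanish only trivially. -/
def PairIndep {na nb : ℕ} (da db : ℕ) (p : Fin nb → Fin na ⊕ Fin nb → K) : Prop :=
  ∀ c : Fin nb → Fin na ⊕ Fin nb → K,
    (∀ x y z, IsMixed da db x y z → ∑ l, polarCubic (c l) (p l) x y z = 0) → c = 0

section Blocks

variable {B : Type*} [LinearOrder B] {sz dd : B → ℕ}

/-- The points on the unions of two blocks of variables. -/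
def blockPoint (T : (a b : B) → Fin (sz b) → (Σ b, Fin (sz b)) → K) (a b : B) (l : Fin (sz b))
    (v : Σ b, Fin (sz b)) : K :=
  if v.1 = a ∨ v.1 = b then T a b l v else 0

variable {T : (a b : B) → Fin (sz b) → (Σ b, Fin (sz b)) → K}

lemma blockPoint_of_ne {a b : B} {l : Fin (sz b)} {v : Σ b, Fin (sz b)} (ha : v.1 ≠ a)
    (hb : v.1 ≠ b) : blockPoint T a b l v = 0 := if_neg (by tauto)

lemma blockPoint_left {a b : B} {l : Fin (sz b)} {x : Fin (sz a)} :
    blockPoint T a b l ⟨a, x⟩ = T a b l ⟨a, x⟩ := if_pos (Or.inl rfl)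

lemma blockPoint_right {a b : B} {l : Fin (sz b)} {x : Fin (sz b)} :
    blockPoint T a b l ⟨b, x⟩ = T a b l ⟨b, x⟩ := if_pos (Or.inr rfl)

/-- The indices of the points on the unions of two blocks, and of the coordinate points. -/
abbrev BlockIndex (sz dd : B → ℕ) : Type _ :=
  (Σ ab : {ab : B × B // ab.1 < ab.2}, Fin (sz ab.1.2)) ⊕ (Σ b, Fin (dd b))

/-- The configuration of points on the unions of two blocks and of coordinate points. -/
def blockConfig [DecidableEq (Σ b, Fin (sz b))] (T : (a b : B) → Fin (sz b) → (Σ b, Fin (sz b)) → K)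
    (hdd : ∀ b, dd b ≤ sz b) : BlockIndex sz dd → (Σ b, Fin (sz b)) → K :=
  Sum.elim (fun j => blockPoint T j.1.1.1 j.1.1.2 j.2)
    (fun j => Pi.single ⟨j.1, j.2.castLE (hdd j.1)⟩ 1)

lemma pair_eq {a b a' b' : B} (h : a < b) (h' : a' < b') (ha : a = a' ∨ a = b')
    (hb : b = a' ∨ b = b') : (a', b') = (a, b) := by
  rcases ha with rfl | rfl <;> rcases hb with rfl | rfl
  · exact absurd h (lt_irrefl _)
  · rfl
  · exact absurd h (lt_asymm h')
  · exact absurd h (lt_irrefl _)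

lemma blockPoint_mul_blockPoint_eq_zero {a b a' b' : B} (h : a < b) (h' : a' < b')
    (hne : (a', b') ≠ (a, b)) (l : Fin (sz b')) {v w : Σ b, Fin (sz b)} (hv : v.1 = a)
    (hw : w.1 = b) : blockPoint T a' b' l v * blockPoint T a' b' l w = 0 := by
  subst hv hw
  by_cases hv : v.1 = a' ∨ v.1 = b'
  · by_cases hw : w.1 = a' ∨ w.1 = b'
    · exact absurd (pair_eq h h' hv hw) hne
    · rw [blockPoint_of_ne (v := w) (by tauto) (by tauto), mul_zero]
  · rw [blockPoint_of_ne (v := v) (by tauto) (by tauto), zero_mul]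

variable [Fintype B]

lemma sum_pairs_eq_single {f : (ab : {ab : B × B // ab.1 < ab.2}) → Fin (sz ab.1.2) → K} {a b : B}
    (h : a < b) (hf : ∀ ab : {ab : B × B // ab.1 < ab.2}, ab ≠ ⟨(a, b), h⟩ → ∀ l, f ab l = 0) :
    ∑ j : Σ ab : {ab : B × B // ab.1 < ab.2}, Fin (sz ab.1.2), f j.1 j.2 =
      ∑ l, f ⟨(a, b), h⟩ l := by
  rw [Fintype.sum_sigma, Fintype.sum_eq_single (⟨(a, b), h⟩ : {ab : B × B // ab.1 < ab.2})]
  intro ab hab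
  exact Finset.sum_eq_zero fun l _ => hf ab hab l

lemma blockConfig_injective [CharZero K] [DecidableEq (Σ b, Fin (sz b))] (hdd : ∀ b, dd b ≤ sz b)
    (hA : ∀ a b c, a < b → b < c → TripleIndep (fun l x => T a b l ⟨a, x⟩)
      (fun l x => T a b l ⟨b, x⟩) (fun l x => T a c l ⟨a, x⟩) (fun l x => T a c l ⟨c, x⟩)
      (fun l x => T b c l ⟨b, x⟩) (fun l x => T b c l ⟨c, x⟩))
    (hB : ∀ a b, a < b → PairIndep (dd a) (dd b)
      fun l => Sum.elim (fun x => T a b l ⟨a, x⟩) (fun x => T a b l ⟨b, x⟩))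
    (c : BlockIndex sz dd → (Σ b, Fin (sz b)) → K)
    (hc : ∀ x y z, ∑ j, polarCubic (c j) (blockConfig T hdd j) x y z = 0) : c = 0 := by
  simp only [Fintype.sum_sum_type, blockConfig, Sum.elim_inl, Sum.elim_inr] at hc
  have hcoord : ∀ x y z : Σ b, Fin (sz b), (∀ v, (v = x ∧ v = y ∨ v = x ∧ v = z ∨ v = y ∧ v = z) →
      dd v.1 ≤ v.2) → ∀ j : Σ b, Fin (dd b), polarCubic (c (Sum.inr j))
        (Pi.single ⟨j.1, j.2.castLE (hdd j.1)⟩ 1) x y z = 0 := by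
    intro x y z h j
    set v : Σ b, Fin (sz b) := ⟨j.1, j.2.castLE (hdd j.1)⟩ with hv
    have hj : ¬ dd v.1 ≤ v.2 := not_le.2 j.2.2
    have h1 : ∀ y z : Σ b, Fin (sz b), ¬ (v = y ∧ v = z) →
        (Pi.single v 1 : _ → K) y * (Pi.single v 1 : _ → K) z = 0 := by
      intro y z hne
      by_cases hy : v = y
      · rw [Pi.single_eq_of_ne (fun hz => hne ⟨hy, hz.symm⟩), mul_zero]
      · rw [Pi.single_eq_of_ne (Ne.symm hy), zero_mul]
    have hyz := h1 y z fun e => hj (h v (by tauto))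
    have hxz := h1 x z fun e => hj (h v (by tauto))
    have hxy := h1 x y fun e => hj (h v (by tauto))
    rw [polarCubic, hxy, mul_assoc, hyz, mul_right_comm, hxz]
    ring
  have htriple : ∀ a b e, a < b → b < e → ∀ (x : Fin (sz a)) (y : Fin (sz b)) (z : Fin (sz e)),
      ∑ j : Σ ab : {ab : B × B // ab.1 < ab.2}, Fin (sz ab.1.2), polarCubic (c (Sum.inl j))
        (blockPoint T j.1.1.1 j.1.1.2 j.2) ⟨a, x⟩ ⟨b, y⟩ ⟨e, z⟩ = 0 := by
    intro a b e hab hbe x y z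
    have h := hc ⟨a, x⟩ ⟨b, y⟩ ⟨e, z⟩
    rwa [Finset.sum_eq_zero (s := Finset.univ (α := Σ b, Fin (dd b))) (fun j _ => hcoord _ _ _ ?_ j), add_zero] at h
    rintro v (⟨rfl, h⟩ | ⟨rfl, h⟩ | ⟨rfl, h⟩)
    · exact absurd (congrArg Sigma.fst h) hab.ne
    · exact absurd (congrArg Sigma.fst h) (hab.trans hbe).ne
    · exact absurd (congrArg Sigma.fst h) hbe.ne
  have hsupp : ∀ (a b e : B) (hab : a < b) (hbe : b < e),
      (∀ l z, c (Sum.inl ⟨⟨(a, b), hab⟩, l⟩) ⟨e, z⟩ = 0) ∧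
      (∀ l y, c (Sum.inl ⟨⟨(a, e), hab.trans hbe⟩, l⟩) ⟨b, y⟩ = 0) ∧
      (∀ l x, c (Sum.inl ⟨⟨(b, e), hbe⟩, l⟩) ⟨a, x⟩ = 0) := by
    intro a b e hab hbe
    have h := hA a b e hab hbe (fun l z => c (Sum.inl ⟨⟨(a, b), hab⟩, l⟩) ⟨e, z⟩)
      (fun l y => c (Sum.inl ⟨⟨(a, e), hab.trans hbe⟩, l⟩) ⟨b, y⟩)
      (fun l x => c (Sum.inl ⟨⟨(b, e), hbe⟩, l⟩) ⟨a, x⟩) fun x y z => by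
        have h := htriple a b e hab hbe x y z
        simp only [polarCubic, Finset.sum_add_distrib] at h
        rw [sum_pairs_eq_single (f := fun ab l => c (Sum.inl ⟨ab, l⟩) ⟨a, x⟩ *
            blockPoint T ab.1.1 ab.1.2 l ⟨b, y⟩ * blockPoint T ab.1.1 ab.1.2 l ⟨e, z⟩) hbe,
          sum_pairs_eq_single (f := fun ab l => blockPoint T ab.1.1 ab.1.2 l ⟨a, x⟩ *
            c (Sum.inl ⟨ab, l⟩) ⟨b, y⟩ * blockPoint T ab.1.1 ab.1.2 l ⟨e, z⟩) (hab.trans hbe),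
          sum_pairs_eq_single (f := fun ab l => blockPoint T ab.1.1 ab.1.2 l ⟨a, x⟩ *
            blockPoint T ab.1.1 ab.1.2 l ⟨b, y⟩ * c (Sum.inl ⟨ab, l⟩) ⟨e, z⟩) hab] at h
        · simp only [blockPoint_left, blockPoint_right] at h
          rw [← h]
          ring
        all_goals
          rintro ⟨⟨a', b'⟩, hab'⟩ hne l
          have hne' := fun h => hne (Subtype.ext h)
        · rw [blockPoint_mul_blockPoint_eq_zero hab hab' hne' l rfl rfl, zero_mul]
        · rw [mul_right_comm, blockPoint_mul_blockPoint_eq_zero (hab.trans hbe) hab' hne' l rfl rfl,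
            zero_mul]
        · rw [mul_assoc, blockPoint_mul_blockPoint_eq_zero hbe hab' hne' l rfl rfl, mul_zero]
    exact ⟨fun l z => congrFun (congrFun h.1 l) z, fun l z => congrFun (congrFun h.2.1 l) z,
      fun l z => congrFun (congrFun h.2.2 l) z⟩
  have hsupp' : ∀ (a b : B) (hab : a < b) (v : Σ b, Fin (sz b)), v.1 ≠ a → v.1 ≠ b → ∀ l,
      c (Sum.inl ⟨⟨(a, b), hab⟩, l⟩) v = 0 := by
    rintro a b hab ⟨e, i⟩ hea heb l
    rcases lt_or_gt_of_ne hea with h | h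
    · exact (hsupp e a b h hab).2.2 l i
    · rcases lt_or_gt_of_ne heb with h' | h'
      · exact (hsupp a e b h h').2.1 l i
      · exact (hsupp a b e hab h').1 l i
  have hpair : ∀ ab l, c (Sum.inl ⟨ab, l⟩) = 0 := by
    rintro ⟨⟨a, b⟩, hab : a < b⟩ l
    let ι : Fin (sz a) ⊕ Fin (sz b) → Σ b, Fin (sz b) := 
      Sum.elim (fun i => ⟨a, i⟩) (fun i => ⟨b, i⟩)
    have hιinj : Function.Injective ι := by
      rintro (i | i) (j | j) h
      · exact congrArg _ (eq_of_heq (Sigma.mk.inj h).2)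
      · exact absurd (Sigma.mk.inj h).1 hab.ne
      · exact absurd (Sigma.mk.inj h).1 hab.ne'
      · exact congrArg _ (eq_of_heq (Sigma.mk.inj h).2)
    have hιdd : ∀ v, Sum.elim (fun i : Fin (sz a) => dd a ≤ i) (fun i : Fin (sz b) => dd b ≤ i) v →
        dd (ι v).1 ≤ (ι v).2 := by
      rintro (i | i) h <;> exact h
    have hιfst : ∀ v, (ι v).1 = a ∨ (ι v).1 = b := by
      rintro (i | i)
      · exact Or.inl rfl
      · exact Or.inr rfl
    have hιblock : ∀ v, ((ι v).1 = a → v.isLeft) ∧ ((ι v).1 ≠ a → v.isRight) := by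
      rintro (i | i)
      · exact ⟨fun _ => rfl, fun h => absurd rfl h⟩
      · exact ⟨fun h => absurd h hab.ne', fun _ => rfl⟩
    have hmix : ∀ x y z, IsMixed (dd a) (dd b) x y z → ∑ l, polarCubic
        (fun v => c (Sum.inl ⟨⟨(a, b), hab⟩, l⟩) (ι v))
        (Sum.elim (fun x => T a b l ⟨a, x⟩) (fun x => T a b l ⟨b, x⟩)) x y z = 0 := by
      intro x y z hxyz
      have h := hc (ι x) (ι y) (ι z)
      rw [Finset.sum_eq_zero (s := Finset.univ (α := Σ b, Fin (dd b)))
        (fun j _ => hcoord _ _ _ ?_ j), add_zero,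
        sum_pairs_eq_single (f := fun ab l => polarCubic (c (Sum.inl ⟨ab, l⟩))
          (blockPoint T ab.1.1 ab.1.2 l) (ι x) (ι y) (ι z)) hab] at h
      · rw [← h]
        refine Finset.sum_congr rfl fun l _ => ?_
        have hι : ∀ v, (Sum.elim (fun x => T a b l ⟨a, x⟩) (fun x => T a b l ⟨b, x⟩) v : K) =
            blockPoint T a b l (ι v) := by
          rintro (v | v)
          · exact blockPoint_left.symm
          · exact blockPoint_right.symm
        simp only [polarCubic, hι]
      · rintro ⟨⟨a', b'⟩, hab'⟩ hne l
        have hne' := fun h => hne (Subtype.ext h)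
        have hprod : ∀ v w, (ι v).1 ≠ (ι w).1 → blockPoint T a' b' l (ι v) *
            blockPoint T a' b' l (ι w) = 0 := by
          intro v w hvw
          rcases hιfst v with hv | hv <;> rcases hιfst w with hw | hw
          · exact absurd (hv.trans hw.symm) hvw
          · exact blockPoint_mul_blockPoint_eq_zero hab hab' hne' l hv hw
          · rw [mul_comm, blockPoint_mul_blockPoint_eq_zero hab hab' hne' l hw hv]
          · exact absurd (hv.trans hw.symm) hvw
        have hprod' : ∀ v w, (ι v).1 ≠ (ι w).1 → c (Sum.inl ⟨⟨(a', b'), hab'⟩, l⟩) (ι v) *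
            blockPoint T a' b' l (ι w) = 0 := by
          intro v w hvw
          by_cases hw : (ι w).1 = a' ∨ (ι w).1 = b'
          · by_cases hv : (ι v).1 = a' ∨ (ι v).1 = b'
            · exfalso
              refine hne' ?_
              rcases hιfst v with hv' | hv' <;> rcases hιfst w with hw' | hw' <;>
                rw [hv'] at hv hvw <;> rw [hw'] at hw hvw
              · exact absurd rfl hvw
              · exact pair_eq hab hab' hv hw
              · exact pair_eq hab hab' hw hv
              · exact absurd rfl hvw
            · rw [hsupp' a' b' hab' (ι v) (by tauto) (by tauto), zero_mul]
          · rw [blockPoint_of_ne (by tauto) (by tauto), mul_zero]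
        have hne3 : (ι x).1 ≠ (ι y).1 ∨ (ι y).1 ≠ (ι z).1 := by
          by_contra! h
          have h1 := hιblock x
          have h2 := hιblock y
          have h3 := hιblock z
          rw [h.1, h.2] at h1
          rw [h.2] at h2
          by_cases hz : (ι z).1 = a
          · exact hxyz.1 ⟨h1.1 hz, h2.1 hz, h3.1 hz⟩
          · exact hxyz.2.1 ⟨h1.2 hz, h2.2 hz, h3.2 hz⟩
        have h3 : ∀ (f g k : (Σ b, Fin (sz b)) → K),
            (∀ v w, (ι v).1 ≠ (ι w).1 → f (ι v) * g (ι w) = 0) →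
            (∀ v w, (ι v).1 ≠ (ι w).1 → g (ι v) * k (ι w) = 0) →
            f (ι x) * g (ι y) * k (ι z) = 0 := by
          intro f g k hfg hgk
          rcases hne3 with h | h
          · rw [hfg x y h, zero_mul]
          · rw [mul_assoc, hgk y z h, mul_zero]
        have hprod'' : ∀ v w, (ι v).1 ≠ (ι w).1 → blockPoint T a' b' l (ι v) *
            c (Sum.inl ⟨⟨(a', b'), hab'⟩, l⟩) (ι w) = 0 := fun v w h => by
          rw [mul_comm, hprod' w v h.symm]
        rw [polarCubic, h3 _ _ _ hprod' hprod, h3 _ _ _ hprod'' hprod', h3 _ _ _ hprod hprod'']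
        simp
      · rintro v (⟨h, h'⟩ | ⟨h, h'⟩ | ⟨h, h'⟩)
        · exact h ▸ hιdd x (hxyz.2.2 x (Or.inl ⟨rfl, hιinj (h.symm.trans h')⟩))
        · exact h ▸ hιdd x (hxyz.2.2 x (Or.inr (Or.inl ⟨rfl, hιinj (h.symm.trans h')⟩)))
        · exact h ▸ hιdd y (hxyz.2.2 y (Or.inr (Or.inr ⟨rfl, hιinj (h.symm.trans h')⟩)))
    have h := hB a b hab (fun l v => c (Sum.inl ⟨⟨(a, b), hab⟩, l⟩) (ι v)) hmix
    funext v
    by_cases hva : v.1 = a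
    · obtain ⟨_, i⟩ := v
      obtain rfl := hva
      exact congrFun (congrFun h l) (Sum.inl i)
    by_cases hvb : v.1 = b
    · obtain ⟨_, i⟩ := v
      obtain rfl := hvb
      exact congrFun (congrFun h l) (Sum.inr i)
    exact hsupp' a b hab v hva hvb l
  funext j v
  rcases j with ⟨ab, l⟩ | j
  · exact congrFun (hpair ab l) v
  · set w : Σ b, Fin (sz b) := ⟨j.1, j.2.castLE (hdd j.1)⟩ with hw
    have key : ∀ v, 2 * (c (Sum.inr j) w * (Pi.single w 1 : _ → K) v) + c (Sum.inr j) v = 0 := by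
      intro v
      have h := hc w w v
      rw [Finset.sum_eq_zero (s := Finset.univ (α := Σ ab : {ab : B × B // ab.1 < ab.2}, Fin (sz ab.1.2)))
        (fun i _ => ?_), zero_add, Fintype.sum_eq_single j] at h
      · rw [← h, ← hw]
        simp only [polarCubic, Pi.single_eq_same]
        ring
      · intro i hij
        have : (Pi.single ⟨i.1, i.2.castLE (hdd i.1)⟩ 1 : (Σ b, Fin (sz b)) → K) w = 0 := by
          refine Pi.single_eq_of_ne (fun h => hij ?_) _
          obtain ⟨i₁, i₂⟩ := i
          obtain ⟨j₁, j₂⟩ := j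
          obtain rfl : j₁ = i₁ := congrArg Sigma.fst h
          have h2 := congrArg Fin.val (eq_of_heq (Sigma.mk.inj h).2)
          exact congrArg _ (Fin.ext h2.symm)
        simp [polarCubic, this]
      · simp [polarCubic, hpair]
    have h1 : c (Sum.inr j) w = 0 := by
      have h := key w
      rw [Pi.single_eq_same] at h
      have h3 : (3 : K) * c (Sum.inr j) w = 0 := by rw [← h]; ring
      exact (mul_eq_zero.1 h3).resolve_left (by norm_num)
    have h := key v
    rwa [h1, zero_mul, mul_zero, zero_add] at h

end Blocks

end Cubics

section CubicExamples

variable {K : Type*} [Field K] [CharZero K]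

lemma tripleIndep_two : TripleIndep (K := K) (na := 3) (nb := 3) (nc := 2)
    ![![1, 0, 0], ![0, 1, 0], ![0, 0, 1]] ![![1, 0, 0], ![0, 1, 0], ![0, 0, 1]]
    ![![0, 1, 1], ![1, 0, 1]] ![![1, 0], ![0, 1]]
    ![![-1, -1, 0], ![0, -1, -1]] ![![2, 2], ![2, 1]] := by
  intro γ β α h
  simp only [Fin.forall_fin_succ, Fin.forall_fin_zero, Fin.sum_univ_succ, Fin.sum_univ_zero,
    funext_iff, Pi.zero_apply] at h ⊢
  simp at h ⊢
  grind

lemma tripleIndep_three : TripleIndep (K := K) (na := 3) (nb := 3) (nc := 3)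
    ![![1, 0, 0], ![0, 1, 0], ![0, 0, 1]] ![![1, 0, 0], ![0, 1, 0], ![0, 0, 1]]
    ![![1, 1, 1], ![1, 0, 1], ![1, 1, 0]] ![![1, 0, 0], ![0, 1, 0], ![0, 0, 1]]
    ![![0, 1, -1], ![1, -1, 0], ![-1, -1, -1]] ![![-1, 0, -1], ![-1, 1, 0], ![0, 2, 2]] := by
  intro γ β α h
  simp only [Fin.forall_fin_succ, Fin.forall_fin_zero, Fin.sum_univ_succ, Fin.sum_univ_zero,
    funext_iff, Pi.zero_apply] at h ⊢
  simp at h ⊢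
  grind

omit [CharZero K] in
lemma PairIndep.of_squarefree {na nb da db : ℕ} {p : Fin nb → Fin na ⊕ Fin nb → K}
    (H : ∀ c : Fin nb → Fin na ⊕ Fin nb → K,
      (∀ i j, i < j → ∀ m, ∑ l, polarCubic (c l) (p l) (.inl i) (.inl j) (.inr m) = 0) →
      (∀ i m n, m < n → ∑ l, polarCubic (c l) (p l) (.inl i) (.inr m) (.inr n) = 0) →
      (∀ i m, db ≤ m.val → ∑ l, polarCubic (c l) (p l) (.inl i) (.inr m) (.inr m) = 0) →
      c = 0) : PairIndep da db p := by
  refine fun c hc => H c (fun i j hij m => hc _ _ _ ?_) (fun i m n hmn => hc _ _ _ ?_)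
    (fun i m hm => hc _ _ _ ?_)
  · refine ⟨by simp, by simp, ?_⟩
    rintro v (⟨rfl, h⟩ | ⟨rfl, h⟩ | ⟨rfl, h⟩)
    · exact absurd (Sum.inl_injective h) hij.ne
    · cases h
    · cases h
  · refine ⟨by simp, by simp, ?_⟩
    rintro v (⟨rfl, h⟩ | ⟨rfl, h⟩ | ⟨rfl, h⟩)
    · cases h
    · cases h
    · exact absurd (Sum.inr_injective h) hmn.ne
  · refine ⟨by simp, by simp, ?_⟩
    rintro v (⟨rfl, h⟩ | ⟨rfl, h⟩ | ⟨rfl, h⟩)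
    · cases h
    · cases h
    · exact hm

lemma pairIndep_two : PairIndep (K := K) (na := 3) (nb := 2) 3 1
    ![Sum.elim ![0, -1, 2] ![1, 1], Sum.elim ![2, 1, 0] ![0, 1]] := by
  refine .of_squarefree fun c h₁ h₂ h₃ => ?_
  simp [Fin.forall_fin_succ, Fin.sum_univ_succ, funext_iff, polarCubic] at h₁ h₂ h₃ ⊢
  grind

lemma pairIndep_three : PairIndep (K := K) (na := 3) (nb := 3) 3 3
    ![Sum.elim ![-1, 1, 0] ![2, 0, 1], Sum.elim ![1, 0, 1] ![2, -1, 0],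
      Sum.elim ![0, -1, 1] ![0, 1, 1]] := by
  refine .of_squarefree fun c h₁ h₂ h₃ => ?_
  simp [Fin.forall_fin_succ, Fin.sum_univ_succ, funext_iff, polarCubic] at h₁ h₂ h₃ ⊢
  grind

lemma pairIndep_four : PairIndep (K := K) (na := 3) (nb := 4) 3 4
    ![Sum.elim ![1, 0, 1] ![0, -1, 0, 1], Sum.elim ![1, 1, 0] ![2, 0, 1, 0],
      Sum.elim ![2, 2, 1] ![0, -1, 1, 0], Sum.elim ![0, 2, 1] ![-1, 0, 0, 2]] := by
  refine .of_squarefree fun c h₁ h₂ h₃ => ?_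
  simp [Fin.forall_fin_succ, Fin.sum_univ_succ, funext_iff, polarCubic] at h₁ h₂ h₃ ⊢
  grind

lemma tripleIndep_four : TripleIndep (K := K) (na := 3) (nb := 3) (nc := 4)
    ![![1, 0, 0], ![0, 1, 0], ![0, 0, 1]] ![![1, 0, 0], ![0, 1, 0], ![0, 0, 1]]
    ![![0, 1, 1], ![1, 0, 1], ![0, 1, 1], ![1, 0, 1]]
    ![![1, 0, 0, 0], ![0, 1, 0, 0], ![0, 0, 1, 0], ![0, 0, 0, 1]]
    ![![-1, -1, 0], ![0, -1, -1], ![-1, -1, 0], ![0, -1, -1]]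
    ![![2, 2, 0, 0], ![2, 1, 0, 0], ![0, 0, 2, 2], ![0, 0, 2, 1]] := by
  intro γ β α h
  simp only [Fin.forall_fin_succ, Fin.forall_fin_zero, Fin.sum_univ_succ, Fin.sum_univ_zero,
    funext_iff, Pi.zero_apply] at h ⊢
  simp at h ⊢
  grind

end CubicExamples

lemma Generically.comp {K ι ι' : Type*} [Field K] {S : (ι → K) → Prop} (h : Generically S)
    {g : ι → ι'} (hg : Function.Injective g) : Generically fun x : ι' → K => S (x ∘ g) := by
  obtain ⟨P, hP, hS⟩ := h
  refine ⟨rename g P, fun h => hP (rename_injective g hg (by rw [h, map_zero])), fun x hx => ?_⟩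
  rw [eval_rename] at hx
  exact hS _ hx

/-- Injectivity is an open condition in a family of linear maps with polynomial entries. -/
lemma generically_injective {K ι V J : Type*} [Field K] [AddCommGroup V] [Module K V]
    [Module.Finite K V] [Finite J] (f : (ι → K) → V →ₗ[K] (J → K))
    (hf : ∀ v j, ∃ P : MvPolynomial ι K, ∀ x, eval x P = f x v j)
    (x₀ : ι → K) (h : Function.Injective (f x₀)) : Generically fun x => Function.Injective (f x) := by
  cases nonempty_fintype J
  obtain ⟨P, hP, hS⟩ := generically_le_finrank_range f hf x₀ (LinearMap.finrank_range_of_inj h).ge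
  refine ⟨P, hP, fun x hx => ?_⟩
  have h1 := LinearMap.finrank_range_add_finrank_ker (f x)
  have h2 := hS x hx
  refine LinearMap.ker_eq_bot.1 (Submodule.finrank_eq_zero.1 ?_)
  omega

section GenericIndep

variable {K : Type*} [Field K]

/-- The conditions of `TripleIndep`, as a linear map. -/
def tripleMap {na nb nc : ℕ} (u₁ : Fin nb → Fin na → K) (v₁ : Fin nb → Fin nb → K)
    (u₂ : Fin nc → Fin na → K) (w₂ : Fin nc → Fin nc → K)
    (v₃ : Fin nc → Fin nb → K) (w₃ : Fin nc → Fin nc → K) :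
    (Fin nb → Fin nc → K) × (Fin nc → Fin nb → K) × (Fin nc → Fin na → K) →ₗ[K]
      (Fin na × Fin nb × Fin nc → K) where
  toFun c := fun j => ∑ i, u₁ i j.1 * v₁ i j.2.1 * c.1 i j.2.2 +
    ∑ l, u₂ l j.1 * c.2.1 l j.2.1 * w₂ l j.2.2 + ∑ l, c.2.2 l j.1 * v₃ l j.2.1 * w₃ l j.2.2
  map_add' c c' := by
    funext j
    simp only [Prod.fst_add, Prod.snd_add, Pi.add_apply, mul_add, add_mul, Finset.sum_add_distrib]
    ring
  map_smul' r c := by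
    funext j
    simp only [Prod.smul_fst, Prod.smul_snd, Pi.smul_apply, smul_eq_mul, RingHom.id_apply, mul_add,
      Finset.mul_sum]
    congr 1
    · congr 1 <;> exact Finset.sum_congr rfl fun _ _ => by ring
    · exact Finset.sum_congr rfl fun _ _ => by ring

lemma tripleIndep_iff_injective {na nb nc : ℕ} {u₁ : Fin nb → Fin na → K}
    {v₁ : Fin nb → Fin nb → K} {u₂ : Fin nc → Fin na → K} {w₂ : Fin nc → Fin nc → K}
    {v₃ : Fin nc → Fin nb → K} {w₃ : Fin nc → Fin nc → K} :
    TripleIndep u₁ v₁ u₂ w₂ v₃ w₃ ↔ Function.Injective (tripleMap u₁ v₁ u₂ w₂ v₃ w₃) := by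
  rw [← LinearMap.ker_eq_bot, LinearMap.ker_eq_bot', TripleIndep]
  simp only [Prod.forall, Prod.mk_eq_zero, funext_iff (β := fun _ => K) (α := Fin na × _),
    tripleMap, LinearMap.coe_mk, AddHom.coe_mk, Pi.zero_apply]

/-- The conditions of `PairIndep`, as a linear map. -/
def pairMap {na nb : ℕ} (da db : ℕ) (p : Fin nb × (Fin na ⊕ Fin nb) → K) :
    (Fin nb → Fin na ⊕ Fin nb → K) →ₗ[K] ({xyz : (Fin na ⊕ Fin nb) × (Fin na ⊕ Fin nb) ×
      (Fin na ⊕ Fin nb) // IsMixed da db xyz.1 xyz.2.1 xyz.2.2} → K) where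
  toFun c := fun j => ∑ l, polarCubic (c l) (fun v => p (l, v)) j.1.1 j.1.2.1 j.1.2.2
  map_add' c c' := by
    funext j
    simp only [polarCubic, Pi.add_apply, ← Finset.sum_add_distrib]
    exact Finset.sum_congr rfl fun _ _ => by ring
  map_smul' r c := by
    funext j
    simp only [polarCubic, Pi.smul_apply, smul_eq_mul, RingHom.id_apply, Finset.mul_sum]
    exact Finset.sum_congr rfl fun _ _ => by ring

lemma pairIndep_iff_injective {na nb da db : ℕ} {p : Fin nb × (Fin na ⊕ Fin nb) → K} :
    PairIndep da db (fun l v => p (l, v)) ↔ Function.Injective (pairMap da db p) := by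
  rw [← LinearMap.ker_eq_bot, LinearMap.ker_eq_bot', PairIndep]
  simp only [funext_iff (β := fun _ => K), Subtype.forall, Prod.forall, pairMap,
    LinearMap.coe_mk, AddHom.coe_mk, Pi.zero_apply]

/-- The coordinates of points on the unions of two out of three blocks. -/
abbrev TripleCoord (na nb nc : ℕ) : Type :=
  (Fin nb × (Fin na ⊕ Fin nb)) ⊕ (Fin nc × (Fin na ⊕ Fin nc)) ⊕ (Fin nc × (Fin nb ⊕ Fin nc))

variable (K) in
/-- Generic points satisfy `TripleIndep`. -/
def GenericTriple (na nb nc : ℕ) : Prop :=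
  Generically fun x : TripleCoord na nb nc → K => TripleIndep
    (fun l i => x (.inl (l, .inl i))) (fun l i => x (.inl (l, .inr i)))
    (fun l i => x (.inr (.inl (l, .inl i)))) (fun l i => x (.inr (.inl (l, .inr i))))
    (fun l i => x (.inr (.inr (l, .inl i)))) (fun l i => x (.inr (.inr (l, .inr i))))

variable (K) in
/-- Generic points satisfy `PairIndep`. -/
def GenericPair (na nb da db : ℕ) : Prop :=
  Generically fun x : Fin nb × (Fin na ⊕ Fin nb) → K => PairIndep da db fun l v => x (l, v)

lemma TripleIndep.generic {na nb nc : ℕ} {u₁ : Fin nb → Fin na → K}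
    {v₁ : Fin nb → Fin nb → K} {u₂ : Fin nc → Fin na → K} {w₂ : Fin nc → Fin nc → K}
    {v₃ : Fin nc → Fin nb → K} {w₃ : Fin nc → Fin nc → K}
    (h : TripleIndep u₁ v₁ u₂ w₂ v₃ w₃) : GenericTriple K na nb nc := by
  simp only [GenericTriple, tripleIndep_iff_injective]
  refine generically_injective (V := (Fin nb → Fin nc → K) × (Fin nc → Fin nb → K) ×
    (Fin nc → Fin na → K)) (fun x => tripleMap _ _ _ _ _ _) (fun c j => ?_)
    (Sum.elim (fun j => Sum.elim (u₁ j.1) (v₁ j.1) j.2)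
      (Sum.elim (fun j => Sum.elim (u₂ j.1) (w₂ j.1) j.2)
        (fun j => Sum.elim (v₃ j.1) (w₃ j.1) j.2))) (tripleIndep_iff_injective.1 h)
  refine ⟨∑ i, X (.inl (i, .inl j.1)) * X (.inl (i, .inr j.2.1)) * C (c.1 i j.2.2) +
    ∑ l, X (.inr (.inl (l, .inl j.1))) * C (c.2.1 l j.2.1) * X (.inr (.inl (l, .inr j.2.2))) +
    ∑ l, C (c.2.2 l j.1) * X (.inr (.inr (l, .inl j.2.1))) * X (.inr (.inr (l, .inr j.2.2))),
    fun x => ?_⟩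
  simp [tripleMap]

lemma PairIndep.generic {na nb da db : ℕ} {p : Fin nb → Fin na ⊕ Fin nb → K}
    (h : PairIndep da db p) : GenericPair K na nb da db := by
  simp only [GenericPair, pairIndep_iff_injective]
  refine generically_injective (V := Fin nb → Fin na ⊕ Fin nb → K) (pairMap da db)
    (fun c j => ?_) (fun j => p j.1 j.2) (pairIndep_iff_injective.1 h)
  refine ⟨∑ l, (C (c l j.1.1) * X (l, j.1.2.1) * X (l, j.1.2.2) +
    X (l, j.1.1) * C (c l j.1.2.1) * X (l, j.1.2.2) +
    X (l, j.1.1) * X (l, j.1.2.1) * C (c l j.1.2.2)), fun x => ?_⟩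
  simp [pairMap, polarCubic]

section

variable {B : Type*} {sz : B → ℕ}

/-- The coordinates of the point `l` on the union of the blocks `a` and `b`. -/
def pairCoord (a b : B) (j : Fin (sz b) × (Fin (sz a) ⊕ Fin (sz b))) :
    Σ ab : B × B, Fin (sz ab.2) × (Σ b, Fin (sz b)) :=
  ⟨(a, b), j.1, j.2.elim (fun i => ⟨a, i⟩) (fun i => ⟨b, i⟩)⟩

lemma pairCoord_injective {a b : B} (hab : a ≠ b) :
    Function.Injective (pairCoord (sz := sz) a b) := by
  rintro ⟨l, i⟩ ⟨l', i'⟩ h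
  have h2 := eq_of_heq (Sigma.mk.inj h).2
  obtain rfl : l = l' := congrArg Prod.fst h2
  have h3 := congrArg Prod.snd h2
  rcases i with i | i <;> rcases i' with i' | i'
  · rw [eq_of_heq (Sigma.mk.inj h3).2]
  · exact absurd (Sigma.mk.inj h3).1 hab
  · exact absurd (Sigma.mk.inj h3).1 hab.symm
  · rw [eq_of_heq (Sigma.mk.inj h3).2]

end

lemma gradSurj_three_of_generic [CharZero K] {B : Type*} [LinearOrder B] [Fintype B]
    {sz dd : B → ℕ} (hdd : ∀ b, dd b ≤ sz b)
    (hA : ∀ a b c, a < b → b < c → GenericTriple K (sz a) (sz b) (sz c))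
    (hB : ∀ a b, a < b → GenericPair K (sz a) (sz b) (dd a) (dd b)) {k q : ℕ}
    (hk : ∑ b, sz b = k) (hq : q ≤ Fintype.card (BlockIndex sz dd)) : GradSurj K k 3 q := by
  classical
  have hA' : Generically fun x : (Σ ab : B × B, Fin (sz ab.2) × (Σ b, Fin (sz b))) → K =>
      ∀ abc : {abc : B × B × B // abc.1 < abc.2.1 ∧ abc.2.1 < abc.2.2},
      TripleIndep (fun l i => x ⟨(abc.1.1, abc.1.2.1), l, ⟨abc.1.1, i⟩⟩)
        (fun l i => x ⟨(abc.1.1, abc.1.2.1), l, ⟨abc.1.2.1, i⟩⟩)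
        (fun l i => x ⟨(abc.1.1, abc.1.2.2), l, ⟨abc.1.1, i⟩⟩)
        (fun l i => x ⟨(abc.1.1, abc.1.2.2), l, ⟨abc.1.2.2, i⟩⟩)
        (fun l i => x ⟨(abc.1.2.1, abc.1.2.2), l, ⟨abc.1.2.1, i⟩⟩)
        (fun l i => x ⟨(abc.1.2.1, abc.1.2.2), l, ⟨abc.1.2.2, i⟩⟩) := by
    refine .forall_finite ?_
    rintro ⟨⟨a, b, c⟩, hab : a < b, hbc : b < c⟩
    refine (hA a b c hab hbc).comp (g := Sum.elim (pairCoord a b)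
      (Sum.elim (pairCoord a c) (pairCoord b c))) ?_
    refine (pairCoord_injective hab.ne).sumElim
      ((pairCoord_injective (hab.trans hbc).ne).sumElim (pairCoord_injective hbc.ne) ?_) ?_
    · intro i j h
      exact hab.ne (congrArg Prod.fst (congrArg Sigma.fst h))
    · rintro i (j | j) h
      · exact hbc.ne (congrArg Prod.snd (congrArg Sigma.fst h))
      · exact hab.ne (congrArg Prod.fst (congrArg Sigma.fst h))
  have hB' : Generically fun x : (Σ ab : B × B, Fin (sz ab.2) × (Σ b, Fin (sz b))) → K =>
      ∀ ab : {ab : B × B // ab.1 < ab.2}, PairIndep (dd ab.1.1) (dd ab.1.2) fun l =>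
        Sum.elim (fun i => x ⟨ab.1, l, ⟨ab.1.1, i⟩⟩) (fun i => x ⟨ab.1, l, ⟨ab.1.2, i⟩⟩) := by
    refine .forall_finite ?_
    rintro ⟨⟨a, b⟩, hab : a < b⟩
    convert (hB a b hab).comp (pairCoord_injective hab.ne) using 5 with x l v
    rcases v with v | v <;> rfl
  obtain ⟨x, hxA, hxB⟩ := (hA'.and hB').exists_point
  exact gradSurj_three_of_polarCubic
    (blockConfig (fun a b l v => x ⟨(a, b), l, v⟩) hdd)
    (blockConfig_injective hdd (fun a b c hab hbc => hxA ⟨(a, b, c), hab, hbc⟩)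
      (fun a b hab => hxB ⟨(a, b), hab⟩)) (by simpa using hk) hq

end GenericIndep

lemma card_blockIndex (t s r : ℕ) :
    2 * Fintype.card (BlockIndex (B := Fin (t + 1)) (fun b => if b.val < t then 3 else s)
      (fun b => if b.val < t then 3 else r)) = 3 * t * (t + 1) + 2 * t * s + 2 * r := by
  have h : ∀ f : Fin (t + 1) → ℕ, ∑ ab : {ab : Fin (t + 1) × Fin (t + 1) // ab.1 < ab.2},
      f ab.1.2 = ∑ b, b.val * f b := by
    intro f
    rw [← Finset.sum_subtype (Finset.univ.filter fun ab : Fin (t + 1) × Fin (t + 1) => ab.1 < ab.2)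
      (by simp) (fun ab => f ab.2), Finset.sum_filter, Fintype.sum_prod_type_right]
    refine Finset.sum_congr rfl fun b _ => ?_
    rw [← Finset.sum_filter]
    simp only [Finset.sum_const, smul_eq_mul]
    congr 1
    have : (Finset.univ.filter fun a : Fin (t + 1) => a < b) = Finset.Iio b := by ext; simp
    rw [this, Fin.card_Iio]
  rw [Fintype.card_sum, Fintype.card_sigma, Fintype.card_sigma]
  simp only [Fintype.card_fin]
  rw [h fun b => if b.val < t then 3 else s, Fin.sum_univ_castSucc, Fin.sum_univ_castSucc]
  simp only [Fin.val_castSucc, Fin.is_lt, if_true, Fin.val_last, lt_irrefl, if_false,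
    Finset.sum_const, Finset.card_univ, Fintype.card_fin, smul_eq_mul]
  rw [Fin.sum_univ_eq_sum_range (fun i => i * 3) t, ← Finset.sum_mul]
  have h4 := Finset.sum_range_id_mul_two t
  cases t with
  | zero => simp
  | succ t =>
    rw [Nat.add_sub_cancel] at h4
    nlinarith

section

variable {K : Type*} [Field K] [CharZero K]

lemma gradSurj_three_add {t s r q : ℕ} (hr : r ≤ s) (hA : GenericTriple K 3 3 s)
    (hB : GenericPair K 3 s 3 r) (hq : 2 * q ≤ 3 * t * (t + 1) + 2 * t * s + 2 * r) :
    GradSurj K (3 * t + s) 3 q := by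
  refine gradSurj_three_of_generic (B := Fin (t + 1)) (sz := fun b => if b.val < t then 3 else s)
    (dd := fun b => if b.val < t then 3 else r) (fun b => ?_) (fun a b c hab hbc => ?_)
    (fun a b hab => ?_) ?_ ?_
  · split_ifs
    exacts [le_rfl, hr]
  · rw [if_pos (show a.val < t by omega), if_pos (show b.val < t by omega)]
    split_ifs
    exacts [tripleIndep_three.generic, hA]
  · rw [if_pos (show a.val < t by omega), if_pos (show a.val < t by omega)]
    split_ifs
    exacts [pairIndep_three.generic, hB]
  · rw [Fin.sum_univ_castSucc]
    simp [mul_comm]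
  · have := card_blockIndex t s r
    omega

lemma gradSurj_three_pointBound {k : ℕ} (hk : 3 ≤ k) : GradSurj K k 3 (pointBound k 3) := by
  have key : ∀ t s r, r ≤ s → GenericTriple K 3 3 s → GenericPair K 3 s 3 r →
      (3 * t + s) * (3 * t + s + 2) ≤ 3 * (3 * t * (t + 1) + 2 * t * s + 2 * r) →
      GradSurj K (3 * t + s) 3 (pointBound (3 * t + s) 3) := by
    intro t s r hr hA hB h
    have heven : Even (3 * t * (t + 1) + 2 * t * s + 2 * r) := by
      have := Nat.even_mul_succ_self t
      rw [mul_assoc 3, mul_assoc 2]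
      exact ((this.mul_left 3).add (even_two_mul _)).add (even_two_mul _)
    obtain ⟨Q, hQ⟩ := heven
    have hb : pointBound (3 * t + s) 3 ≤ Q := by
      refine le_of_mul_lt_mul_add (k := 3 * t + s) ((pointBound_le _ _).trans_lt ?_)
      have := multichoose_three_mul (3 * t + s)
      rw [hQ] at h
      have := Nat.mul_le_mul_right (3 * t + s + 1) h
      nlinarith
    exact gradSurj_three_add hr hA hB (by omega)
  obtain ⟨t, rfl | rfl | rfl⟩ : ∃ t, k = 3 * t + 3 ∨ k = 3 * t + 4 ∨ k = 3 * (t + 1) + 2 :=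
    ⟨(k - 3) / 3, by omega⟩
  · exact key t 3 3 le_rfl tripleIndep_three.generic pairIndep_three.generic (by nlinarith)
  · exact key t 4 4 le_rfl tripleIndep_four.generic pairIndep_four.generic (by nlinarith)
  · exact key (t + 1) 2 1 one_le_two tripleIndep_two.generic pairIndep_two.generic (by nlinarith)

/-- Forms of degree at least three have arbitrary gradients at the expected number of points. -/
theorem gradSurj_pointBound {k d : ℕ} (hk : 2 ≤ k) (hd : 3 ≤ d) : GradSurj K k d (pointBound k d) :=
  gradSurj_pointBound_of_cubic (fun _ h => gradSurj_three_pointBound h) k hk d hd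

end

section Jacobian

variable {K : Type*} [Field K]

/-- The chain rule for partial derivatives. -/
lemma pderiv_aeval {σ τ : Type*} [Fintype τ] (Ψ : τ → MvPolynomial σ K) (P : MvPolynomial τ K)
    (i : σ) : pderiv i (aeval Ψ P) = ∑ j, aeval Ψ (pderiv j P) * pderiv i (Ψ j) := by
  classical
  induction P using MvPolynomial.induction_on with
  | C a => simp
  | add p q hp hq => simp only [map_add, hp, hq, add_mul, Finset.sum_add_distrib]
  | mul_X p l hp =>
    simp only [map_mul, aeval_X, pderiv_mul, hp, map_add, add_mul, Finset.sum_add_distrib,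
      pderiv_X]
    congr 1
    · rw [Finset.sum_mul]
      exact Finset.sum_congr rfl fun j _ => by ring
    · simp [Pi.single_apply, apply_ite]

variable [CharZero K]

lemma eq_C_of_pderiv_eq_zero {τ : Type*} {P : MvPolynomial τ K} (h : ∀ i, pderiv i P = 0) :
    P = C (coeff 0 P) := by
  classical
  ext m
  rw [coeff_C]
  split_ifs with hm
  · rw [hm]
  · obtain ⟨i, hi⟩ := Finsupp.ne_iff.1 (Ne.symm hm)
    have h1 := coeff_pderiv (i := i) P (m - Finsupp.single i 1)
    have h2 : m - Finsupp.single i 1 + Finsupp.single i 1 = m :=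
      tsub_add_cancel_of_le (Finsupp.single_le_iff.2 (Nat.one_le_iff_ne_zero.2 hi))
    rw [h i, coeff_zero, h2] at h1
    exact (mul_eq_zero.1 h1.symm).resolve_right (Nat.cast_add_one_ne_zero _)

/-- Polynomials whose Jacobian has full rank at some point are algebraically independent. -/
lemma algebraicIndependent_of_jacobian {σ : Type*} [Fintype σ] {r : ℕ}
    (Ψ : Fin r → MvPolynomial σ K) (x : σ → K) (B : Fin r → σ → K)
    (h : ∀ i j, ∑ l, B i l * eval x (pderiv l (Ψ j)) = if i = j then 1 else 0) :
    AlgebraicIndependent K Ψ := by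
  let M : Matrix (Fin r) (Fin r) (MvPolynomial σ K) :=
    Matrix.of fun i j => ∑ l, C (B i l) * pderiv l (Ψ j)
  have hM : M.det ≠ 0 := fun h0 => by
    have h1 : M.map (eval x) = 1 := by
      ext i j
      simp [M, h, Matrix.one_apply]
    have h2 := congrArg (eval x) h0
    rw [RingHom.map_det, RingHom.mapMatrix_apply, h1] at h2
    simp at h2
  have hstep : ∀ P : MvPolynomial (Fin r) K, aeval Ψ P = 0 → ∀ j, aeval Ψ (pderiv j P) = 0 := fun P hP => by
    refine congrFun (Matrix.eq_zero_of_mulVec_eq_zero hM (v := fun j => aeval Ψ (pderiv j P)) ?_)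
    funext i
    simp only [Matrix.mulVec, dotProduct, M, Matrix.of_apply, Finset.sum_mul, Pi.zero_apply]
    rw [Finset.sum_comm]
    refine Finset.sum_eq_zero fun l _ => ?_
    have h1 := pderiv_aeval Ψ P l
    rw [hP, map_zero] at h1
    calc ∑ j, C (B i l) * pderiv l (Ψ j) * aeval Ψ (pderiv j P)
        = C (B i l) * ∑ j, aeval Ψ (pderiv j P) * pderiv l (Ψ j) := by
          rw [Finset.mul_sum]
          exact Finset.sum_congr rfl fun j _ => by ring
      _ = 0 := by rw [← h1, mul_zero]
  have hdeg : ∀ N, ∀ P : MvPolynomial (Fin r) K, P.totalDegree ≤ N → aeval Ψ P = 0 → P = 0 := by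
    intro N
    have hconst : ∀ P : MvPolynomial (Fin r) K, (∀ j, pderiv j P = 0) → aeval Ψ P = 0 → P = 0 := by
      intro P h1 h2
      have h3 := eq_C_of_pderiv_eq_zero h1
      rw [h3, aeval_C, algebraMap_eq, C_eq_zero] at h2
      rw [h3, h2, C_0]
    induction N with
    | zero =>
      intro P hP h0
      refine hconst P (fun j => ?_) h0
      rw [totalDegree_eq_zero_iff_eq_C.1 (Nat.le_zero.1 hP), pderiv_C]
    | succ N ih =>
      intro P hP h0
      refine hconst P (fun j => ih _ ?_ (hstep P h0 j)) h0
      refine Finset.sup_le fun m hm => ?_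
      by_contra! hlt
      rw [mem_support_iff, coeff_pderiv] at hm
      refine hm ?_
      rw [coeff_eq_zero_of_totalDegree_lt, zero_mul]
      change _ < (m + Finsupp.single j 1).degree
      rw [map_add, Finsupp.degree_single]
      change _ < m.degree at hlt
      omega
  rw [algebraicIndependent_iff]
  exact fun P hP => hdeg _ P le_rfl hP

end Jacobian

lemma le_ringKrullDim_of_hasGoingUp {R S : Type*} [CommRing R] [CommRing S] [Algebra R S]
    [Algebra.IsIntegral R S] [FaithfulSMul R S] : ringKrullDim R ≤ ringKrullDim S := by
  refine iSup_le fun l => ?_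
  obtain ⟨P, hP, hlo⟩ := Ideal.nonempty_primesOver (S := S) l.head.asIdeal
  obtain ⟨L, hL, -⟩ := Ideal.exists_ltSeries_of_hasGoingUp l P
  rw [← hL]
  exact le_iSup (fun p : LTSeries (PrimeSpectrum S) => ((p.length : ℕ∞) : WithBot ℕ∞)) L

/-- The transcendence degree bounds the dimension of an affine domain from below. -/
lemma AlgebraicIndependent.le_ringKrullDim {K R : Type} [Field K] [CommRing R] [IsDomain R]
    [Algebra K R] [Algebra.FiniteType K R] {r : ℕ} {y : Fin r → R}
    (hy : AlgebraicIndependent K y) : (r : WithBot ℕ∞) ≤ ringKrullDim R := by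
  obtain ⟨s, g, hg, hint⟩ := exists_integral_inj_algHom_of_fg K R
  let := g.toRingHom.toAlgebra
  have : IsScalarTower K (MvPolynomial (Fin s) K) R :=
    .of_algebraMap_eq fun c => (g.commutes c).symm
  have : Algebra.IsIntegral (MvPolynomial (Fin s) K) R := ⟨hint⟩
  have : FaithfulSMul (MvPolynomial (Fin s) K) R :=
    (faithfulSMul_iff_algebraMap_injective _ _).2 hg
  have h1 := hy.cardinalMk_le_trdeg
  rw [← trdeg_add_eq K (MvPolynomial (Fin s) K), trdeg_eq_zero (R := MvPolynomial (Fin s) K), add_zero,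
    MvPolynomial.trdeg_of_isDomain] at h1
  simp only [Cardinal.mk_fin, Cardinal.lift_natCast, Nat.cast_le] at h1
  calc (r : WithBot ℕ∞) ≤ (s : WithBot ℕ∞) := by exact_mod_cast h1
    _ = ringKrullDim (MvPolynomial (Fin s) K) := by
      rw [MvPolynomial.ringKrullDim_of_isNoetherianRing, ringKrullDim_eq_zero_of_field, zero_add,
        Nat.card_fin]
    _ ≤ ringKrullDim R := le_ringKrullDim_of_hasGoingUp

/-- The dimension of the closure of the image of a polynomial map is at least the rank of its
differential at any point. -/
lemma le_coneKrullDim_of_jacobian {K σ τ : Type} [Field K] [CharZero K] [Fintype σ] [Fintype τ]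
    (S : Set (τ → K)) (Φ : τ → MvPolynomial σ K) (hS : ∀ x, (fun p => eval x (Φ p)) ∈ S)
    (x : σ → K) (f : (τ → K) →ₗ[K] (σ → K))
    (hf : ∀ F l, f F l = ∑ p, F p * eval x (pderiv l (Φ p))) {r : ℕ}
    (hr : r ≤ Module.finrank K (LinearMap.range f)) :
    (r : WithBot ℕ∞) ≤ ringKrullDim (MvPolynomial τ K ⧸ ⨅ x ∈ S, RingHom.ker (eval x)) := by
  classical
  obtain ⟨A, B, hAB⟩ := exists_comp_eq_id_of_le_finrank_range f hr
  set R := (aeval (R := K) Φ).range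
  have hdim : ringKrullDim R ≤ ringKrullDim (MvPolynomial τ K ⧸ ⨅ x ∈ S, RingHom.ker (eval x)) := by
    refine ringKrullDim_le_of_surjective (Ideal.Quotient.lift _ (aeval (R := K) Φ).rangeRestrict.toRingHom
      fun P hP => Subtype.ext (MvPolynomial.funext fun x => ?_)) ?_
    · have h1 : eval (fun p => eval x (Φ p)) P = 0 := by
        simp only [Submodule.mem_iInf] at hP
        exact hP _ (hS x)
      have h2 := aeval_bind₁ (R := K) x Φ P
      exact h2.trans h1
    · exact Ideal.Quotient.lift_surjective_of_surjective _ _ (AlgHom.rangeRestrict_surjective _)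
  have hmem : ∀ p, Φ p ∈ R := fun p => ⟨X p, aeval_X _ _⟩
  let y : Fin r → R := fun j => ∑ p, algebraMap K R (B (Pi.single j 1) p) * ⟨Φ p, hmem p⟩
  have hy : AlgebraicIndependent K y := by
    refine AlgebraicIndependent.of_comp R.val ?_
    refine algebraicIndependent_of_jacobian _ x (fun i l => A (Pi.single l 1) i) fun i j => ?_
    have h1 : ∀ l, eval x (pderiv l ((R.val ∘ y) j)) = f (B (Pi.single j 1)) l := fun l => by
      rw [hf]
      simp [y, map_sum, ← algebraMap_eq]
    simp only [h1]
    have h2 := congrFun (LinearMap.congr_fun hAB (Pi.single j 1)) i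
    simp only [LinearMap.comp_apply, LinearMap.id_apply, Pi.single_apply] at h2
    conv_rhs => rw [← h2, pi_eq_sum_univ' (f (B (Pi.single j 1)))]
    simp [map_sum, map_smul, Finset.sum_apply, mul_comm]
  have : Algebra.FiniteType K R :=
    .of_surjective (aeval (R := K) Φ).rangeRestrict (AlgHom.rangeRestrict_surjective _)
  exact hy.le_ringKrullDim.trans hdim

section Interpolation

variable {K : Type*} [Field K]

lemma exists_surjective_eval_submodule {V X T : Type*} [AddCommGroup V] [Module K V]
    [Module.Finite K V] [Fintype T] (F : V →ₗ[K] (X → K)) (hF : Function.Injective F)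
    (S : Submodule K V) (hT : Fintype.card T ≤ Module.finrank K S) :
    ∃ y : T → X, ∀ c : T → K, ∃ v ∈ S, ∀ t, F v (y t) = c t := by
  have h1 : Function.Injective (F.domRestrict S) := fun v w h => Subtype.ext (hF h)
  obtain ⟨y, hy⟩ := exists_surjective_eval (F.domRestrict S)
    (hT.trans (LinearMap.finrank_range_of_inj h1).ge)
  let e := Fintype.equivFin T
  refine ⟨y ∘ e, fun c => ?_⟩
  obtain ⟨v, hv⟩ := hy (c ∘ e.symm)
  refine ⟨v.1, v.2, fun t => ?_⟩
  have := congrFun hv (e t)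
  rwa [Function.comp_apply, Equiv.symm_apply_apply] at this

lemma exists_injective_eval_submodule {V X T : Type*} [AddCommGroup V] [Module K V]
    [Module.Finite K V] [Fintype T] [Nonempty X] (F : V →ₗ[K] (X → K)) (hF : Function.Injective F)
    (S : Submodule K V) (hT : Module.finrank K S ≤ Fintype.card T) :
    ∃ y : T → X, ∀ v ∈ S, (∀ t, F v (y t) = 0) → v = 0 := by
  obtain ⟨y, hy⟩ := exists_surjective_eval_submodule (T := Fin (Module.finrank K S)) F hF S
    (Fintype.card_fin _).le
  obtain ⟨φ⟩ := Function.Embedding.nonempty_of_card_le (α := Fin (Module.finrank K S)) (β := T)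
    (by simpa)
  have hs : Function.Surjective (LinearMap.funLeft K K y ∘ₗ F.domRestrict S) := fun c => by
    obtain ⟨v, hvS, hv⟩ := hy c
    exact ⟨⟨v, hvS⟩, funext hv⟩
  have hi := (LinearMap.injective_iff_surjective_of_finrank_eq_finrank
    (Module.finrank_fin_fun K).symm).2 hs
  refine ⟨Function.extend φ y fun _ => Classical.arbitrary X, fun v hv h => ?_⟩
  have h0 : (⟨v, hv⟩ : S) = 0 := hi <| by
    rw [map_zero]
    funext i
    have := h (φ i)
    rwa [φ.injective.extend_apply] at this
  exact congrArg Subtype.val h0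

/-- Forms of degree `d`, as functions. -/
def evalForm (k d : ℕ) : homogeneousSubmodule (Fin k) K d →ₗ[K] ((Fin k → K) → K) where
  toFun f y := eval y f.1
  map_add' _ _ := by ext; simp
  map_smul' _ _ := by ext; simp

lemma evalForm_injective [Infinite K] (k d : ℕ) : Function.Injective (evalForm (K := K) k d) :=
  fun _ _ h => Subtype.ext (MvPolynomial.funext fun y => congrFun h y)

/-- The gradients of a form at one family of points and its values at another one. -/
def jetMap {P T : Type*} {k : ℕ} (d : ℕ) (x : P × Fin k → K) (y : T × Fin k → K) :
    homogeneousSubmodule (Fin k) K d →ₗ[K] ((P × Fin k) ⊕ T → K) where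
  toFun f := Sum.elim (gradMap d x f) fun t => eval (fun l => y (t, l)) f.1
  map_add' _ _ := by ext (_ | _) <;> simp
  map_smul' _ _ := by ext (_ | _) <;> simp

lemma exists_eval_eq_jetMap {ι P T : Type*} {k d : ℕ} (a : P → ι) (b : T → ι)
    (f : homogeneousSubmodule (Fin k) K d) (j : (P × Fin k) ⊕ T) :
    ∃ Q, ∀ z : ι × Fin k → K,
      eval z Q = jetMap d (fun p => z (a p.1, p.2)) (fun t => z (b t.1, t.2)) f j := by
  rcases j with j | t
  · exact ⟨rename (fun l => (a j.1, l)) (pderiv j.2 f.1), fun z => by rw [eval_rename]; rfl⟩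
  · exact ⟨rename (fun l => (b t, l)) f.1, fun z => by rw [eval_rename]; rfl⟩

lemma GradSurj.finrank_ker_add {k d q : ℕ} {x : Fin q × Fin k → K}
    (hx : Function.Surjective (gradMap d x)) :
    Module.finrank K (LinearMap.ker (gradMap d x)) + q * k = k.multichoose d := by
  have h := LinearMap.finrank_range_add_finrank_ker (gradMap d x)
  rw [LinearMap.range_eq_top.2 hx, finrank_top, Module.finrank_fintype_fun_eq_card,
    finrank_homogeneousSubmodule, Fintype.card_prod, Fintype.card_fin, Fintype.card_fin] at h
  omega

variable [Infinite K]

lemma GradSurj.exists_jetMap_surjective {k d q : ℕ} {T : Type*} [Fintype T] (h : GradSurj K k d q)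
    (hT : q * k + Fintype.card T ≤ k.multichoose d) :
    ∃ (x : Fin q × Fin k → K) (y : T × Fin k → K), Function.Surjective (jetMap d x y) := by
  obtain ⟨x, hx⟩ := h
  have h1 := GradSurj.finrank_ker_add hx
  obtain ⟨y, hy⟩ := exists_surjective_eval_submodule (T := T) (evalForm k d)
    (evalForm_injective k d) (LinearMap.ker (gradMap d x)) (by omega)
  refine ⟨x, fun p => y p.1 p.2, fun c => ?_⟩
  obtain ⟨f, hf⟩ := hx (c ∘ Sum.inl)
  obtain ⟨g, hg, hgy⟩ := hy fun t => c (Sum.inr t) - evalForm k d f (y t)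
  refine ⟨f + g, funext ?_⟩
  rintro (j | t)
  · have h2 : gradMap d x (f + g) j = c (Sum.inl j) := by
      rw [map_add, hf, LinearMap.mem_ker.1 hg, add_zero, Function.comp_apply]
    exact h2
  · have h2 : evalForm k d (f + g) (y t) = c (Sum.inr t) := by
      rw [map_add, Pi.add_apply, hgy, add_sub_cancel]
    exact h2

lemma GradSurj.exists_jetMap_injective {k d q : ℕ} {T : Type*} [Fintype T] (h : GradSurj K k d q)
    (hT : k.multichoose d ≤ q * k + Fintype.card T) :
    ∃ (x : Fin q × Fin k → K) (y : T × Fin k → K), Function.Injective (jetMap d x y) := by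
  obtain ⟨x, hx⟩ := h
  have h1 := GradSurj.finrank_ker_add hx
  obtain ⟨y, hy⟩ := exists_injective_eval_submodule (T := T) (evalForm k d)
    (evalForm_injective k d) (LinearMap.ker (gradMap d x)) (by omega)
  refine ⟨x, fun p => y p.1 p.2, (injective_iff_map_eq_zero _).2 fun f hf => hy f ?_ fun t => ?_⟩
  · exact LinearMap.mem_ker.2 (funext fun j => congrFun hf (Sum.inl j))
  · exact congrFun hf (Sum.inr t)

/-- The gradients of a form at the points of the group `i`, and its values at the others. -/
def groupJetMap {I : Type*} {k q : ℕ} (d : ℕ) (z : (I × Fin q) × Fin k → K) (i : I) :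
    homogeneousSubmodule (Fin k) K d →ₗ[K] ((Fin q × Fin k) ⊕ {p : I × Fin q // p.1 ≠ i} → K) :=
  jetMap d (fun p => z ((i, p.1), p.2)) (fun t => z (t.1.1, t.2))

omit [Infinite K] in
lemma exists_groupJetMap_eq_jetMap {I : Type*} {k q d : ℕ} (i : I) (x : Fin q × Fin k → K)
    (y : {p : I × Fin q // p.1 ≠ i} × Fin k → K) :
    ∃ z : (I × Fin q) × Fin k → K, groupJetMap d z i = jetMap d x y := by
  classical
  refine ⟨fun p => if h : p.1.1 = i then x (p.1.2, p.2) else y (⟨p.1, h⟩, p.2), ?_⟩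
  unfold groupJetMap
  congr 1
  · funext p
    simp
  · funext t
    have := t.1.2
    simp [this]

lemma card_group_compl {n q : ℕ} (i : Fin (n + 1)) :
    Fintype.card {p : Fin (n + 1) × Fin q // p.1 ≠ i} = q * n := by
  have e : {p : Fin (n + 1) × Fin q // p.1 ≠ i} ≃ {j : Fin (n + 1) // j ≠ i} × Fin q :=
    (Equiv.prodSubtypeFstEquivSubtypeProd (p := fun j => j ≠ i))
  rw [Fintype.card_congr e, Fintype.card_prod, Fintype.card_fin, Fintype.card_subtype_compl]
  simp [mul_comm]

lemma GradSurj.exists_groupJetMap_surjective {k d q n : ℕ} (h : GradSurj K k d q)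
    (hq : q * (n + k) ≤ k.multichoose d) :
    ∃ z : (Fin (n + 1) × Fin q) × Fin k → K, ∀ i, Function.Surjective (groupJetMap d z i) := by
  refine (Generically.forall_finite fun i => ?_).exists_point
  obtain ⟨x, y, hxy⟩ := h.exists_jetMap_surjective (T := {p : Fin (n + 1) × Fin q // p.1 ≠ i})
    (by rw [card_group_compl]; linarith)
  obtain ⟨z, hz⟩ := exists_groupJetMap_eq_jetMap (d := d) i x y
  exact generically_surjective (fun z => groupJetMap d z i)
    (exists_eval_eq_jetMap (fun j => (i, j)) Subtype.val) z (by rwa [hz])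

lemma GradSurj.exists_groupJetMap_injective {k d q n : ℕ} (h : GradSurj K k d q)
    (hq : k.multichoose d ≤ q * (n + k)) :
    ∃ z : (Fin (n + 1) × Fin q) × Fin k → K, ∀ i, Function.Injective (groupJetMap d z i) := by
  refine (Generically.forall_finite fun i => ?_).exists_point
  obtain ⟨x, y, hxy⟩ := h.exists_jetMap_injective (T := {p : Fin (n + 1) × Fin q // p.1 ≠ i})
    (by rw [card_group_compl]; linarith)
  obtain ⟨z, hz⟩ := exists_groupJetMap_eq_jetMap (d := d) i x y
  exact generically_injective (fun z => groupJetMap d z i)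
    (exists_eval_eq_jetMap (fun j => (i, j)) Subtype.val) z (by rwa [hz])

end Interpolation

section Secant

variable {K : Type} [Field K]

/-- The polynomial parametrization of the secant cone of the Segre–Veronese variety: sums of `s`
products of a vector and the `d`-th powers of a linear form. -/
def secantParam (K : Type) [Field K] (n k d s : ℕ)
    (p : Fin (n + 1) × {μ : Fin k → ℕ // ∑ i, μ i = d}) :
    MvPolynomial ((Fin s × Fin (n + 1)) ⊕ (Fin s × Fin k)) K :=
  ∑ j, X (Sum.inl (j, p.1)) * rename (fun l => Sum.inr (j, l))
    (monomial (Finsupp.equivFunOnFinite.symm p.2.1) 1)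

lemma eval_secantParam {n k d s : ℕ} (x : (Fin s × Fin (n + 1)) ⊕ (Fin s × Fin k) → K) (p) :
    eval x (secantParam K n k d s p) =
      ∑ j, x (Sum.inl (j, p.1)) * ∏ i, x (Sum.inr (j, i)) ^ p.2.1 i := by
  simp [secantParam, eval_rename, eval_monomial, Finsupp.prod_fintype]

/-- The transpose of the differential of `secantParam` at `x`. -/
def secantJacobian {n k d s : ℕ} (x : (Fin s × Fin (n + 1)) ⊕ (Fin s × Fin k) → K) :
    (Fin (n + 1) × {μ : Fin k → ℕ // ∑ i, μ i = d} → K) →ₗ[K]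
      ((Fin s × Fin (n + 1)) ⊕ (Fin s × Fin k) → K) where
  toFun F l := ∑ p, F p * eval x (pderiv l (secantParam K n k d s p))
  map_add' _ _ := by ext; simp [add_mul, Finset.sum_add_distrib]
  map_smul' _ _ := by ext; simp [mul_assoc, Finset.mul_sum]

/-- The form of degree `d` with coefficients `F (i, ·)`. -/
def componentForm {n k d : ℕ} (F : Fin (n + 1) × {μ : Fin k → ℕ // ∑ i, μ i = d} → K)
    (i : Fin (n + 1)) : homogeneousSubmodule (Fin k) K d :=
  (homogeneousSubmoduleEquiv K k d).symm fun μ => F (i, μ)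

lemma componentForm_coe {n k d : ℕ} (F : Fin (n + 1) × {μ : Fin k → ℕ // ∑ i, μ i = d} → K)
    (i : Fin (n + 1)) : (componentForm F i : MvPolynomial (Fin k) K) =
      ∑ μ, C (F (i, μ)) * monomial (Finsupp.equivFunOnFinite.symm μ.1) 1 := by
  simp only [C_mul_monomial, mul_one]
  rfl

lemma secantJacobian_inl {n k d s : ℕ} (x : (Fin s × Fin (n + 1)) ⊕ (Fin s × Fin k) → K)
    (F : Fin (n + 1) × {μ : Fin k → ℕ // ∑ i, μ i = d} → K) (j : Fin s) (i : Fin (n + 1)) :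
    secantJacobian x F (Sum.inl (j, i)) =
      eval (fun l => x (Sum.inr (j, l))) (componentForm F i).1 := by
  classical
  have h1 : ∀ p, eval x (pderiv (Sum.inl (j, i)) (secantParam K n k d s p)) =
      if p.1 = i then eval (fun l => x (Sum.inr (j, l)))
        (monomial (Finsupp.equivFunOnFinite.symm p.2.1) 1) else 0 := by
    intro p
    have h2 : ∀ (j' : Fin s) (P : MvPolynomial (Fin k) K), pderiv (Sum.inl (j, i))
        (rename (fun l : Fin k => (Sum.inr (j', l) : (Fin s × Fin (n + 1)) ⊕ (Fin s × Fin k))) P) =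
        0 := fun j' P => by
      refine pderiv_eq_zero_of_notMem_vars fun h => ?_
      obtain ⟨l, -, hl⟩ := Finset.mem_image.1 (vars_rename _ _ h)
      exact Sum.inr_ne_inl hl
    simp only [secantParam, map_sum, pderiv_mul, h2, mul_zero, add_zero, map_mul, eval_rename,
      pderiv_X, Function.comp_def]
    rw [Finset.sum_eq_single j]
    · by_cases hp : p.1 = i <;> simp [hp]
    · intro j' _ hj
      simp [hj]
    · simp
  change ∑ p, F p * _ = _
  rw [componentForm_coe]
  simp only [h1, Fintype.sum_prod_type, map_sum, map_mul, eval_C, mul_ite, mul_zero]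
  rw [Finset.sum_eq_single i (fun b _ hb => by simp [hb]) (by simp)]
  simp

lemma secantJacobian_inr {n k d s : ℕ} (x : (Fin s × Fin (n + 1)) ⊕ (Fin s × Fin k) → K)
    (F : Fin (n + 1) × {μ : Fin k → ℕ // ∑ i, μ i = d} → K) (j : Fin s) (l : Fin k) :
    secantJacobian x F (Sum.inr (j, l)) = ∑ i, x (Sum.inl (j, i)) *
      eval (fun l => x (Sum.inr (j, l))) (pderiv l (componentForm F i).1) := by
  classical
  have h1 : ∀ p, eval x (pderiv (Sum.inr (j, l)) (secantParam K n k d s p)) =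
      x (Sum.inl (j, p.1)) * eval (fun l => x (Sum.inr (j, l)))
        (pderiv l (monomial (Finsupp.equivFunOnFinite.symm p.2.1) 1)) := by
    intro p
    simp only [secantParam, map_sum, pderiv_mul, map_mul, pderiv_X_of_ne Sum.inl_ne_inr, zero_mul,
      zero_add, eval_X]
    rw [Finset.sum_eq_single j]
    · rw [pderiv_rename (f := fun l : Fin k => (Sum.inr (j, l) : (Fin s × Fin (n + 1)) ⊕ _))
        (fun a b h => by simpa using h), eval_rename]
      rfl
    · intro j' _ hj
      rw [pderiv_eq_zero_of_notMem_vars, map_zero, mul_zero]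
      intro h
      obtain ⟨l', -, hl⟩ := Finset.mem_image.1 (vars_rename _ _ h)
      simp [hj] at hl
    · simp
  change ∑ p, F p * _ = _
  simp only [h1, Fintype.sum_prod_type, componentForm_coe, map_sum, pderiv_mul, pderiv_C, zero_mul,
    zero_add, map_mul, eval_C, Finset.mul_sum]
  exact Finset.sum_congr rfl fun i _ => Finset.sum_congr rfl fun μ _ => by ring

/-- The point of the source of `secantParam` given by unit vectors and a choice of points. -/
def groupPoint {n k q s : ℕ} (z : (Fin (n + 1) × Fin q) × Fin k → K)
    (π : Fin s → Fin (n + 1) × Fin q) : (Fin s × Fin (n + 1)) ⊕ (Fin s × Fin k) → K :=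
  Sum.elim (fun p => if (π p.1).1 = p.2 then 1 else 0) fun p => z (π p.1, p.2)

lemma secantJacobian_groupPoint_inr {n k d q s : ℕ} (z : (Fin (n + 1) × Fin q) × Fin k → K)
    (π : Fin s → Fin (n + 1) × Fin q) (F : Fin (n + 1) × {μ : Fin k → ℕ // ∑ i, μ i = d} → K)
    (j : Fin s) (l : Fin k) : secantJacobian (groupPoint z π) F (Sum.inr (j, l)) =
      eval (fun l => z (π j, l)) (pderiv l (componentForm F (π j).1).1) := by
  rw [secantJacobian_inr]
  simp [groupPoint]

lemma finrank_range_secantJacobian_of_surjective {n k d q s : ℕ}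
    (z : (Fin (n + 1) × Fin q) × Fin k → K)
    (hz : ∀ i, Function.Surjective (groupJetMap d z i)) (π : Fin s → Fin (n + 1) × Fin q)
    (hπ : Function.Injective π) :
    s * (n + k) ≤ Module.finrank K (LinearMap.range (secantJacobian (d := d) (groupPoint z π))) := by
  let A : ((Fin s × Fin (n + 1)) ⊕ (Fin s × Fin k) → K) →ₗ[K]
      ((Fin s × Fin n) ⊕ (Fin s × Fin k) → K) :=
    LinearMap.funLeft K K (Sum.map (fun p => (p.1, (π p.1).1.succAbove p.2)) id)
  have hs : Function.Surjective (A ∘ₗ secantJacobian (d := d) (groupPoint z π)) := by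
    intro c
    let w : Fin s → Fin (n + 1) → K := fun j =>
      Fin.insertNth (α := fun _ => K) (π j).1 0 fun t => c (Sum.inl (j, t))
    choose f hf using fun i => hz i (Sum.elim
      (fun p => Function.extend π (fun j l => c (Sum.inr (j, l))) 0 (i, p.1) p.2)
      (fun t => Function.extend π w 0 t.1 i))
    refine ⟨fun p => homogeneousSubmoduleEquiv K k d (f p.1) p.2, funext ?_⟩
    have hc : ∀ i, componentForm (fun p => homogeneousSubmoduleEquiv K k d (f p.1) p.2) i = f i :=
      fun i => (homogeneousSubmoduleEquiv K k d).symm_apply_apply (f i)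
    rintro (⟨j, t⟩ | ⟨j, l⟩)
    · change secantJacobian _ _ (Sum.inl (j, (π j).1.succAbove t)) = _
      rw [secantJacobian_inl, hc]
      have h1 := congrFun (hf ((π j).1.succAbove t))
        (Sum.inr ⟨π j, (Fin.succAbove_ne _ _).symm⟩)
      refine Eq.trans h1 ?_
      simp [hπ.extend_apply, w]
    · change secantJacobian _ _ (Sum.inr (j, l)) = _
      rw [secantJacobian_groupPoint_inr, hc]
      have h1 := congrFun (hf (π j).1) (Sum.inl ((π j).2, l))
      refine Eq.trans h1 ?_
      simp [hπ.extend_apply]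
  rw [← le_finrank_range_iff_surjective, LinearMap.range_comp] at hs
  simp only [Fintype.card_sum, Fintype.card_prod, Fintype.card_fin] at hs
  rw [mul_add]
  exact hs.trans (Submodule.finrank_map_le _ _)

lemma finrank_range_secantJacobian_of_injective {n k d q s : ℕ}
    (z : (Fin (n + 1) × Fin q) × Fin k → K)
    (hz : ∀ i, Function.Injective (groupJetMap d z i)) (π : Fin s → Fin (n + 1) × Fin q)
    (hπ : Function.Surjective π) :
    (n + 1) * k.multichoose d ≤
      Module.finrank K (LinearMap.range (secantJacobian (d := d) (groupPoint z π))) := by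
  have hi : Function.Injective (secantJacobian (d := d) (groupPoint z π)) := by
    refine (injective_iff_map_eq_zero _).2 fun F hF => ?_
    have h0 : ∀ i, componentForm F i = 0 := by
      intro i
      refine hz i ?_
      rw [map_zero]
      funext t
      rcases t with ⟨a, l⟩ | ⟨p, hp⟩
      · obtain ⟨j, hj⟩ := hπ (i, a)
        have h1 := congrFun hF (Sum.inr (j, l))
        rw [secantJacobian_groupPoint_inr, hj] at h1
        exact h1
      · obtain ⟨j, rfl⟩ := hπ p
        have h1 := congrFun hF (Sum.inl (j, i))
        rw [secantJacobian_inl] at h1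
        exact h1
    funext p
    exact congrFun ((LinearEquiv.map_eq_zero_iff _).1 (h0 p.1)) p.2
  rw [LinearMap.finrank_range_of_inj hi, Module.finrank_fintype_fun_eq_card, Fintype.card_prod,
    card_exponents, Fintype.card_fin]

end Secant

lemma secantParam_mem_secantCone {K : Type} [Field K] {n m d s : ℕ}
    (x : (Fin s × Fin (n + 1)) ⊕ (Fin s × Fin (m + 1)) → K) :
    (fun p => eval x (secantParam K n (m + 1) d s p)) ∈ secantCone K (svCone K n m d) s :=
  ⟨fun j p => x (Sum.inl (j, p.1)) * ∏ i, x (Sum.inr (j, i)) ^ p.2.1 i,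
    fun j => ⟨fun i => x (Sum.inl (j, i)), fun i => x (Sum.inr (j, i)), rfl⟩,
    funext fun p => by rw [eval_secantParam, Finset.sum_apply]⟩

lemma not_grassmannDefective_of_le {K : Type} [Field K] [CharZero K] {n m d s : ℕ} (hs : 1 ≤ s)
    (x : (Fin s × Fin (n + 1)) ⊕ (Fin s × Fin (m + 1)) → K)
    (hx : min ((n + 1) * (m + d).choose d) (s * (n + m + 1)) ≤
      Module.finrank K (LinearMap.range (secantJacobian (d := d) x))) :
    ¬ GrassmannDefective K n m d s := by
  have h := le_coneKrullDim_of_jacobian (secantCone K (svCone K n m d) s)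
    (secantParam K n (m + 1) d s) secantParam_mem_secantCone x (secantJacobian x)
    (fun _ _ => rfl) hx
  refine not_lt.2 (le_trans (le_of_eq ?_) h)
  have h1 : 0 < (n + 1) * (m + d).choose d :=
    Nat.mul_pos n.succ_pos (Nat.choose_pos (Nat.le_add_left d m))
  have h2 : 0 < s * (n + m + 1) := Nat.mul_pos hs (Nat.succ_pos _)
  have h3 : min ((n + 1) * (m + d).choose d - 1) (s * (n + m + 1) - 1) + 1 =
      min ((n + 1) * (m + d).choose d) (s * (n + m + 1)) := by omega
  rw [← h3]
  norm_cast

/-- **Remark.**  Let `d ≥ 3`, `n, m ≥ 1`, `s₁` the largest multiple of `n+1` at most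
`⌊(n+1)·C(m+d,d)/(m+n+1)⌋`, `s₂` the smallest multiple of `n+1` at least
`⌈(n+1)·C(m+d,d)/(m+n+1)⌉`.  Then the `d`-uple Veronese embedding of `P^m` is not
`(n, s−1)`-Grassmann defective for any `s ≤ s₁` and any `s ≥ s₂`. -/
theorem stmt5 (K : Type) [Field K] [IsAlgClosed K] [CharZero K]
    (n m d : ℕ) (hd : 3 ≤ d) (hn : 1 ≤ n) (hm : 1 ≤ m)
    (s₁ s₂ : ℕ)
    (hs₁ : (n + 1) ∣ s₁ ∧ s₁ * (m + n + 1) ≤ (n + 1) * ((m + d).choose d) ∧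
      ∀ s', (n + 1) ∣ s' → s' * (m + n + 1) ≤ (n + 1) * ((m + d).choose d) → s' ≤ s₁)
    (hs₂ : (n + 1) ∣ s₂ ∧ (n + 1) * ((m + d).choose d) ≤ s₂ * (m + n + 1) ∧
      ∀ s', (n + 1) ∣ s' → (n + 1) * ((m + d).choose d) ≤ s' * (m + n + 1) → s₂ ≤ s') :
    ∀ s : ℕ, 1 ≤ s → (s ≤ s₁ ∨ s₂ ≤ s) → ¬ GrassmannDefective K n m d s := by
  have hN : (m + 1).multichoose d = (m + d).choose d := by
    rw [Nat.multichoose_eq]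
    congr 1
    omega
  have hpb := multichoose_le_pointBound (m + 1) d
  have hG := gradSurj_pointBound (K := K) (k := m + 1) (by omega) hd
  rw [← hN] at hs₁ hs₂
  rintro s hs (hle | hle)
  · obtain ⟨⟨q, rfl⟩, hq, -⟩ := hs₁
    rw [mul_assoc] at hq
    have hq' := Nat.le_of_mul_le_mul_left hq n.succ_pos
    have hqb : q ≤ pointBound (m + 1) d := by
      refine Nat.le_of_mul_le_mul_right (c := m + 1 + 1) (le_trans ?_ (hq'.trans hpb)) (by omega)
      exact Nat.mul_le_mul_left q (by omega)
    obtain ⟨z, hz⟩ := (hG.mono hqb).exists_groupJetMap_surjective (n := n)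
      (by rwa [show n + (m + 1) = m + n + 1 by omega])
    obtain ⟨π⟩ := Function.Embedding.nonempty_of_card_le (α := Fin s) (β := Fin (n + 1) × Fin q)
      (by simpa)
    refine not_grassmannDefective_of_le hs (groupPoint z π) (min_le_of_right_le ?_)
    exact finrank_range_secantJacobian_of_surjective z hz π π.injective
  · obtain ⟨⟨q, rfl⟩, hq, hmin⟩ := hs₂
    rw [mul_assoc] at hq
    have hq' := Nat.le_of_mul_le_mul_left hq n.succ_pos
    have hqb : q ≤ pointBound (m + 1) d := by
      refine Nat.le_of_mul_le_mul_left (hmin _ (dvd_mul_right _ _) ?_) n.succ_pos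
      rw [mul_assoc]
      exact Nat.mul_le_mul_left _ (hpb.trans (Nat.mul_le_mul_left _ (by omega)))
    have hq0 : 0 < q := by
      have h1 : 0 < (m + 1).multichoose d := hN ▸ Nat.choose_pos (Nat.le_add_left d m)
      exact Nat.pos_of_mul_pos_right (h1.trans_le hq')
    have : Nonempty (Fin (n + 1) × Fin q) := ⟨(0, ⟨0, hq0⟩)⟩
    obtain ⟨z, hz⟩ := (hG.mono hqb).exists_groupJetMap_injective (n := n)
      (by rwa [show n + (m + 1) = m + n + 1 by omega])
    obtain ⟨e⟩ := Function.Embedding.nonempty_of_card_le (α := Fin (n + 1) × Fin q) (β := Fin s)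
      (by simpa)
    refine not_grassmannDefective_of_le hs (groupPoint z (Function.invFun e)) (min_le_of_left_le ?_)
    rw [← hN]
    exact finrank_range_secantJacobian_of_injective z hz _ (Function.invFun_surjective e.injective)
end
end

section
/- Let H_1 ≅ P^{n-1} and H_2 ≅ P^{m-1} be generic linear subspaces of P^{n+m} and d ≥ 1. Then the degree d+1 piece of the ideal of the scheme dH_1 + H_2 satisfies dim (I_{dH_1+H_2})_{d+1} = (n+1)·C(m+d, d), which equals the dimension of the bidegree-(1,d) piece R_{(1,d)} of the multigraded coordinate ring R = K[x_0,…,x_n, y_0,…,y_m] of P^n × P^m. -/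
open MvPolynomial

noncomputable section

/-- The degree-`t` homogeneous piece of an ideal `I` of a polynomial ring, as a
`K`-vector space; `Module.finrank K (piece K I t)` is `dim (I)_t`. -/
def piece (K : Type) [Field K] {ι : Type} (I : Ideal (MvPolynomial ι K)) (t : ℕ) :
    Submodule K (MvPolynomial ι K) :=
  Submodule.restrictScalars K I ⊓ MvPolynomial.homogeneousSubmodule ι K t

/-- The (saturated, radical) homogeneous ideal of the projective linear subspace spanned
by the set `S` of vectors: the ideal generated by all linear forms vanishing on `S`. -/
def linIdeal (K : Type) [Field K] {ι : Type} (S : Set (ι → K)) : Ideal (MvPolynomial ι K) :=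
  Ideal.span { f | f ∈ MvPolynomial.homogeneousSubmodule ι K 1 ∧ ∀ x ∈ S, MvPolynomial.eval x f = 0 }

/-- Bigrading weight on the variables of `K[x₀,…,xₙ,y₀,…,y_m]`. -/
def bweight (n m : ℕ) : (Fin (n + 1) ⊕ Fin (m + 1)) → ℕ × ℕ :=
  Sum.elim (fun _ => ((1 : ℕ), (0 : ℕ))) (fun _ => ((0 : ℕ), (1 : ℕ)))

/-- The algebra map `X_c ↦ ∑ s, B s c X_s`, i.e. the pullback of polynomial functions along the
linear map `x ↦ x ᵥ* B`. -/
def linSubst {K σ τ : Type} [Field K] [Fintype σ] (B : Matrix σ τ K) :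
    MvPolynomial τ K →ₐ[K] MvPolynomial σ K :=
  aeval fun c => ∑ s, C (B s c) * X s

section linSubst

variable {K σ τ : Type} [Field K] [Fintype σ]

@[simp]
theorem linSubst_X (B : Matrix σ τ K) (c : τ) :
    linSubst B (X c) = ∑ s, C (B s c) * X s := by
  simp [linSubst]

theorem eval_linSubst (B : Matrix σ τ K) (x : σ → K) (f : MvPolynomial τ K) :
    eval x (linSubst B f) = eval (Matrix.vecMul x B) f := by
  have : ((eval x).comp (linSubst B).toRingHom) = eval (Matrix.vecMul x B) := by
    ext c
    · simp
    · simp [Matrix.vecMul, dotProduct, mul_comm]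
  exact congrArg (fun F : MvPolynomial τ K →+* K => F f) this

theorem linSubst_comp {υ : Type} [Fintype τ] (B : Matrix σ τ K) (B' : Matrix τ υ K) :
    (linSubst B).comp (linSubst B') = linSubst (B * B') := by
  ext1 u
  simp only [AlgHom.comp_apply, linSubst_X, map_sum, map_mul, Matrix.mul_apply,
    Finset.sum_mul, Finset.mul_sum, algHom_C, algebraMap_eq]
  rw [Finset.sum_comm]
  refine Finset.sum_congr rfl fun _ _ => Finset.sum_congr rfl fun _ _ => ?_
  ring

theorem linSubst_one [DecidableEq σ] : linSubst (1 : Matrix σ σ K) = AlgHom.id K _ := by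
  ext1 u
  simp [Matrix.one_apply]

theorem linSubst_isHomogeneous (B : Matrix σ τ K) {f : MvPolynomial τ K} {t : ℕ}
    (hf : f.IsHomogeneous t) : (linSubst B f).IsHomogeneous t := by
  have h := hf.aeval (S := K) (n := 1) (fun c => ∑ s, C (B s c) * X s) fun c =>
    IsHomogeneous.sum _ _ _ fun s _ => by simpa using (isHomogeneous_C _ (B s c)).mul (isHomogeneous_X K s)
  simpa [linSubst] using h

theorem map_linIdeal_le (B : Matrix σ τ K) (S : Set (τ → K)) (S' : Set (σ → K))
    (h : ∀ x ∈ S', Matrix.vecMul x B ∈ S) :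
    (linIdeal K S).map (linSubst B) ≤ linIdeal K S' := by
  rw [linIdeal, Ideal.map_span, Ideal.span_le]
  rintro _ ⟨f, ⟨hf, hS⟩, rfl⟩
  exact Ideal.subset_span ⟨linSubst_isHomogeneous B hf, fun x hx =>
    (eval_linSubst B x f).trans (hS _ (h x hx))⟩

variable [Fintype τ] [DecidableEq σ] [DecidableEq τ]

/-- Invertible linear substitutions as algebra equivalences. -/
def linSubstEquiv (B : Matrix σ τ K) (B' : Matrix τ σ K)
    (h : B * B' = 1) (h' : B' * B = 1) : MvPolynomial τ K ≃ₐ[K] MvPolynomial σ K :=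
  AlgEquiv.ofAlgHom (linSubst B) (linSubst B')
    (by rw [linSubst_comp, h, linSubst_one]) (by rw [linSubst_comp, h', linSubst_one])

theorem map_linIdeal_eq {B : Matrix σ τ K}
    {B' : Matrix τ σ K} (h : B * B' = 1) (h' : B' * B = 1) {S : Set (τ → K)} {S' : Set (σ → K)}
    (hS : S = (Matrix.vecMul · B) '' S') :
    (linIdeal K S).map (linSubstEquiv B B' h h' : MvPolynomial τ K →+* MvPolynomial σ K)
      = linIdeal K S' := by
  apply le_antisymm
  · exact map_linIdeal_le B S S' fun x hx => hS ▸ ⟨x, hx, rfl⟩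
  · have h1 := map_linIdeal_le B' S' S (by
      rw [hS]
      rintro _ ⟨x, hx, rfl⟩
      simpa [Matrix.vecMul_vecMul, h] using hx)
    have h2 := Ideal.map_mono (f := linSubst B) h1
    rw [Ideal.map_mapₐ, linSubst_comp, h, linSubst_one] at h2
    exact (Ideal.map_id _).symm.trans_le h2

theorem map_inf_linSubstEquiv {B : Matrix σ τ K} {B' : Matrix τ σ K} (h : B * B' = 1)
    (h' : B' * B = 1) (I J : Ideal (MvPolynomial τ K)) :
    (I ⊓ J).map (linSubstEquiv B B' h h' : MvPolynomial τ K →+* MvPolynomial σ K)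
      = I.map (linSubstEquiv B B' h h' : MvPolynomial τ K →+* MvPolynomial σ K) ⊓
        J.map (linSubstEquiv B B' h h' : MvPolynomial τ K →+* MvPolynomial σ K) := by
  have hmap (I : Ideal (MvPolynomial τ K)) :
      I.map (linSubstEquiv B B' h h' : MvPolynomial τ K →+* MvPolynomial σ K)
        = I.comap ((linSubstEquiv B B' h h').toRingEquiv.symm : MvPolynomial σ K →+* _) :=
    Ideal.map_comap_of_equiv (linSubstEquiv B B' h h').toRingEquiv
  rw [hmap, hmap, hmap, Ideal.comap_inf]

theorem finrank_piece_map {B : Matrix σ τ K}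
    {B' : Matrix τ σ K} (h : B * B' = 1) (h' : B' * B = 1) (I : Ideal (MvPolynomial τ K))
    (t : ℕ) :
    Module.finrank K (piece K I t) = Module.finrank K
      (piece K (I.map (linSubstEquiv B B' h h' : MvPolynomial τ K →+* MvPolynomial σ K)) t) := by
  rw [← LinearEquiv.finrank_map_eq (linSubstEquiv B B' h h').toLinearEquiv]
  refine congrArg (fun V : Submodule K (MvPolynomial σ K) => Module.finrank K V) ?_
  ext f
  simp only [piece, Submodule.mem_map, Submodule.mem_inf, Submodule.restrictScalars_mem,
    mem_homogeneousSubmodule]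
  constructor
  · rintro ⟨f, ⟨hf, hf'⟩, rfl⟩
    exact ⟨Ideal.mem_map_of_mem _ hf, linSubst_isHomogeneous B hf'⟩
  · rintro ⟨hf, hf'⟩
    obtain ⟨g, hg, rfl⟩ := (Ideal.mem_map_of_equiv (linSubstEquiv B B' h h').toRingEquiv f).1 hf
    refine ⟨g, ⟨hg, ?_⟩, rfl⟩
    have := linSubst_isHomogeneous B' hf'
    rwa [show linSubst B' ((linSubstEquiv B B' h h').toRingEquiv g) = g from
      (linSubstEquiv B B' h h').symm_apply_apply g] at this

end linSubst

section MonomialIdeals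

variable {K σ : Type} [Field K]

theorem eval_single_of_isHomogeneous_one [DecidableEq σ] {f : MvPolynomial σ K}
    (hf : f.IsHomogeneous 1) (j : σ) :
    eval (Pi.single j 1) f = coeff (Finsupp.single j 1) f := by
  rw [eval_eq, Finset.sum_eq_single (Finsupp.single j 1)]
  · simp
  · intro m hm hmj
    have hdeg : m.degree = 1 := by
      by_contra hne
      exact (mem_support_iff.1 hm) (hf.coeff_eq_zero hne)
    obtain ⟨k, rfl⟩ := (Finsupp.sum_eq_one_iff _).mp hdeg
    have hkj : k ≠ j := fun h => hmj (h ▸ rfl)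
    simp [hkj]
  · intro h
    simp [notMem_support_iff.1 h]

theorem linIdeal_single [DecidableEq σ] (A : Set σ) :
    linIdeal K ((fun i => Pi.single i (1 : K)) '' A) = Ideal.span (X '' Aᶜ) := by
  apply le_antisymm
  · rw [linIdeal, Ideal.span_le]
    rintro f ⟨hf, hA⟩
    rw [SetLike.mem_coe, mem_ideal_span_X_image]
    intro m hm
    have hdeg : m.degree = 1 := by
      by_contra hne
      exact (mem_support_iff.1 hm) (IsHomogeneous.coeff_eq_zero hf hne)
    obtain ⟨k, rfl⟩ := (Finsupp.sum_eq_one_iff _).mp hdeg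
    refine ⟨k, fun hk => mem_support_iff.1 hm ?_, by simp⟩
    rw [← eval_single_of_isHomogeneous_one hf]
    exact hA _ ⟨k, hk, rfl⟩
  · rw [Ideal.span_le]
    rintro _ ⟨j, hj, rfl⟩
    refine Ideal.subset_span ⟨isHomogeneous_X K j, ?_⟩
    rintro _ ⟨i, hi, rfl⟩
    have : j ≠ i := fun h => hj (h ▸ hi)
    simp [this]

theorem mem_span_X_image_pow_iff (s : Finset σ) (k : ℕ) (f : MvPolynomial σ K) :
    f ∈ Ideal.span (X '' (s : Set σ)) ^ k ↔ ∀ m ∈ f.support, k ≤ ∑ i ∈ s, m i := by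
  classical
  constructor
  · induction k generalizing f with
    | zero => simp
    | succ k ih =>
      intro hf
      rw [pow_succ] at hf
      refine Submodule.mul_induction_on hf (fun p hp q hq m hm => ?_) fun p q hp hq m hm => ?_
      · obtain ⟨a, ha, b, hb, rfl⟩ := Finset.mem_add.1 (support_mul p q hm)
        obtain ⟨i, hi, hbi⟩ := mem_ideal_span_X_image.1 hq b hb
        have h1 := ih p hp a ha
        have h2 : b i ≤ ∑ i ∈ s, b i := Finset.single_le_sum (fun _ _ => Nat.zero_le _) hi
        simp only [Finsupp.add_apply, Finset.sum_add_distrib]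
        omega
      · exact (Finset.mem_union.1 (support_add hm)).elim (hp m) (hq m)
  · intro hf
    rw [f.as_sum]
    refine Ideal.sum_mem _ fun m hm => Ideal.pow_le_pow_right (hf m hm) ?_
    rw [monomial_eq]
    refine Ideal.mul_mem_left _ _ ?_
    have hsub : m.prod (fun n e => (X n : MvPolynomial σ K) ^ e)
        = ∏ i ∈ m.support ∪ s, X i ^ m i :=
      Finsupp.prod_of_support_subset _ Finset.subset_union_left _ (by simp)
    rw [hsub, ← Finset.prod_sdiff (Finset.subset_union_right (s₁ := m.support) (s₂ := s)),
      ← Finset.prod_pow_eq_pow_sum]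
    exact Ideal.mul_mem_left _ _ (Ideal.prod_mem_prod fun i hi =>
      Ideal.pow_mem_pow (Ideal.subset_span (Set.mem_image_of_mem X hi)) _)

theorem finrank_restrictSupport (T : Set (σ →₀ ℕ)) :
    Module.finrank K (restrictSupport K T) = Nat.card T :=
  Module.finrank_eq_nat_card_basis (basisRestrictSupport K T)

end MonomialIdeals

section Counting

theorem natCard_sum_eq (m d : ℕ) :
    Nat.card {k : Fin (m + 1) →₀ ℕ // ∑ i, k i = d} = (m + d).choose d := by
  have e : {k : Fin (m + 1) →₀ ℕ // ∑ i, k i = d} ≃ Sym (Fin (m + 1)) d :=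
    (Equiv.subtypeEquivRight fun k => by simp [Finsupp.sum_fintype]).trans
      (Sym.equivNatSum (Fin (m + 1)) d).symm
  rw [Nat.card_congr e, Nat.card_eq_fintype_card, Sym.card_sym_eq_choose]
  simp only [Fintype.card_fin]
  congr 1
  omega

theorem finsupp_eq_single_of_sum_eq_one {ι : Type} [Fintype ι] {k : ι →₀ ℕ}
    (h : ∑ i, k i = 1) : ∃ i, k = Finsupp.single i 1 := by
  apply (Finsupp.sum_eq_one_iff k).1
  rw [Finsupp.sum_fintype _ _ (by simp)]
  exact h

theorem natCard_bidegree (n m d : ℕ) :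
    Nat.card {k : Fin (n + 1) ⊕ Fin (m + 1) →₀ ℕ |
      ∑ i, k (.inl i) = 1 ∧ ∑ i, k (.inr i) = d} = (n + 1) * (m + d).choose d := by
  let F : Fin (n + 1) × {k : Fin (m + 1) →₀ ℕ // ∑ i, k i = d} →
      {k : Fin (n + 1) ⊕ Fin (m + 1) →₀ ℕ | ∑ i, k (.inl i) = 1 ∧ ∑ i, k (.inr i) = d} :=
    fun p => ⟨Finsupp.sumElim (Finsupp.single p.1 1) p.2.1, by
      simp [Finsupp.sumElim_apply, Finsupp.single_apply, p.2.2]⟩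
  have hF : Function.Bijective F := by
    constructor
    · rintro ⟨i, k, hk⟩ ⟨i', k', hk'⟩ h
      have h := congrArg Subtype.val h
      have h1 : Finsupp.single i 1 = Finsupp.single i' 1 :=
        Finsupp.ext fun x => DFunLike.congr_fun h (.inl x)
      have h2 : k = k' := Finsupp.ext fun x => DFunLike.congr_fun h (.inr x)
      rw [Finsupp.single_left_inj one_ne_zero] at h1
      subst h1 h2
      rfl
    · rintro ⟨k, hk1, hk2⟩
      let e := Finsupp.sumFinsuppEquivProdFinsupp k
      obtain ⟨i, hi⟩ := finsupp_eq_single_of_sum_eq_one (k := e.1) hk1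
      refine ⟨(i, ⟨e.2, hk2⟩), Subtype.ext ?_⟩
      ext (x | x)
      · exact (DFunLike.congr_fun hi x).symm
      · rfl
  rw [← Nat.card_congr (Equiv.ofBijective F hF), Nat.card_prod, natCard_sum_eq, Nat.card_fin]

/-- The exponents of degree `d + 1` lying in both monomial ideals. -/
theorem natCard_fat_exponents (n m d : ℕ) :
    Nat.card {k : Fin n ⊕ Fin (m + 1) →₀ ℕ |
      (∑ i, k (.inl i) + ∑ i, k (.inr i) = d + 1) ∧ d ≤ ∑ i, k (.inr i) ∧
      ((∃ i, k (.inl i) ≠ 0) ∨ k (.inr (Fin.last m)) ≠ 0)} = (n + 1) * (m + d).choose d := by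
  set T := {k : Fin n ⊕ Fin (m + 1) →₀ ℕ |
      (∑ i, k (.inl i) + ∑ i, k (.inr i) = d + 1) ∧ d ≤ ∑ i, k (.inr i) ∧
      ((∃ i, k (.inl i) ≠ 0) ∨ k (.inr (Fin.last m)) ≠ 0)} with hT
  let F : Option (Fin n) × {k : Fin (m + 1) →₀ ℕ // ∑ i, k i = d} →
      Fin n ⊕ Fin (m + 1) →₀ ℕ := fun p =>
    p.1.elim (Finsupp.sumElim 0 (p.2.1 + Finsupp.single (Fin.last m) 1))
      fun i => Finsupp.sumElim (Finsupp.single i 1) p.2.1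
  have hFT : ∀ p, F p ∈ T := by
    rintro ⟨_ | i, k, hk⟩
    · simp [F, hT, Finsupp.sumElim_apply, Finset.sum_add_distrib, hk, Finsupp.single_apply]
    · refine ⟨?_, ?_, Or.inl ⟨i, ?_⟩⟩ <;>
        simp [F, Finsupp.sumElim_apply, hk, Finsupp.single_apply, add_comm]
  have hF : Function.Bijective fun p => (⟨F p, hFT p⟩ : T) := by
    constructor
    · rintro ⟨i, k, hk⟩ ⟨i', k', hk'⟩ h
      have h : F (i, ⟨k, hk⟩) = F (i', ⟨k', hk'⟩) := congrArg Subtype.val h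
      rcases i with _ | i <;> rcases i' with _ | i'
      · have h2 : k + Finsupp.single (Fin.last m) 1 = k' + Finsupp.single (Fin.last m) 1 :=
          Finsupp.ext fun x => DFunLike.congr_fun h (.inr x)
        obtain rfl := add_right_cancel h2
        rfl
      · have := DFunLike.congr_fun h (.inl i')
        simp [F, Finsupp.sumElim_apply] at this
      · have := DFunLike.congr_fun h (.inl i)
        simp [F, Finsupp.sumElim_apply] at this
      · have h1 : Finsupp.single i 1 = Finsupp.single i' 1 :=
          Finsupp.ext fun x => DFunLike.congr_fun h (.inl x)
        have h2 : k = k' := Finsupp.ext fun x => DFunLike.congr_fun h (.inr x)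
        rw [Finsupp.single_left_inj one_ne_zero] at h1
        subst h1 h2
        rfl
    · rintro ⟨k, hk1, hk2, hk3⟩
      let e := Finsupp.sumFinsuppEquivProdFinsupp k
      by_cases h0 : ∑ i, k (.inl i) = 0
      · have hz : ∀ i, k (.inl i) = 0 := by simpa using h0
        have hl : k (.inr (Fin.last m)) ≠ 0 := hk3.resolve_left (by simp [hz])
        have hle : Finsupp.single (Fin.last m) 1 ≤ e.2 :=
          Finsupp.single_le_iff.2 (Nat.one_le_iff_ne_zero.2 hl)
        have hadd := tsub_add_cancel_of_le hle
        have hsum : ∑ i, (e.2 - Finsupp.single (Fin.last m) 1 : Fin (m + 1) →₀ ℕ) i = d := by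
          have h := congrArg (fun q : Fin (m + 1) →₀ ℕ => ∑ i, q i) hadd
          have he : ∑ i, e.2 i = ∑ i, k (.inr i) := rfl
          simp only [Finsupp.add_apply, Finset.sum_add_distrib, Finsupp.single_apply,
            Finset.sum_ite_eq, Finset.mem_univ, if_true] at h
          omega
        refine ⟨(none, ⟨_, hsum⟩), Subtype.ext ?_⟩
        ext (x | x)
        · exact (hz x).symm
        · exact DFunLike.congr_fun hadd x
      · obtain ⟨i, hi⟩ := finsupp_eq_single_of_sum_eq_one (k := e.1)
          (show ∑ i, k (.inl i) = 1 by omega)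
        refine ⟨(some i, ⟨e.2, show ∑ i, k (.inr i) = d by omega⟩), Subtype.ext ?_⟩
        ext (x | x)
        · exact (DFunLike.congr_fun hi x).symm
        · rfl
  rw [← Nat.card_congr (Equiv.ofBijective _ hF), Nat.card_prod, natCard_sum_eq,
    Nat.card_eq_fintype_card, Fintype.card_option, Fintype.card_fin]

end Counting

theorem finrank_bidegree (K : Type) [Field K] (n m d : ℕ) :
    Module.finrank K (weightedHomogeneousSubmodule K (bweight n m) (1, d))
      = (n + 1) * (m + d).choose d := by
  rw [weightedHomogeneousSubmodule_eq_finsupp_supported, ← natCard_bidegree n m d]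
  refine (finrank_restrictSupport _).trans (congrArg (fun s : Set _ => Nat.card s) ?_)
  ext k
  simp [Finsupp.weight_apply, Finsupp.sum_fintype, bweight, Prod.ext_iff, Prod.fst_sum, Prod.snd_sum,
    -nsmul_eq_mul]

theorem finrank_piece_coordinate (K : Type) [Field K] (n m d : ℕ) :
    Module.finrank K (piece K
      (linIdeal K ((fun i => Pi.single i (1 : K)) ''
          (Set.range (Sum.inl : Fin n → Fin n ⊕ Fin (m + 1)))) ^ d ⊓
        linIdeal K ((fun i => Pi.single i (1 : K)) ''
          (Set.range fun i : Fin m => (Sum.inr i.castSucc : Fin n ⊕ Fin (m + 1))))) (d + 1))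
      = (n + 1) * (m + d).choose d := by
  rw [linIdeal_single, linIdeal_single, ← natCard_fat_exponents n m d,
    ← finrank_restrictSupport (K := K)]
  refine congrArg (fun V : Submodule K (MvPolynomial (Fin n ⊕ Fin (m + 1)) K) =>
    Module.finrank K V) ?_
  ext f
  have hs : (Set.range (Sum.inl : Fin n → Fin n ⊕ Fin (m + 1)))ᶜ
      = (Finset.univ.map Function.Embedding.inr : Finset (Fin n ⊕ Fin (m + 1))) := by
    ext (x | x) <;> simp
  rw [piece, hs, homogeneousSubmodule_eq_finsupp_supported, Submodule.mem_inf,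
    Submodule.restrictScalars_mem, Submodule.mem_inf, mem_span_X_image_pow_iff,
    mem_ideal_span_X_image, mem_restrictSupport_iff, AddMonoidAlgebra.mem_supported]
  have hex : ∀ k : Fin n ⊕ Fin (m + 1) →₀ ℕ,
      (∃ i ∈ (Set.range fun i : Fin m => (Sum.inr i.castSucc : Fin n ⊕ Fin (m + 1)))ᶜ, k i ≠ 0) ↔
      ((∃ i, k (.inl i) ≠ 0) ∨ k (.inr (Fin.last m)) ≠ 0) := by
    intro k
    simp [Fin.exists_fin_succ']
  simp only [hex, Set.subset_def, Finset.sum_map, Function.Embedding.inr_apply, Set.mem_ofPred_eq,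
    Finset.mem_coe, Finsupp.degree_eq_sum, Fintype.sum_sum_type]
  exact ⟨fun hf k hk => ⟨hf.2 k hk, hf.1.1 k hk, hf.1.2 k hk⟩,
    fun hf => ⟨⟨fun k hk => (hf k hk).2.1, fun k hk => (hf k hk).2.2⟩, fun k hk => (hf k hk).1⟩⟩

/-- Let `H₁ ≅ P^{n-1}`, `H₂ ≅ P^{m-1}` be generic linear subspaces of `P^{n+m}` and
`d ≥ 1`.  Then `dim (I_{dH₁+H₂})_{d+1} = (n+1)·C(m+d,d)`, which equals the dimension of
the bidegree-`(1,d)` piece `R_{(1,d)}` of the multigraded coordinate ring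
`R = K[x₀,…,xₙ,y₀,…,y_m]` of `P^n × P^m`. -/
theorem stmt10 (K : Type) [Field K] [IsAlgClosed K] [CharZero K]
    (n m d : ℕ) (hd : 1 ≤ d) (hn : 1 ≤ n) (hm : 1 ≤ m) :
    (∃ g : MvPolynomial (ℕ × ℕ) K, g ≠ 0 ∧
      ∀ P : ℕ → ℕ → K, MvPolynomial.eval (fun ij => P ij.1 ij.2) g ≠ 0 →
        let a : Fin n → (Fin (n + m + 1) → K) := fun i c => P (i : ℕ) (c : ℕ)
        let b : Fin m → (Fin (n + m + 1) → K) := fun i c => P (n + (i : ℕ)) (c : ℕ)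
        Module.finrank K
            (piece K ((linIdeal K (Set.range a)) ^ d ⊓ linIdeal K (Set.range b)) (d + 1))
          = (n + 1) * ((m + d).choose d)) ∧
    Module.finrank K
        (MvPolynomial.weightedHomogeneousSubmodule K (bweight n m) (1, d))
      = (n + 1) * ((m + d).choose d) := by
  refine ⟨⟨rename (Prod.map Fin.val Fin.val)
    (Matrix.mvPolynomialX (Fin (n + m + 1)) (Fin (n + m + 1)) K).det, ?_, ?_⟩,
    finrank_bidegree K n m d⟩
  · rw [Ne, map_eq_zero_iff _
      (rename_injective _ (Fin.val_injective.prodMap Fin.val_injective))]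
    exact Matrix.det_mvPolynomialX_ne_zero _ _
  intro P hP a b
  rw [eval_rename, Matrix.eval_det_mvPolynomialX] at hP
  set A : Matrix (Fin (n + m + 1)) (Fin (n + m + 1)) K := Matrix.of fun i j => P i j with hA
  have hdet : IsUnit A.det := isUnit_iff_ne_zero.2 hP
  let e : Fin n ⊕ Fin (m + 1) ≃ Fin (n + m + 1) := finSumFinEquiv
  let B : Matrix (Fin n ⊕ Fin (m + 1)) (Fin (n + m + 1)) K := A.submatrix e id
  let B' : Matrix (Fin (n + m + 1)) (Fin n ⊕ Fin (m + 1)) K := A⁻¹.submatrix id e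
  have h : B * B' = 1 := by
    simp only [B, B']
    rw [← Matrix.submatrix_mul A A⁻¹ e id e Function.bijective_id, Matrix.mul_nonsing_inv A hdet,
      Matrix.submatrix_one_equiv]
  have h' : B' * B = 1 := by
    simp only [B, B']
    rw [Matrix.submatrix_mul_equiv A⁻¹ A id e id, Matrix.nonsing_inv_mul A hdet,
      Matrix.submatrix_id_id]
  have ha : Set.range a = (Matrix.vecMul · B) '' ((fun i => Pi.single i (1 : K)) ''
      (Set.range (Sum.inl : Fin n → Fin n ⊕ Fin (m + 1)))) := by
    rw [← Set.range_comp, ← Set.range_comp]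
    congr 1
    ext i c
    simp [a, B, A, e]
  have hb : Set.range b = (Matrix.vecMul · B) '' ((fun i => Pi.single i (1 : K)) ''
      (Set.range fun i : Fin m => (Sum.inr i.castSucc : Fin n ⊕ Fin (m + 1)))) := by
    rw [← Set.range_comp, ← Set.range_comp]
    congr 1
    ext i c
    simp [b, B, A, e]
  rw [finrank_piece_map h h', ← finrank_piece_coordinate K n m d,
    ← map_linIdeal_eq h h' ha, ← map_linIdeal_eq h h' hb, ← Ideal.map_pow,
    map_inf_linSubstEquiv]
end
end

section
/- Let d ≥ 3, n, m ≥ 1, s, t ∈ ℕ. Let P_1, …, P_s be generic points of P^{n+m}, H_1 ≅ P^{n-1} and H_2 ≅ P^{m-1} generic linear subspaces, W_1, …, W_t generic n-dimensional linear subspaces containing H_1, and X = dH_1 + H_2 + 2P_1 + ⋯ + 2P_s + W_1 + ⋯ + W_t. Then dim (I_X)_{d+1} ≥ (n+1)·C(m+d,d) − s(n+m+1) − t(n+1). -/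
open MvPolynomial

noncomputable section

section LinearAlgebra

variable {K E : Type*} [Field K] [AddCommGroup E] [Module K E]

lemma finrank_le_finrank_inf_add {V Q F : Submodule K E} [FiniteDimensional K V]
    [FiniteDimensional K F] (h : V ≤ Q ⊔ F) :
    Module.finrank K V ≤ Module.finrank K (V ⊓ Q : Submodule K E) + Module.finrank K F := by
  let f : V →ₗ[K] E ⧸ Q := Q.mkQ ∘ₗ V.subtype
  have hker : Module.finrank K (LinearMap.ker f) =
      Module.finrank K (V ⊓ Q : Submodule K E) := by
    have : LinearMap.ker f = Q.comap V.subtype := by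
      simp [f, LinearMap.ker_comp]
    rw [this, ← Submodule.map_comap_subtype]
    exact (LinearEquiv.finrank_eq (Submodule.equivMapOfInjective _ V.injective_subtype _))
  have hrange : LinearMap.range f ≤ F.map Q.mkQ := by
    rintro _ ⟨x, rfl⟩
    obtain ⟨q, hq, y, hy, hxy⟩ := Submodule.mem_sup.1 (h x.2)
    refine ⟨y, hy, ?_⟩
    simp only [f, LinearMap.comp_apply, Submodule.subtype_apply, ← hxy, map_add]
    simp [(Submodule.Quotient.mk_eq_zero Q).2 hq]
  have h1 := LinearMap.finrank_range_add_finrank_ker f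
  have h2 := Submodule.finrank_mono hrange
  have h3 := Submodule.finrank_map_le Q.mkQ F
  omega

lemma finrank_le_finrank_inf_iInf_add {α : Type*} (V : Submodule K E) [FiniteDimensional K V]
    (Q : α → Submodule K E) (k : ℕ) (A : Finset α)
    (h : ∀ i ∈ A, ∃ F : Submodule K E, FiniteDimensional K F ∧ Module.finrank K F ≤ k ∧
      V ≤ Q i ⊔ F) :
    Module.finrank K V ≤
      Module.finrank K (V ⊓ ⨅ i ∈ A, Q i : Submodule K E) + A.card * k := by
  classical
  induction A using Finset.induction_on with
  | empty =>
    have h0 : V ⊓ ⨅ i ∈ (∅ : Finset α), Q i = V := by simp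
    rw [h0]
    exact Nat.le_add_right _ _
  | insert i A hi ih =>
    have h1 := ih fun j hj => h j (Finset.mem_insert_of_mem hj)
    obtain ⟨F, hF, hFk, hV⟩ := h i (Finset.mem_insert_self i A)
    have : FiniteDimensional K (V ⊓ ⨅ j ∈ A, Q j : Submodule K E) :=
      Submodule.finiteDimensional_of_le inf_le_left
    have h2 := finrank_le_finrank_inf_add
      (V := V ⊓ ⨅ j ∈ A, Q j) (Q := Q i) (F := F) (inf_le_left.trans hV)
    have h3 : V ⊓ ⨅ j ∈ insert i A, Q j = (V ⊓ ⨅ j ∈ A, Q j) ⊓ Q i := by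
      rw [Finset.iInf_insert, inf_assoc, inf_comm (Q i)]
    rw [h3, Finset.card_insert_of_notMem hi, add_mul]
    omega

end LinearAlgebra

section Products

variable {K R : Type*} [Field K] [CommRing R] [Algebra K R]

/-- If a space `T` of ring elements is spanned by `z` modulo `I`, then products of `e`
elements of `T` are spanned by `z ^ e` modulo `I`. -/
lemma prod_mem_sup_span_pow (I : Ideal R) (T : Submodule K R) (z : R)
    (hz : ∀ u ∈ T, ∃ c : K, u - c • z ∈ I) (σ : Multiset R) (hσ : ∀ u ∈ σ, u ∈ T) :
    ∃ c : K, σ.prod - c • z ^ σ.card ∈ I := by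
  induction σ using Multiset.induction_on with
  | empty => exact ⟨1, by simp⟩
  | cons u σ ih =>
    obtain ⟨c, hc⟩ := ih fun v hv => hσ v (Multiset.mem_cons_of_mem hv)
    obtain ⟨a, ha⟩ := hz u (hσ u (Multiset.mem_cons_self u σ))
    refine ⟨a * c, ?_⟩
    have := I.add_mem (I.mul_mem_left u hc) (I.mul_mem_left (c • z ^ σ.card) ha)
    convert this using 1
    simp only [Multiset.prod_cons, Multiset.card_cons, Algebra.smul_def, map_mul]
    ring

/-- If a space `T` of ring elements is spanned by `z ∈ T` modulo `I`, then products of `e + 1`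
elements of `T` lie in `z ^ e T` modulo `I ^ 2`. -/
lemma prod_mem_sq_sup_mul (I : Ideal R) (T : Submodule K R) (z : R) (hzT : z ∈ T)
    (hz : ∀ u ∈ T, ∃ c : K, u - c • z ∈ I) (e : ℕ) (σ : Multiset R) (he : σ.card = e + 1)
    (hσ : ∀ u ∈ σ, u ∈ T) :
    ∃ v ∈ T, σ.prod - z ^ e * v ∈ I ^ 2 := by
  induction e generalizing σ with
  | zero =>
    obtain ⟨u, rfl⟩ := Multiset.card_eq_one.1 he
    exact ⟨u, hσ u (by simp), by simp⟩
  | succ e ih =>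
    obtain ⟨u, hu⟩ := Multiset.card_pos_iff_exists_mem.1 (by omega : 0 < σ.card)
    obtain ⟨σ, rfl⟩ := Multiset.exists_cons_of_mem hu
    obtain ⟨v, hv, hσv⟩ := ih σ (by simpa using he) fun w hw => hσ w (Multiset.mem_cons_of_mem hw)
    have huT := hσ u hu
    obtain ⟨a, ha⟩ := hz u huT
    obtain ⟨c, hc⟩ := hz v hv
    refine ⟨a • v + c • (u - a • z), T.add_mem (T.smul_mem _ hv)
      (T.smul_mem _ (T.sub_mem huT (T.smul_mem _ hzT))), ?_⟩
    have := (I ^ 2).add_mem ((I ^ 2).mul_mem_left u hσv)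
      ((I ^ 2).mul_mem_left (z ^ e) (by rw [sq]; exact Ideal.mul_mem_mul ha hc))
    convert this using 1
    simp only [Multiset.prod_cons, Algebra.smul_def]
    ring

end Products

section LinearForms

variable {K ι : Type} [Field K]

lemma exists_sub_smul_mem_linIdeal (T : Submodule K (MvPolynomial ι K))
    (hT : T ≤ homogeneousSubmodule ι K 1) (S : Set (ι → K)) (hS : ∀ u ∈ T, ∀ x ∈ S, eval x u = 0)
    (w : ι → K) :
    ∃ z ∈ T, ∀ u ∈ T, ∃ c : K, u - c • z ∈ linIdeal K (S ∪ {w}) := by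
  have key : ∀ u ∈ T, eval w u = 0 → u ∈ linIdeal K (S ∪ {w}) := fun u hu hw =>
    Ideal.subset_span ⟨hT hu, by
      rintro x (hx | rfl)
      exacts [hS u hu x hx, hw]⟩
  by_cases h : ∃ z ∈ T, eval w z ≠ 0
  · obtain ⟨z, hz, hwz⟩ := h
    refine ⟨z, hz, fun u hu => ⟨eval w u / eval w z,
      key _ (T.sub_mem hu (T.smul_mem _ hz)) ?_⟩⟩
    simp [smul_eval, hwz]
  · push Not at h
    exact ⟨0, T.zero_mem, fun u hu => ⟨0, by simpa using key u hu (h u hu)⟩⟩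

lemma multiset_prod_map_X (σ : Multiset ι) [DecidableEq ι] :
    (σ.map (X : ι → MvPolynomial ι K)).prod = monomial (Multiset.toFinsupp σ) 1 := by
  induction σ using Multiset.induction_on with
  | empty => simp
  | cons i σ ih =>
    rw [Multiset.map_cons, Multiset.prod_cons, ih, ← Multiset.singleton_add, map_add,
      Multiset.toFinsupp_singleton, X, monomial_mul, one_mul]

lemma isHomogeneous_multiset_prod (σ : Multiset (MvPolynomial ι K))
    (h : ∀ u ∈ σ, u ∈ homogeneousSubmodule ι K 1) :
    σ.prod ∈ homogeneousSubmodule ι K σ.card := by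
  induction σ using Multiset.induction_on with
  | empty => exact isHomogeneous_one ι K
  | cons u σ ih =>
    rw [Multiset.prod_cons, Multiset.card_cons, add_comm]
    exact IsHomogeneous.mul (h u (by simp)) (ih fun v hv => h v (Multiset.mem_cons_of_mem hv))

lemma multiset_prod_mem_pow {R : Type*} [CommRing R] (I : Ideal R) (σ : Multiset R)
    (h : ∀ u ∈ σ, u ∈ I) : σ.prod ∈ I ^ σ.card := by
  induction σ using Multiset.induction_on with
  | empty => simp
  | cons u σ ih =>
    rw [Multiset.prod_cons, Multiset.card_cons, pow_succ']
    exact Ideal.mul_mem_mul (h u (by simp)) (ih fun v hv => h v (Multiset.mem_cons_of_mem hv))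

lemma finiteDimensional_homogeneousSubmodule [Finite ι] (e : ℕ) :
    FiniteDimensional K (homogeneousSubmodule ι K e) :=
  Submodule.finiteDimensional_of_le (S₂ := restrictTotalDegree ι K e) fun _ hp =>
    (mem_restrictTotalDegree _ _ _).2 (IsHomogeneous.totalDegree_le hp)

/-- The linear form whose coefficients are the entries of column `i` of the matrix `N`. -/
def dualForm [Fintype ι] (N : Matrix ι ι K) (i : ι) : MvPolynomial ι K :=
  ∑ c, N c i • X c

lemma dualForm_mem_span [Fintype ι] (N : Matrix ι ι K) (i : ι) :
    dualForm N i ∈ Submodule.span K (Set.range (X : ι → MvPolynomial ι K)) :=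
  Submodule.sum_mem _ fun c _ => Submodule.smul_mem _ _ (Submodule.subset_span ⟨c, rfl⟩)

lemma span_X_le_homogeneousSubmodule :
    Submodule.span K (Set.range (X : ι → MvPolynomial ι K)) ≤ homogeneousSubmodule ι K 1 :=
  Submodule.span_le.2 (by rintro _ ⟨c, rfl⟩; exact isHomogeneous_X K c)

lemma exists_finrank_le_double_point [Fintype ι] (w : ι → K) (d : ℕ) :
    ∃ F : Submodule K (MvPolynomial ι K), FiniteDimensional K F ∧
      Module.finrank K F ≤ Fintype.card ι ∧
      ∀ σ : Multiset (MvPolynomial ι K), σ.card = d + 1 →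
        (∀ u ∈ σ, u ∈ Submodule.span K (Set.range (X : ι → MvPolynomial ι K))) →
        σ.prod ∈ Submodule.restrictScalars K (linIdeal K {w} ^ 2) ⊔ F := by
  let T := Submodule.span K (Set.range (X : ι → MvPolynomial ι K))
  have hT : FiniteDimensional K T := FiniteDimensional.span_of_finite K (Set.finite_range _)
  obtain ⟨z, hz, hzu⟩ := exists_sub_smul_mem_linIdeal T span_X_le_homogeneousSubmodule ∅
    (by simp) w
  rw [Set.empty_union] at hzu
  refine ⟨T.map (LinearMap.mulLeft K (z ^ d)), inferInstance,
    (Submodule.finrank_map_le _ _).trans (finrank_range_le_card _), fun σ hσ hσT => ?_⟩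
  obtain ⟨v, hv, hvσ⟩ := prod_mem_sq_sup_mul _ T z hz hzu d σ hσ hσT
  exact Submodule.mem_sup.2 ⟨_, hvσ, _, ⟨v, hv, rfl⟩, by simp⟩

lemma exists_finrank_le_linear_space (T : Submodule K (MvPolynomial ι K))
    (hT : T ≤ homogeneousSubmodule ι K 1) (S : Set (ι → K)) (hS : ∀ u ∈ T, ∀ x ∈ S, eval x u = 0)
    (w : ι → K) (d : ℕ) {β : Type*} [Fintype β] (f : β → MvPolynomial ι K) :
    ∃ F : Submodule K (MvPolynomial ι K), FiniteDimensional K F ∧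
      Module.finrank K F ≤ Fintype.card β ∧
      ∀ i, ∀ σ : Multiset (MvPolynomial ι K), σ.card = d → (∀ u ∈ σ, u ∈ T) →
        f i * σ.prod ∈ Submodule.restrictScalars K (linIdeal K (S ∪ {w})) ⊔ F := by
  obtain ⟨z, -, hzu⟩ := exists_sub_smul_mem_linIdeal T hT S hS w
  refine ⟨Submodule.span K (Set.range fun i => f i * z ^ d),
    FiniteDimensional.span_of_finite K (Set.finite_range _), finrank_range_le_card _,
    fun i σ hσ hσT => ?_⟩
  obtain ⟨c, hc⟩ := prod_mem_sup_span_pow _ T z hzu σ hσT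
  rw [hσ] at hc
  exact Submodule.mem_sup.2 ⟨_, Ideal.mul_mem_left _ (f i) hc, _,
    Submodule.smul_mem _ c (Submodule.subset_span ⟨i, rfl⟩), by
      simp only [Algebra.smul_def]; ring⟩

variable [Fintype ι] [DecidableEq ι]

lemma eval_dualForm {M N : Matrix ι ι K} (h : M * N = 1) (i j : ι) :
    eval (M j) (dualForm N i) = if j = i then 1 else 0 := by
  rw [← Matrix.one_apply, ← h, Matrix.mul_apply, dualForm, map_sum]
  exact Finset.sum_congr rfl fun c _ => by rw [smul_eval, eval_X, mul_comm]

lemma aeval_dualForm_injective {M N : Matrix ι ι K} (h : M * N = 1) :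
    Function.Injective (aeval (dualForm N) : MvPolynomial ι K →ₐ[K] MvPolynomial ι K) := by
  let ψ : MvPolynomial ι K →ₐ[K] MvPolynomial ι K := aeval (dualForm M)
  have hψ : ψ.comp (aeval (dualForm N)) = AlgHom.id K _ := by
    ext1 i
    have hcomp : ψ (dualForm N i) = ∑ j, (M * N) j i • X j := by
      simp only [ψ, dualForm, map_sum, map_smul, aeval_X, Finset.smul_sum, Matrix.mul_apply,
        Finset.sum_smul, smul_smul]
      rw [Finset.sum_comm]
      exact Finset.sum_congr rfl fun j _ => Finset.sum_congr rfl fun c _ => by rw [mul_comm]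
    simp [hcomp, h, Matrix.one_apply]
  exact Function.LeftInverse.injective (g := ψ) fun p => DFunLike.congr_fun hψ p

/-- Products of the forms `L k` over distinct multisets of indices are linearly independent, when
the `L k` are dual to a basis. -/
lemma linearIndependent_prod_dualForm {M N : Matrix ι ι K} (h : M * N = 1) {α : Type*}
    (σ : α → Multiset ι) (hσ : Function.Injective σ) :
    LinearIndependent K fun p => ((σ p).map (dualForm N)).prod := by
  have h1 := ((basisMonomials ι K).linearIndependent.comp (fun p => Multiset.toFinsupp (σ p))
    (Multiset.toFinsupp.injective.comp hσ)).map'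
      (aeval (dualForm N) : MvPolynomial ι K →ₐ[K] MvPolynomial ι K).toLinearMap
      (LinearMap.ker_eq_bot.2 (aeval_dualForm_injective h))
  have h2 : (fun p => ((σ p).map (dualForm N)).prod) =
      (aeval (dualForm N) : MvPolynomial ι K →ₐ[K] MvPolynomial ι K).toLinearMap ∘
        basisMonomials ι K ∘ fun p => Multiset.toFinsupp (σ p) := by
    funext p
    simp [← multiset_prod_map_X, map_multiset_prod, Multiset.map_map, Function.comp_def]
  rw [h2]
  exact h1

lemma dualForm_mem_linIdeal {M N : Matrix ι ι K} (h : M * N = 1) {β : Type*} (r : β → ι) (i : ι)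
    (hi : ∀ k, r k ≠ i) : dualForm N i ∈ linIdeal K (Set.range fun k => M (r k)) :=
  Ideal.subset_span ⟨span_X_le_homogeneousSubmodule (dualForm_mem_span N i), by
    rintro _ ⟨k, rfl⟩
    rw [eval_dualForm h, if_neg (hi k)]⟩

end LinearForms

section Configuration

/-- Indices of the linear forms vanishing on `H₂`. -/
def idxX (n m : ℕ) (i : Fin (n + 1)) : Fin (n + m + 1) :=
  if h : (i : ℕ) < n then ⟨i, by omega⟩ else Fin.last _

/-- Indices of the linear forms vanishing on `H₁`. -/
def idxY (n m : ℕ) (j : Fin (m + 1)) : Fin (n + m + 1) :=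
  ⟨n + j, by omega⟩

lemma idxX_injective (n m : ℕ) : Function.Injective (idxX n m) := by
  intro i j h
  simp only [idxX, Fin.last] at h
  split_ifs at h <;> simp only [Fin.mk.injEq] at h <;> ext <;> omega

lemma idxY_injective (n m : ℕ) : Function.Injective (idxY n m) := by
  intro i j h
  simp only [idxY, Fin.mk.injEq] at h
  ext
  omega

/-- The multiset of indices of the linear factors of a product of one form vanishing on `H₂` and
`d` forms vanishing on `H₁`. -/
def idxMultiset (n m d : ℕ) (p : Fin (n + 1) × Sym (Fin (m + 1)) d) :
    Multiset (Fin (n + m + 1)) :=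
  idxX n m p.1 ::ₘ (p.2 : Multiset (Fin (m + 1))).map (idxY n m)

lemma idxMultiset_injective (n m d : ℕ) : Function.Injective (idxMultiset n m d) := by
  rintro ⟨i, σ⟩ ⟨j, τ⟩ h
  simp only [idxMultiset] at h
  have key : ∀ {i j : Fin (n + 1)} {σ τ : Sym (Fin (m + 1)) d},
      idxX n m i ::ₘ (σ : Multiset (Fin (m + 1))).map (idxY n m) =
        idxX n m j ::ₘ (τ : Multiset (Fin (m + 1))).map (idxY n m) →
      idxX n m i = idxX n m j ∨ (i : ℕ) = n := by
    intro i j σ τ h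
    have hi : idxX n m i ∈ idxX n m j ::ₘ (τ : Multiset (Fin (m + 1))).map (idxY n m) :=
      h ▸ Multiset.mem_cons_self _ _
    rcases Multiset.mem_cons.1 hi with hi | hi
    · exact Or.inl hi
    · right
      obtain ⟨k, -, hk⟩ := Multiset.mem_map.1 hi
      by_contra hne
      have hlt : (i : ℕ) < n := by omega
      simp only [idxX, idxY, hlt, dif_pos, Fin.mk.injEq] at hk
      omega
  have hij : i = j := by
    rcases key h with h1 | h1
    · exact idxX_injective n m h1
    · rcases key h.symm with h2 | h2
      · exact (idxX_injective n m h2).symm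
      · ext; omega
  subst hij
  rw [Multiset.cons_inj_right] at h
  rw [Sym.coe_injective (Multiset.map_injective (idxY_injective n m) h)]

end Configuration

/-- For `d ≥ 3`, `n, m ≥ 1` and any `s, t ∈ ℕ`, and a generic configuration of
`H₁ ≅ P^{n-1}`, `H₂ ≅ P^{m-1}`, `t` generic `n`-dimensional linear spaces `Wⱼ = ⟨H₁, wⱼ⟩`
containing `H₁` and `s` generic points of `P^{n+m}`, the scheme
`X = dH₁ + H₂ + 2pt₁ + ⋯ + 2pt_s + W₁ + ⋯ + W_t` satisfies
`dim (I_X)_{d+1} ≥ (n+1)·C(m+d,d) − s(n+m+1) − t(n+1)`. -/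
theorem stmt12 (K : Type) [Field K] [IsAlgClosed K] [CharZero K]
    (n m d s t : ℕ) (hd : 3 ≤ d) (hn : 1 ≤ n) (hm : 1 ≤ m) :
    ∃ g : MvPolynomial (ℕ × ℕ) K, g ≠ 0 ∧
      ∀ P : ℕ → ℕ → K, MvPolynomial.eval (fun ij => P ij.1 ij.2) g ≠ 0 →
        let a : Fin n → (Fin (n + m + 1) → K) := fun i c => P (i : ℕ) (c : ℕ)
        let b : Fin m → (Fin (n + m + 1) → K) := fun i c => P (n + (i : ℕ)) (c : ℕ)
        let w : Fin t → (Fin (n + m + 1) → K) := fun i c => P (n + m + (i : ℕ)) (c : ℕ)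
        let pt : Fin s → (Fin (n + m + 1) → K) := fun i c => P (n + m + t + (i : ℕ)) (c : ℕ)
        let IX : Ideal (MvPolynomial (Fin (n + m + 1)) K) :=
          (linIdeal K (Set.range a)) ^ d ⊓ linIdeal K (Set.range b)
            ⊓ (⨅ i : Fin s, (linIdeal K {pt i}) ^ 2)
            ⊓ (⨅ j : Fin t, linIdeal K (Set.range a ∪ {w j}))
        ((n + 1) * ((m + d).choose d) - s * (n + m + 1) - t * (n + 1) : ℤ)
          ≤ (Module.finrank K (piece K IX (d + 1)) : ℤ) := by
  classical
  let A : Matrix (Fin (n + m + 1)) (Fin (n + m + 1)) (MvPolynomial (ℕ × ℕ) K) :=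
    fun i j => X ((i : ℕ), (j : ℕ))
  have hA : ∀ P : ℕ → ℕ → K, eval (fun ij => P ij.1 ij.2) A.det =
      (Matrix.of fun i j : Fin (n + m + 1) => P i j).det := by
    intro P
    rw [RingHom.map_det]
    congr 1
    ext i j
    exact eval_X _
  refine ⟨A.det, fun h0 => ?_, fun P hP => ?_⟩
  · have h1 := hA fun i j => if i = j then 1 else 0
    have h2 : (Matrix.of fun i j : Fin (n + m + 1) => if (i : ℕ) = j then (1 : K) else 0) = 1 := by
      ext i j
      simp [Matrix.one_apply, Fin.ext_iff]
    rw [h0, h2] at h1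
    simp at h1
  intro a b w pt IX
  let M : Matrix (Fin (n + m + 1)) (Fin (n + m + 1)) K := Matrix.of fun i j => P i j
  have hM : M * M⁻¹ = 1 := Matrix.mul_nonsing_inv M (by
    rw [isUnit_iff_ne_zero, ← hA P]
    exact hP)
  let L := dualForm M⁻¹
  have hL : ∀ i, L i ∈ Submodule.span K (Set.range (X : _ → MvPolynomial (Fin (n + m + 1)) K)) :=
    dualForm_mem_span _
  have hY : ∀ j, L (idxY n m j) ∈ linIdeal K (Set.range a) := fun j =>
    dualForm_mem_linIdeal hM (fun k : Fin n => ⟨k, by omega⟩) _ fun k => by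
      simp only [idxY, ne_eq, Fin.mk.injEq]
      omega
  have hX : ∀ i, L (idxX n m i) ∈ linIdeal K (Set.range b) := fun i =>
    dualForm_mem_linIdeal hM (fun k : Fin m => ⟨n + k, by omega⟩) _ fun k => by
      simp only [idxX, Fin.last]
      split_ifs <;> simp only [ne_eq, Fin.mk.injEq] <;> omega
  let v : Fin (n + 1) × Sym (Fin (m + 1)) d → MvPolynomial (Fin (n + m + 1)) K :=
    fun p => ((idxMultiset n m d p).map L).prod
  have hvmul : ∀ p, v p = L (idxX n m p.1) *
      ((p.2 : Multiset (Fin (m + 1))).map fun j => L (idxY n m j)).prod := fun p => by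
    simp [v, idxMultiset, Multiset.map_map]
  have hv : LinearIndependent K v :=
    linearIndependent_prod_dualForm hM _ (idxMultiset_injective n m d)
  let V := Submodule.span K (Set.range v)
  have hVfin : FiniteDimensional K V := FiniteDimensional.span_of_finite K (Set.finite_range _)
  have hV : Module.finrank K V = (n + 1) * (m + d).choose d := by
    rw [finrank_span_eq_card hv, Fintype.card_prod, Fintype.card_fin, Sym.card_sym_eq_choose,
      Fintype.card_fin]
    congr 2
    omega
  have hcard : ∀ p, (idxMultiset n m d p).card = d + 1 := fun p => by simp [idxMultiset]
  have hpt := finrank_le_finrank_inf_iInf_add V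
    (fun i : Fin s => Submodule.restrictScalars K (linIdeal K {pt i} ^ 2)) (n + m + 1)
    Finset.univ fun i _ => by
      obtain ⟨F, hF, hFk, h⟩ := exists_finrank_le_double_point (pt i) d
      refine ⟨F, hF, by simpa using hFk, Submodule.span_le.2 ?_⟩
      rintro _ ⟨p, rfl⟩
      refine h _ (by simp [hcard]) fun u hu => ?_
      obtain ⟨k, -, rfl⟩ := Multiset.mem_map.1 hu
      exact hL k
  let V' := V ⊓ ⨅ i ∈ (Finset.univ : Finset (Fin s)),
    Submodule.restrictScalars K (linIdeal K {pt i} ^ 2)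
  have hV'fin : FiniteDimensional K V' := Submodule.finiteDimensional_of_le inf_le_left
  have hw := finrank_le_finrank_inf_iInf_add V'
    (fun j : Fin t => Submodule.restrictScalars K (linIdeal K (Set.range a ∪ {w j}))) (n + 1)
    Finset.univ fun j _ => by
      obtain ⟨F, hF, hFk, h⟩ := exists_finrank_le_linear_space
        (Submodule.span K (Set.range fun j => L (idxY n m j)))
        (Submodule.span_le.2 (by
          rintro _ ⟨j, rfl⟩
          exact span_X_le_homogeneousSubmodule (hL _)))
        (Set.range a) (fun u hu x hx => by
          have hle : Submodule.span K (Set.range fun j => L (idxY n m j)) ≤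
              LinearMap.ker (aeval x : MvPolynomial (Fin (n + m + 1)) K →ₐ[K] K).toLinearMap :=
            Submodule.span_le.2 (by
              rintro _ ⟨j, rfl⟩
              obtain ⟨k, rfl⟩ := hx
              refine (eval_dualForm hM (idxY n m j) ⟨k, by omega⟩).trans (if_neg ?_)
              simp only [idxY, Fin.mk.injEq]
              omega)
          exact hle hu)
        (w j) d (fun i => L (idxX n m i))
      refine ⟨F, hF, by simpa using hFk, inf_le_left.trans (Submodule.span_le.2 ?_)⟩
      rintro _ ⟨p, rfl⟩
      rw [hvmul]
      refine h _ _ (by simp) fun u hu => ?_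
      obtain ⟨k, -, rfl⟩ := Multiset.mem_map.1 hu
      exact Submodule.subset_span ⟨k, rfl⟩
  have hle : V' ⊓ ⨅ j ∈ (Finset.univ : Finset (Fin t)),
      Submodule.restrictScalars K (linIdeal K (Set.range a ∪ {w j})) ≤ piece K IX (d + 1) := by
    rintro f ⟨⟨hfV, hfpt⟩, hfw⟩
    have hVle : V ≤ Submodule.restrictScalars K
        (linIdeal K (Set.range a) ^ d ⊓ linIdeal K (Set.range b)) ⊓
          homogeneousSubmodule _ K (d + 1) := Submodule.span_le.2 (by
      rintro _ ⟨p, rfl⟩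
      refine ⟨⟨?_, ?_⟩, ?_⟩
      · rw [hvmul]
        refine Ideal.mul_mem_left _ _ ?_
        have := multiset_prod_mem_pow (linIdeal K (Set.range a))
          ((p.2 : Multiset (Fin (m + 1))).map fun j => L (idxY n m j)) fun u hu => by
            obtain ⟨k, -, rfl⟩ := Multiset.mem_map.1 hu
            exact hY k
        simpa using this
      · rw [hvmul]
        exact Ideal.mul_mem_right _ _ (hX _)
      · have := isHomogeneous_multiset_prod ((idxMultiset n m d p).map L) fun u hu => by
          obtain ⟨k, -, rfl⟩ := Multiset.mem_map.1 hu
          exact span_X_le_homogeneousSubmodule (hL k)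
        rwa [Multiset.card_map, hcard] at this)
    have h1 := hVle hfV
    simp only [SetLike.mem_coe, Finset.mem_univ, iInf_pos, Submodule.mem_iInf,
      Submodule.restrictScalars_mem] at hfpt hfw
    exact ⟨⟨⟨h1.1, (Ideal.mem_iInf).2 hfpt⟩, (Ideal.mem_iInf).2 hfw⟩, h1.2⟩
  have : FiniteDimensional K (piece K IX (d + 1)) :=
    have := finiteDimensional_homogeneousSubmodule (K := K) (ι := Fin (n + m + 1)) (d + 1)
    Submodule.finiteDimensional_of_le inf_le_right
  have hmono := Submodule.finrank_mono hle
  simp only [Finset.card_univ, Fintype.card_fin] at hpt hw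
  rw [hV] at hpt
  have : (n + 1) * (m + d).choose d ≤
      Module.finrank K (piece K IX (d + 1)) + s * (n + m + 1) + t * (n + 1) := by
    change _ ≤ Module.finrank K V' + _ at hpt
    omega
  zify at this
  linarith
end
end

section
/- Let H_1 ≅ P^{n-1} be a linear subspace of P^{n+m}, P_1, …, P_s points not on H_1, and V_i = ⟨H_1, P_i⟩ ≅ P^n the linear span of H_1 and P_i. Let Y be any scheme containing dH_1 + 2P_1 + ⋯ + 2P_s. Then each V_i lies in the base locus of the hypersurfaces of degree d+1 defined by forms of (I_Y)_{d+1}; consequently (I_Y)_{d+1} = (I_{Y + V_1 + ⋯ + V_s})_{d+1}. -/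
open MvPolynomial

noncomputable section

/-- A linear form vanishing on a set vanishes on its span. -/
lemma eval_eq_zero_of_mem_span {K : Type} [Field K] {ι : Type} {l : MvPolynomial ι K}
    (hl : l ∈ MvPolynomial.homogeneousSubmodule ι K 1) {S : Set (ι → K)}
    (hS : ∀ x ∈ S, eval x l = 0) {h : ι → K} (hh : h ∈ Submodule.span K S) : eval h l = 0 := by
  have hlin (a b : K) (x y : ι → K) : eval (a • x + b • y) l = a * eval x l + b * eval y l := by
    clear hS
    rw [homogeneousSubmodule_one_eq_span_X] at hl
    induction hl using Submodule.span_induction with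
    | mem z hz => obtain ⟨i, rfl⟩ := hz; simp
    | zero => simp
    | add z w _ _ hz hw => simp only [map_add, hz, hw]; ring
    | smul c z _ hz => simp only [smul_eval, hz]; ring
  induction hh using Submodule.span_induction with
  | mem x hx => exact hS x hx
  | zero => simpa using hlin 0 0 0 0
  | add x y _ _ hx hy => simpa [hx, hy] using hlin 1 1 x y
  | smul c x _ hx => simpa [hx] using hlin c 0 x 0

/-- Substituting a point of the parametrised line through `h` and `p` into a linear form. -/
lemma aeval_line_of_mem_homogeneousSubmodule_one {K : Type} [Field K] {ι : Type} (h p : ι → K)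
    {l : MvPolynomial ι K} (hl : l ∈ MvPolynomial.homogeneousSubmodule ι K 1) :
    MvPolynomial.aeval (fun i => C (h i) * X 0 + C (p i) * X 1 : ι → MvPolynomial (Fin 2) K) l
      = C (eval h l) * X 0 + C (eval p l) * X 1 := by
  rw [homogeneousSubmodule_one_eq_span_X] at hl
  induction hl using Submodule.span_induction with
  | mem x hx => obtain ⟨i, rfl⟩ := hx; simp
  | zero => simp
  | add x y _ _ hx hy => simp only [map_add, hx, hy]; ring
  | smul c x _ hx => rw [map_smul, hx, smul_eval, smul_eval]; simp only [smul_eq_C_mul, C_mul]; ring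

/-- If the image of every linear form vanishing on `S` is divisible by `q`, then the image of
the `k`-th power of `linIdeal K S` is divisible by `q ^ k`. -/
lemma pow_dvd_map_of_mem_linIdeal_pow {K : Type} [Field K] {ι : Type} {R : Type*} [CommRing R]
    (φ : MvPolynomial ι K →+* R) (q : R) {S : Set (ι → K)}
    (hφ : ∀ l ∈ MvPolynomial.homogeneousSubmodule ι K 1, (∀ x ∈ S, eval x l = 0) → q ∣ φ l)
    {k : ℕ} {f : MvPolynomial ι K} (hf : f ∈ linIdeal K S ^ k) : q ^ k ∣ φ f := by
  have hle : (linIdeal K S).map φ ≤ Ideal.span {q} := by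
    rw [linIdeal, Ideal.map_span, Ideal.span_le]
    rintro _ ⟨l, ⟨hl, hl'⟩, rfl⟩
    exact Ideal.mem_span_singleton.2 (hφ l hl hl')
  rw [← Ideal.mem_span_singleton, ← Ideal.span_singleton_pow]
  refine Ideal.pow_right_mono hle k ?_
  rw [← Ideal.map_pow]
  exact Ideal.mem_map_of_mem φ hf

lemma le_of_X_pow_dvd_of_coeff_ne_zero {K σ : Type*} [CommSemiring K] {i : σ} {k : ℕ}
    {f : MvPolynomial σ K} (hf : (X i : MvPolynomial σ K) ^ k ∣ f) {e : σ →₀ ℕ}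
    (he : coeff e f ≠ 0) : k ≤ e i := by
  classical
  obtain ⟨g, rfl⟩ := hf
  rw [X_pow_eq_monomial, coeff_monomial_mul'] at he
  have hle : Finsupp.single i k ≤ e := by
    by_contra hne
    exact he (if_neg hne)
  simpa using hle i

/-- A form of degree `d + 1` vanishing to order `d` along a linear space and to order `2` at a
point `p` vanishes on each line joining `p` to that linear space. -/
lemma eval_add_smul_eq_zero {K : Type} [Field K] {ι : Type} {S : Set (ι → K)} {p h : ι → K}
    (hh : h ∈ Submodule.span K S) {d : ℕ} {f : MvPolynomial ι K} (hf : f.IsHomogeneous (d + 1))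
    (hS : f ∈ linIdeal K S ^ d) (hp : f ∈ linIdeal K {p} ^ 2) (c : K) :
    eval (h + c • p) f = 0 := by
  set φ : MvPolynomial ι K →ₐ[K] MvPolynomial (Fin 2) K := MvPolynomial.aeval
    (fun i => C (h i) * X 0 + C (p i) * X 1 : ι → MvPolynomial (Fin 2) K) with hφ
  have hhom : (φ f).IsHomogeneous (1 * (d + 1)) :=
    hf.aeval _ fun i => (isHomogeneous_C_mul_X _ _).add (isHomogeneous_C_mul_X _ _)
  have h1 : (X 1 : MvPolynomial (Fin 2) K) ^ d ∣ φ f := by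
    refine pow_dvd_map_of_mem_linIdeal_pow φ.toRingHom _ (fun l hl hl' => ?_) hS
    have hz : eval h l = 0 := eval_eq_zero_of_mem_span hl hl' hh
    change _ ∣ φ l
    rw [hφ, aeval_line_of_mem_homogeneousSubmodule_one h p hl, hz]
    simp
  have h0 : (X 0 : MvPolynomial (Fin 2) K) ^ 2 ∣ φ f := by
    refine pow_dvd_map_of_mem_linIdeal_pow φ.toRingHom _ (fun l hl hl' => ?_) hp
    change _ ∣ φ l
    rw [hφ, aeval_line_of_mem_homogeneousSubmodule_one h p hl, hl' p rfl]
    simp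
  have hzero : φ f = 0 := by
    ext e
    rw [coeff_zero]
    by_contra he
    have hdeg := hhom he
    rw [Finsupp.weight_apply, Finsupp.sum_fintype _ _ (by simp), Fin.sum_univ_two] at hdeg
    have := le_of_X_pow_dvd_of_coeff_ne_zero h0 he
    have := le_of_X_pow_dvd_of_coeff_ne_zero h1 he
    simp at hdeg
    omega
  have hcomp : eval (h + c • p) f = eval ![1, c] (φ f) := by
    rw [hφ, ← MvPolynomial.coe_aeval_eq_eval, ← MvPolynomial.coe_aeval_eq_eval]
    simp only [RingHom.coe_coe]
    rw [← AlgHom.comp_apply, comp_aeval]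
    congr 2
    ext i
    simp [mul_comm]
  rw [hcomp, hzero, map_zero]

/-- A polynomial vanishing on a linear subspace lies in the ideal generated by the linear forms
vanishing on it. -/
lemma mem_linIdeal_of_forall_eval_eq_zero {K : Type} [Field K] [Infinite K] {ι : Type} [Finite ι]
    {S : Set (ι → K)} {f : MvPolynomial ι K} (hf : ∀ v ∈ Submodule.span K S, eval v f = 0) :
    f ∈ linIdeal K S := by
  classical
  cases nonempty_fintype ι
  obtain ⟨π, hπ⟩ := (LinearMap.id : Submodule.span K S →ₗ[K] _).exists_extend
  let g : ι → MvPolynomial ι K := fun i => ∑ j, C ((π (Pi.single j 1) : ι → K) i) * X j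
  have hg (x : ι → K) (i : ι) : eval x (g i) = (π x : ι → K) i := by
    conv_rhs => rw [← (Pi.basisFun K ι).sum_repr x]
    simp [g, mul_comm]
  have hgf : aeval g f = 0 := by
    refine MvPolynomial.funext fun x => ?_
    rw [map_zero, ← hf _ (π x).2, ← MvPolynomial.coe_aeval_eq_eval,
      ← MvPolynomial.coe_aeval_eq_eval]
    simp only [RingHom.coe_coe]
    rw [← AlgHom.comp_apply, comp_aeval]
    congr 2
    ext i
    simpa using hg x i
  have hX (i : ι) : X i - g i ∈ linIdeal K S := by
    refine Ideal.subset_span ⟨sub_mem (isHomogeneous_X _ _) (sum_mem fun j _ =>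
      isHomogeneous_C_mul_X _ _), fun x hx => ?_⟩
    have hπx := LinearMap.congr_fun hπ ⟨x, Submodule.subset_span hx⟩
    simp only [LinearMap.comp_apply, Submodule.subtype_apply, LinearMap.id_apply] at hπx
    rw [map_sub, hg, hπx, eval_X, sub_self]
  have hmk : Ideal.Quotient.mkₐ K (linIdeal K S) = (Ideal.Quotient.mkₐ K (linIdeal K S)).comp
      (aeval g) := by
    ext i
    simpa using Ideal.Quotient.eq.2 (hX i)
  have := DFunLike.congr_fun hmk f
  rw [AlgHom.comp_apply, hgf, map_zero] at this
  exact Ideal.Quotient.eq_zero_iff_mem.1 this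

/-- Let `H₁ ≅ P^{n-1} ⊂ P^{n+m}` (spanned by the independent vectors `a₁,…,aₙ`), let
`p₁,…,p_s` be points not on `H₁`, and let `Vᵢ = ⟨H₁, pᵢ⟩ ≅ P^n`.  Let `Y` be any scheme
containing `dH₁ + 2p₁ + ⋯ + 2p_s`, i.e. its ideal `J` satisfies
`J ≤ I_{H₁}^d ⊓ ⨅ᵢ I_{pᵢ}²`.  Then each `Vᵢ` lies in the base locus of the degree-`d+1`
hypersurfaces defined by forms of `(I_Y)_{d+1}`; consequently
`(I_Y)_{d+1} = (I_{Y+V₁+⋯+V_s})_{d+1}`. -/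
theorem stmt13 (K : Type) [Field K] [IsAlgClosed K] [CharZero K]
    (n m d s : ℕ) (hn : 1 ≤ n)
    (a : Fin n → (Fin (n + m + 1) → K)) (ha : LinearIndependent K a)
    (p : Fin s → (Fin (n + m + 1) → K)) (hp0 : ∀ i, p i ≠ 0)
    (hp : ∀ i, p i ∉ Submodule.span K (Set.range a))
    (J : Ideal (MvPolynomial (Fin (n + m + 1)) K))
    (hJ : J ≤ (linIdeal K (Set.range a)) ^ d ⊓ ⨅ i : Fin s, (linIdeal K {p i}) ^ 2) :
    (∀ f ∈ piece K J (d + 1), ∀ i : Fin s,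
        ∀ v ∈ Submodule.span K (Set.range a ∪ {p i}), MvPolynomial.eval v f = 0) ∧
    piece K J (d + 1)
      = piece K (J ⊓ ⨅ i : Fin s, linIdeal K (Set.range a ∪ {p i})) (d + 1) := by
  have hbase : ∀ f ∈ piece K J (d + 1), ∀ i : Fin s,
      ∀ v ∈ Submodule.span K (Set.range a ∪ {p i}), MvPolynomial.eval v f = 0 := by
    rintro f ⟨hfJ, hf⟩ i v hv
    obtain ⟨hfa, hfp⟩ := hJ hfJ
    rw [Submodule.span_union, Submodule.mem_sup] at hv
    obtain ⟨h, hh, y, hy, rfl⟩ := hv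
    obtain ⟨c, rfl⟩ := Submodule.mem_span_singleton.1 hy
    exact eval_add_smul_eq_zero hh hf hfa ((Submodule.mem_iInf _).1 hfp i) c
  refine ⟨hbase, le_antisymm (fun f hf => ⟨⟨hf.1, ?_⟩, hf.2⟩) fun f hf => ⟨hf.1.1, hf.2⟩⟩
  exact (Submodule.mem_iInf _).2 fun i => mem_linIdeal_of_forall_eval_eq_zero (hbase f hf i)
end
end
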